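/- (Bombieri–Davenport) One has liminf_{n→∞} (p_{n+1} − p_n)/log p_n ≤ 0.46650. -/

import Mathlib

open Real Filter

/-- `nthPrime n` is the `n`-th prime number `p_n` (so `p_1 = 2`, `p_2 = 3`, ...). -/
noncomputable def nthPrime (n : ℕ) : ℕ := Nat.nth Nat.Prime (n - 1)

namespace BD
open Finset Topology
lemma abel {a f : ℕ → ℂ} {b : ℕ → ℝ} (hb : Summable b)
    (hB : ∀ n, ‖∑ m ∈ range (n+1), a m‖ * ‖f (n+1) - f n‖ ≤ b n)
    (hf : Tendsto (fun N => (∑ n ∈ range N, a n) * f N) atTop (𝓝 0))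
    (hs : Summable fun n => a n * f n) :
    ‖∑' n, a n * f n‖ ≤ ∑' n, b n := by
  have h1 := hs.hasSum.tendsto_sum_nat
  have hb0 : ∀ n, 0 ≤ b n := fun n => le_trans (by positivity) (hB n)
  have key : ∀ N, ‖∑ n ∈ range N, a n * f n‖ ≤ ‖(∑ n ∈ range N, a n) * f N‖ + ∑' n, b n := by
    intro N
    have e : ∑ n ∈ range N, a n * f n = (∑ n ∈ range N, a n) * f N
        - ∑ n ∈ range N, (∑ m ∈ range (n+1), a m) * (f (n+1) - f n) := by
      induction N with
      | zero => simp
      | succ N ih =>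
        rw [sum_range_succ, ih, sum_range_succ (fun n => (∑ m ∈ range (n+1), a m) * (f (n+1) - f n)) N,
          sum_range_succ a N]; ring
    rw [e]
    refine (norm_sub_le _ _).trans (add_le_add le_rfl ?_)
    refine (norm_sum_le_of_le _ fun n _ => ?_).trans (hb.sum_le_tsum (range N) fun n _ => hb0 n)
    rw [norm_mul]; exact hB n
  have h2 : Tendsto (fun N => ‖(∑ n ∈ range N, a n) * f N‖ + ∑' n, b n) atTop
      (𝓝 (0 + ∑' n, b n)) := Tendsto.add_const _ (by simpa using hf.norm)
  simpa using le_of_tendsto_of_tendsto' h1.norm h2 key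
lemma periodic_sum_bound {a : ℕ → ℂ} {q : ℕ} (ha : ∀ n, ‖a n‖ ≤ 1) (hp : ∀ n, a (q + n) = a n)
    (hq : 0 < q) (h0 : ∑ n ∈ range q, a n = 0) (N : ℕ) : ‖∑ n ∈ range N, a n‖ ≤ q := by
  induction N using Nat.strong_induction_on with
  | _ N ih =>
    rcases lt_or_ge N q with h | h
    · calc _ ≤ ∑ n ∈ range N, (1:ℝ) := norm_sum_le_of_le _ fun n _ => ha n
        _ ≤ q := by simp; exact h.le
    · obtain ⟨M, rfl⟩ := Nat.exists_eq_add_of_le h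
      rw [sum_range_add, h0, zero_add]
      simp_rw [hp]
      exact ih M (by omega)
lemma char_period_sum {q : ℕ} [NeZero q] (g : ZMod q → ℂ) :
    ∑ n ∈ range q, g (n : ZMod q) = ∑ x : ZMod q, g x := by
  refine sum_bij' (fun n _ => (n : ZMod q)) (fun x _ => x.val) ?_ ?_ ?_ ?_ ?_
  · simp
  · intro x _; simpa using ZMod.val_lt x
  · intro n hn; exact ZMod.val_cast_of_lt (by simpa using hn)
  · simp
  · simp
lemma char_sum_bound {q : ℕ} [NeZero q] {χ : DirichletCharacter ℂ q} (hχ : χ ≠ 1) (N : ℕ) :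
    ‖∑ n ∈ range N, χ n‖ ≤ q := by
  refine periodic_sum_bound (fun n => DirichletCharacter.norm_le_one χ _) (by simp)
    (NeZero.pos q) ?_ N
  rw [char_period_sum]
  exact MulChar.sum_eq_zero_of_ne_one hχ
end BD
namespace BD
open Finset Topology
lemma log_pow_le (r : ℕ) {ε : ℝ} (hε : 0 < ε) :
    ∃ K : ℝ, 0 < K ∧ ∀ u : ℝ, 1 ≤ u → (1 + log u)^r ≤ K * u^ε := by
  set δ := ε / (r+1) with hδ
  have hδ0 : 0 < δ := by positivity
  refine ⟨(1 + 1/δ)^r, by positivity, fun u hu => ?_⟩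
  have h1 : 1 + log u ≤ (1 + 1/δ) * u^δ := by
    have := log_le_rpow_div (by linarith : 0 ≤ u) hδ0
    have h2 := one_le_rpow hu hδ0.le
    have : u^δ/δ = 1/δ * u^δ := by ring
    nlinarith
  calc (1 + log u)^r ≤ ((1 + 1/δ) * u^δ)^r :=
        pow_le_pow_left₀ (by have := log_nonneg hu; linarith) h1 r
    _ = (1 + 1/δ)^r * u^(δ*r) := by rw [mul_pow, ← rpow_natCast (u^δ), ← rpow_mul (by linarith)]
    _ ≤ _ := by
        gcongr
        · rw [hδ, div_mul_eq_mul_div, div_le_iff₀ (by positivity)]; nlinarith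
noncomputable def g (r : ℕ) (s : ℂ) (n : ℕ) : ℂ := if n = 0 then 0 else (Real.log n : ℂ)^r / (n:ℂ)^s
lemma g_diff (r : ℕ) {ε : ℝ} (hε : 0 < ε) (hε1 : ε ≤ 1) : ∃ K : ℝ, 0 < K ∧ ∀ s : ℂ, 1 < s.re → s.re ≤ 2 → ∀ n,
    ‖g r s (n+1) - g r s n‖ ≤ K * (1 + |s.im|) * ((n:ℝ)+1)^(-2+ε) := by
  obtain ⟨K1, hK1, hK⟩ := log_pow_le r hε
  refine ⟨4 * ((r + 2) * K1) + 1, by positivity, fun s hs hs2 n => ?_⟩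
  have ht : 0 ≤ |s.im| := abs_nonneg _
  rcases Nat.eq_zero_or_pos n with rfl | hn
  · have : ‖g r s (0+1) - g r s 0‖ ≤ 1 := by
      simp only [g]; rcases Nat.eq_zero_or_pos r with rfl | hr
      · simp
      · simp [hr.ne']
    refine this.trans ?_
    simp only [Nat.cast_zero, zero_add, one_rpow, mul_one]
    have : 0 ≤ 4 * ((r + 2) * K1) := by positivity
    nlinarith
  have hn1 : (1:ℝ) ≤ n := by exact_mod_cast hn
  let G : ℝ → ℂ := fun u => (Real.log u : ℂ)^r * (u:ℂ)^(-s)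
  have hG : ∀ m : ℕ, 0 < m → g r s m = G m := by
    intro m hm
    simp [g, G, hm.ne', Complex.cpow_neg, div_eq_mul_inv]
  have hder : ∀ u ∈ Set.Icc (n:ℝ) (n+1), HasDerivWithinAt G
      ((r * (Real.log u : ℂ)^(r-1) * ((u⁻¹ : ℝ):ℂ)) * (u:ℂ)^(-s) + (Real.log u : ℂ)^r * (-s * (u:ℂ)^(-s-1)))
      (Set.Icc (n:ℝ) (n+1)) u := by
    intro u hu
    have hu0 : 0 < u := by linarith [hu.1]
    refine HasDerivAt.hasDerivWithinAt ?_
    refine HasDerivAt.mul ?_ ?_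
    · exact ((Real.hasDerivAt_log hu0.ne').ofReal_comp).pow r
    · exact hasDerivAt_ofReal_cpow_const hu0.ne' (by
        intro h
        have := congrArg Complex.re h
        simp at this; linarith)
  have hbd : ∀ u ∈ Set.Icc (n:ℝ) (n+1), ‖(r * (Real.log u : ℂ)^(r-1) * ((u⁻¹ : ℝ):ℂ)) * (u:ℂ)^(-s)
      + (Real.log u : ℂ)^r * (-s * (u:ℂ)^(-s-1))‖ ≤ (r + 2 + |s.im|) * K1 * (n:ℝ)^(-2+ε) := by
    intro u hu
    have hu1 : 1 ≤ u := by linarith [hu.1]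
    have hu0 : 0 < u := by linarith [hu.1]
    have hl := log_nonneg hu1
    have hns : ‖s‖ ≤ 2 + |s.im| := (Complex.norm_le_abs_re_add_abs_im s).trans (by
      rw [abs_of_pos (by linarith)]; linarith)
    have e1 : ‖(u:ℂ)^(-s)‖ ≤ u^(-1:ℝ) := by
      rw [Complex.norm_cpow_eq_rpow_re_of_pos hu0]
      exact rpow_le_rpow_of_exponent_le hu1 (by simp; linarith)
    have e2 : ‖(u:ℂ)^(-s-1)‖ ≤ u^(-2:ℝ) := by
      rw [Complex.norm_cpow_eq_rpow_re_of_pos hu0]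
      exact rpow_le_rpow_of_exponent_le hu1 (by simp; linarith)
    have e3 : u^(-1:ℝ) * u⁻¹ = u^(-2:ℝ) := by
      rw [← rpow_neg_one u, ← rpow_add hu0]; norm_num
    have e4 : (log u)^(r-1) ≤ (1 + log u)^r :=
      (pow_le_pow_left₀ hl (by linarith) _).trans (pow_le_pow_right₀ (by linarith) (by omega))
    have e5 : (log u)^r ≤ (1 + log u)^r := pow_le_pow_left₀ hl (by linarith) _
    calc _ ≤ r * (log u)^(r-1) * u⁻¹ * u^(-1:ℝ) + (log u)^r * ((2 + |s.im|) * u^(-2:ℝ)) := by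
          refine (norm_add_le _ _).trans (add_le_add ?_ ?_)
          · simp only [norm_mul, norm_pow, Complex.norm_real, Complex.norm_natCast, norm_inv,
              norm_of_nonneg hl, norm_of_nonneg hu0.le]
            gcongr
          · simp only [norm_mul, norm_pow, Complex.norm_real, norm_neg, norm_of_nonneg hl]
            gcongr
      _ = (r * (log u)^(r-1) + (log u)^r * (2 + |s.im|)) * u^(-2:ℝ) := by rw [← e3]; ring
      _ ≤ (r * (1 + log u)^r + (1 + log u)^r * (2 + |s.im|)) * u^(-2:ℝ) := by gcongr
      _ = (r + 2 + |s.im|) * (1 + log u)^r * u^(-2:ℝ) := by ring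
      _ ≤ (r + 2 + |s.im|) * (K1 * u^ε) * u^(-2:ℝ) := by gcongr; exact hK u hu1
      _ = (r + 2 + |s.im|) * K1 * u^(-2+ε) := by rw [rpow_add hu0]; ring
      _ ≤ _ := by
          have := rpow_le_rpow_of_nonpos (by linarith : 0 < (n:ℝ)) hu.1 (by linarith : -2+ε ≤ 0)
          gcongr
  have := Convex.norm_image_sub_le_of_norm_hasDerivWithin_le (𝕜 := ℝ) (x := (n:ℝ)) (y := (n:ℝ)+1)
    (f' := fun u => (r * (Real.log u : ℂ)^(r-1) * ((u⁻¹ : ℝ):ℂ)) * (u:ℂ)^(-s)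
      + (Real.log u : ℂ)^r * (-s * (u:ℂ)^(-s-1))) hder hbd (convex_Icc _ _) (by simp) (by simp)
  rw [hG _ n.succ_pos, hG n hn]
  push_cast
  refine this.trans ?_
  have h4 : (n:ℝ)^(-2+ε) ≤ 4 * ((n:ℝ)+1)^(-2+ε) := by
    have h2 : ((2:ℝ) * n)^(-2+ε) ≤ ((n:ℝ)+1)^(-2+ε) :=
      rpow_le_rpow_of_nonpos (by linarith) (by linarith) (by linarith)
    have h5 : (2:ℝ)^(2-ε) ≤ 4 := by
      calc (2:ℝ)^(2-ε) ≤ 2^(2:ℝ) := rpow_le_rpow_of_exponent_le (by norm_num) (by linarith)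
        _ = 4 := by norm_num
    have h6 : (n:ℝ)^(-2+ε) = (2:ℝ)^(2-ε) * ((2:ℝ) * n)^(-2+ε) := by
      rw [mul_rpow (by norm_num) (by linarith), ← mul_assoc, ← rpow_add (by norm_num)]
      norm_num
    rw [h6]; gcongr
  have h7 : (r + 2 + |s.im|) ≤ (r+2) * (1 + |s.im|) := by nlinarith [Nat.cast_nonneg (α := ℝ) r]
  calc _ = (r + 2 + |s.im|) * K1 * (n:ℝ)^(-2+ε) := by simp
    _ ≤ ((r+2) * (1 + |s.im|)) * K1 * (4 * ((n:ℝ)+1)^(-2+ε)) := by gcongr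
    _ = (4 * ((r + 2) * K1)) * (1 + |s.im|) * ((n:ℝ)+1)^(-2+ε) := by ring
    _ ≤ _ := by gcongr; linarith
lemma g_norm_tendsto (r : ℕ) {s : ℂ} (hs : 1 < s.re) : Tendsto (g r s) atTop (𝓝 0) := by
  obtain ⟨K, hK, h⟩ := log_pow_le r (half_pos one_pos)
  have : Tendsto (fun n : ℕ => K * ((n:ℝ)^(-(1/2):ℝ))) atTop (𝓝 (K * 0)) :=
    ((tendsto_rpow_neg_atTop (by norm_num)).comp tendsto_natCast_atTop_atTop).const_mul K
  rw [mul_zero] at this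
  refine squeeze_zero_norm' ?_ this
  filter_upwards [eventually_ge_atTop 1] with n hn
  have hn1 : (1:ℝ) ≤ n := by exact_mod_cast hn
  have hn0 : (0:ℝ) < n := by linarith
  have hl := log_nonneg hn1
  rw [g, if_neg (by omega), norm_div, Complex.norm_natCast_cpow_of_pos hn, norm_pow, Complex.norm_real,
    norm_of_nonneg hl, div_le_iff₀ (by positivity)]
  calc (log n)^r ≤ (1 + log n)^r := pow_le_pow_left₀ hl (by linarith) _
    _ ≤ K * (n:ℝ)^(1/2:ℝ) := h n hn1
    _ ≤ K * (n:ℝ)^(-(1/2) + s.re) := by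
      gcongr
      linarith
    _ = _ := by rw [rpow_add hn0]; ring
lemma sum_rpow (δ : ℝ) (hδ : 0 < δ) : Summable fun n : ℕ => ((n:ℝ)+1)^(-1-δ) := by
  have := (Real.summable_nat_rpow (p := -1-δ)).2 (by linarith)
  simpa using (summable_nat_add_iff 1).2 this
lemma a_g_summable (r : ℕ) {s : ℂ} (hs : 1 < s.re) {a : ℕ → ℂ} {A : ℝ} (ha : ∀ n, ‖a n‖ ≤ A) :
    Summable fun n => a n * g r s n := by
  obtain ⟨K, hK, h⟩ := log_pow_le r (half_pos (sub_pos.2 hs))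
  have hA : 0 ≤ A := (norm_nonneg _).trans (ha 0)
  refine Summable.of_norm_bounded (g := fun n : ℕ => A * (K * ((n:ℝ)^(-1-(s.re-1)/2)))) ?_ ?_
  · exact ((Real.summable_nat_rpow.2 (by linarith)).mul_left K).mul_left A
  intro n
  rw [norm_mul]
  gcongr
  · exact ha n
  rcases Nat.eq_zero_or_pos n with rfl | hn
  · simp [g]; positivity
  have hn1 : (1:ℝ) ≤ n := by exact_mod_cast hn
  have hn0 : (0:ℝ) < n := by linarith
  have hl := log_nonneg hn1
  rw [g, if_neg (by omega), norm_div, Complex.norm_natCast_cpow_of_pos hn, norm_pow, Complex.norm_real,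
    norm_of_nonneg hl, div_le_iff₀ (by positivity)]
  calc (log n)^r ≤ (1 + log n)^r := pow_le_pow_left₀ hl (by linarith) _
    _ ≤ _ := h n hn1
    _ = _ := by rw [mul_assoc, ← rpow_add hn0]; congr 2; ring
lemma sum_tendsto (r : ℕ) {s : ℂ} (hs : 1 < s.re) {a : ℕ → ℂ} {B : ℝ}
    (hB : ∀ N, ‖∑ n ∈ range N, a n‖ ≤ B) :
    Tendsto (fun N => (∑ n ∈ range N, a n) * g r s N) atTop (𝓝 0) := by
  have := (g_norm_tendsto r hs).norm.const_mul B
  simp only [norm_zero, mul_zero] at this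
  refine squeeze_zero_norm (fun n => ?_) this
  rw [norm_mul]; gcongr; exact hB n
lemma sum_le_card {a : ℕ → ℂ} (ha : ∀ n, ‖a n‖ ≤ 1) (N : ℕ) : ‖∑ n ∈ range N, a n‖ ≤ N := by
  simpa using norm_sum_le_of_le (range N) fun n _ => ha n
lemma series_bound (r : ℕ) {ε : ℝ} (hε : 0 < ε) (hε1 : ε ≤ 1) : ∃ K : ℝ, 1 ≤ K ∧ ∀ (a : ℕ → ℂ) (B : ℝ),
    (∀ n, ‖a n‖ ≤ 1) → (∀ N, ‖∑ n ∈ range N, a n‖ ≤ B) → ∀ s : ℂ, 1 < s.re → s.re ≤ 2 →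
    ‖∑' n, a n * g r s n‖ ≤ K * (1 + |s.im|) * B^ε := by
  obtain ⟨K, hK, h⟩ := g_diff r (half_pos hε) (by linarith)
  have hS := sum_rpow (ε/2) (half_pos hε)
  set S := ∑' n : ℕ, ((n:ℝ)+1)^(-1-ε/2) with hSd
  have hS0 : 0 ≤ S := tsum_nonneg fun n => by positivity
  refine ⟨K * S + 1, by nlinarith [mul_nonneg hK.le hS0], fun a B ha hB s hs hs2 => ?_⟩
  have hB0 : 0 ≤ B := (norm_nonneg _).trans (hB 0)
  have := abel (a := a) (f := g r s) (b := fun n => K * (1 + |s.im|) * B^ε * ((n:ℝ)+1)^(-1-ε/2))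
    (hS.mul_left _) ?_ (sum_tendsto r hs hB) (a_g_summable r hs ha)
  · refine this.trans ?_
    rw [tsum_mul_left, ← hSd]
    have : 0 ≤ (1 + |s.im|) * B^ε := by positivity
    nlinarith
  intro n
  have hn0 : (0:ℝ) < (n:ℝ)+1 := by positivity
  have h1 : ‖∑ m ∈ range (n+1), a m‖ ≤ B^ε * ((n:ℝ)+1)^(1-ε) := by
    set X := ‖∑ m ∈ range (n+1), a m‖ with hX
    have hX0 : 0 ≤ X := norm_nonneg _
    have hXn : X ≤ (n:ℝ)+1 := by have := sum_le_card ha (n+1); push_cast at this; exact this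
    calc X = X^ε * X^(1-ε) := by
          rw [← rpow_add_of_nonneg hX0 hε.le (by linarith)]; simp
      _ ≤ _ := by gcongr; exact hB _
  calc _ ≤ (B^ε * ((n:ℝ)+1)^(1-ε)) * (K * (1 + |s.im|) * ((n:ℝ)+1)^(-2+ε/2)) := by
        gcongr; exact h s hs hs2 n
    _ = K * (1 + |s.im|) * B^ε * (((n:ℝ)+1)^(1-ε) * ((n:ℝ)+1)^(-2+ε/2)) := by ring
    _ = _ := by rw [← rpow_add hn0]; congr 2; ring
lemma tail_bound (r : ℕ) : ∃ K : ℝ, 1 ≤ K ∧ ∀ (a : ℕ → ℂ) (B : ℝ) (N : ℕ), 1 ≤ N →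
    (∀ n, ‖a n‖ ≤ 1) → (∀ N, ‖∑ n ∈ range N, a n‖ ≤ B) → ∀ s : ℂ, 1 < s.re → s.re ≤ 2 →
    ‖∑' n, (if N < n then a n else 0) * g r s n‖ ≤ K * (1 + |s.im|) * B * (N:ℝ)^(-(1/2):ℝ) := by
  obtain ⟨K, hK, h⟩ := g_diff r (ε := 1/4) (by norm_num) (by norm_num)
  have hS := sum_rpow (1/4) (by norm_num)
  set S := ∑' n : ℕ, ((n:ℝ)+1)^(-1-1/4:ℝ) with hSd
  have hS0 : 0 ≤ S := tsum_nonneg fun n => by positivity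
  refine ⟨2 * K * S + 1, by nlinarith [mul_nonneg hK.le hS0], fun a B N hN ha hB s hs hs2 => ?_⟩
  have hB0 : 0 ≤ B := (norm_nonneg _).trans (hB 0)
  set a' : ℕ → ℂ := fun n => if N < n then a n else 0 with ha'
  have ha1 : ∀ n, ‖a' n‖ ≤ 1 := fun n => by simp only [ha']; split_ifs <;> simp [ha]
  have hz : ∀ M, M ≤ N + 1 → ∑ n ∈ range M, a' n = 0 := fun M hM =>
    sum_eq_zero fun n hn => by simp only [ha']; rw [if_neg]; simp at hn; omega
  have hB' : ∀ M, ‖∑ n ∈ range M, a' n‖ ≤ 2 * B := by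
    intro M
    rcases le_total M (N+1) with hM | hM
    · rw [hz M hM]; simp; exact hB0
    · have e : ∑ n ∈ range M, a' n = ∑ n ∈ range M, a n - ∑ n ∈ range (N+1), a n := by
        have e1 := sum_range_add_sum_Ico a' hM
        have e2 := sum_range_add_sum_Ico a hM
        rw [← e1, ← e2, hz _ le_rfl, zero_add, add_sub_cancel_left]
        refine sum_congr rfl fun n hn => ?_
        simp only [ha']; rw [if_pos]; simp at hn; omega
      rw [e]; refine (norm_sub_le _ _).trans ?_; linarith [hB M, hB (N+1)]
  have hN0 : (0:ℝ) < N := by exact_mod_cast hN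
  have := abel (a := a') (f := g r s)
    (b := fun n => (2 * B) * K * (1 + |s.im|) * (N:ℝ)^(-(1/2):ℝ) * ((n:ℝ)+1)^(-1-1/4:ℝ))
    (hS.mul_left _) ?_ (sum_tendsto r hs hB') (a_g_summable r hs ha1)
  · refine this.trans ?_
    rw [tsum_mul_left, ← hSd]
    have : 0 ≤ (1 + |s.im|) * B * (N:ℝ)^(-(1/2):ℝ) := by positivity
    nlinarith
  intro n
  have hn0 : (0:ℝ) < (n:ℝ)+1 := by positivity
  rcases lt_or_ge n (N+1) with hn | hn
  · rw [hz (n+1) (by omega)]; simp; positivity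
  calc _ ≤ (2*B) * (K * (1 + |s.im|) * ((n:ℝ)+1)^(-2+1/4:ℝ)) := by
        gcongr
        · exact hB' _
        · exact h s hs hs2 n
    _ = (2*B) * K * (1 + |s.im|) * (((n:ℝ)+1)^(-(1/2):ℝ) * ((n:ℝ)+1)^(-1-1/4:ℝ)) := by
        rw [← rpow_add hn0]; norm_num; ring
    _ ≤ (2*B) * K * (1 + |s.im|) * ((N:ℝ)^(-(1/2):ℝ) * ((n:ℝ)+1)^(-1-1/4:ℝ)) := by
        have : ((n:ℝ)+1)^(-(1/2):ℝ) ≤ (N:ℝ)^(-(1/2):ℝ) :=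
          rpow_le_rpow_of_nonpos hN0 (by exact_mod_cast (by omega : N ≤ n+1)) (by norm_num)
        gcongr
    _ = _ := by ring
end BD
namespace BD
open Finset Topology
noncomputable def ell (a : ℕ → ℂ) (r : ℕ) (s : ℂ) : ℂ := LSeries (fun n => a n * (Real.log n : ℂ)^r) s
lemma ell_eq (a : ℕ → ℂ) (r : ℕ) (s : ℂ) : ell a r s = ∑' n, a n * g r s n := by
  unfold ell LSeries
  congr 1; ext n
  rcases Nat.eq_zero_or_pos n with rfl | hn
  · simp [g]
  · simp only [LSeries.term_def, g, if_neg hn.ne']; ring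
lemma ell_summable {a : ℕ → ℂ} (r : ℕ) {s : ℂ} {A : ℝ} (ha : ∀ n, ‖a n‖ ≤ A) (hs : 1 < s.re) :
    LSeriesSummable (fun n => a n * (Real.log n : ℂ)^r) s := by
  refine (a_g_summable r hs ha).congr fun n => ?_
  rcases Nat.eq_zero_or_pos n with rfl | hn
  · simp [g]
  · simp only [LSeries.term_def, g, if_neg hn.ne']; ring
lemma ell_zero (a : ℕ → ℂ) (s : ℂ) : ell a 0 s = LSeries a s := by simp [ell]
lemma ell_add {a b : ℕ → ℂ} (r : ℕ) {s : ℂ} {A B : ℝ} (ha : ∀ n, ‖a n‖ ≤ A) (hb : ∀ n, ‖b n‖ ≤ B)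
    (hs : 1 < s.re) : ell (a + b) r s = ell a r s + ell b r s := by
  unfold ell
  rw [← LSeries_add (ell_summable r ha hs) (ell_summable r hb hs)]
  congr 1; ext n; simp [add_mul]
lemma zeta_bound : ∃ K : ℝ, 1 ≤ K ∧ ∀ s : ℂ, 1 < s.re → s.re ≤ 2 →
    ‖ell 1 0 s‖ ≤ 1 / ‖s - 1‖ + K * (1 + |s.im|) := by
  have hS := sum_rpow 1 one_pos
  set S := ∑' n : ℕ, ((n:ℝ)+1)^(-1-1:ℝ) with hSd
  have hS0 : 0 ≤ S := tsum_nonneg fun n => by positivity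
  refine ⟨2 * S + 1, by linarith, fun s hs hs2 => ?_⟩
  have ht : 0 ≤ |s.im| := abs_nonneg _
  have hs1 : 1 - s ≠ 0 := by
    intro h; have := congrArg Complex.re h; simp at this; linarith
  have hs0 : -s ≠ 0 := by intro h; have := congrArg Complex.re h; simp at this; linarith
  have hns : ‖-s‖ ≤ 2 + |s.im| := (Complex.norm_le_abs_re_add_abs_im (-s)).trans (by
      simp only [Complex.neg_re, Complex.neg_im, abs_neg]; rw [abs_of_pos (by linarith)]; linarith)
  let h : ℝ → ℂ := fun u => (u:ℂ)^(1-s) / (1-s)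
  let d : ℕ → ℂ := fun n => (((n:ℝ)+1 : ℝ):ℂ)^(-s) - (h ((n:ℝ)+1+1) - h ((n:ℝ)+1))
  have hd : ∀ n, ‖d n‖ ≤ (2 + |s.im|) * ((n:ℝ)+1)^(-1-1:ℝ) := by
    intro n
    set v : ℝ := (n:ℝ)+1 with hv
    have hv1 : 1 ≤ v := by rw [hv]; linarith [Nat.cast_nonneg (α := ℝ) n]
    have h1 : ∀ u ∈ Set.Icc v (v+1), ‖(u:ℂ)^(-s) - (v:ℂ)^(-s)‖ ≤ (2 + |s.im|) * v^(-1-1:ℝ) := by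
      intro u hu
      have := Convex.norm_image_sub_le_of_norm_hasDerivWithin_le (𝕜 := ℝ) (x := v) (y := u)
        (f := fun u : ℝ => (u:ℂ)^(-s)) (f' := fun u : ℝ => -s * (u:ℂ)^(-s-1)) (s := Set.Icc v (v+1))
        (C := (2 + |s.im|) * v^(-1-1:ℝ))
        (fun u hu => (hasDerivAt_ofReal_cpow_const (by linarith [hu.1]) hs0).hasDerivWithinAt) ?_
        (convex_Icc _ _) (by simp) hu
      · refine this.trans ?_
        have : ‖u - v‖ ≤ 1 := by rw [norm_of_nonneg (by linarith [hu.1])]; linarith [hu.2]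
        exact mul_le_of_le_one_right (by positivity) this
      intro u hu
      have hu0 : 0 < u := by linarith [hu.1]
      rw [norm_mul, Complex.norm_cpow_eq_rpow_re_of_pos hu0]
      gcongr
      calc u^((-s-1).re) ≤ u^(-1-1:ℝ) := rpow_le_rpow_of_exponent_le (by linarith [hu.1]) (by simp; linarith)
        _ ≤ _ := rpow_le_rpow_of_nonpos (by linarith) hu.1 (by norm_num)
    have := Convex.norm_image_sub_le_of_norm_hasDerivWithin_le (𝕜 := ℝ) (x := v) (y := v+1)
        (f := fun u : ℝ => h u - u * (v:ℂ)^(-s)) (f' := fun u : ℝ => (u:ℂ)^(-s) - 1 * (v:ℂ)^(-s))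
        (s := Set.Icc v (v+1)) (C := (2 + |s.im|) * v^(-1-1:ℝ)) ?_ ?_
        (convex_Icc _ _) (by simp) (by simp)
    · simp only [add_sub_cancel_left, norm_one, mul_one] at this
      refine le_trans (le_of_eq ?_) this
      rw [← norm_neg]; congr 1
      show -((v:ℂ)^(-s) - (h (v+1) - h v)) = _
      push_cast; ring
    · intro u hu
      have hu0 : u ≠ 0 := by linarith [hu.1]
      refine HasDerivAt.hasDerivWithinAt (HasDerivAt.sub ?_ ?_)
      · have := hasDerivAt_ofReal_cpow_const' hu0 (r := -s) (by
          intro h; have := congrArg Complex.re h; simp at this; linarith)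
        have e : -s + 1 = 1 - s := by ring
        rw [e] at this; exact this
      · exact (hasDerivAt_id u).ofReal_comp.mul_const _
    · intro u hu; rw [one_mul]; exact h1 u hu
  have hdS : Summable d := Summable.of_norm_bounded (hS.mul_left _) hd
  have hdn : ‖∑' n, d n‖ ≤ (2 + |s.im|) * S := by
    rw [hSd, ← tsum_mul_left]; exact tsum_of_norm_bounded (hS.mul_left _).hasSum hd
  have hg := (summable_nat_add_iff 1).2 (a_g_summable (a := 1) (A := 1) 0 hs (by simp))
  have hh : Tendsto (fun N : ℕ => h ((N:ℝ)+1)) atTop (𝓝 0) := by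
    have : Tendsto (fun N : ℕ => (((N:ℝ)+1)^(-(s.re-1)) / ‖1-s‖)) atTop (𝓝 (0/‖1-s‖)) :=
      ((tendsto_rpow_neg_atTop (by linarith)).comp
        (tendsto_natCast_atTop_atTop.atTop_add tendsto_const_nhds)).div_const _
    rw [zero_div] at this
    refine squeeze_zero_norm (fun N => ?_) this
    simp only [h]
    rw [norm_div, Complex.norm_cpow_eq_rpow_re_of_pos (by positivity)]
    apply le_of_eq; congr 2; simp
  have e : ell 1 0 s = ∑' n, d n - h 1 := by
    rw [ell_eq, (a_g_summable (a := 1) (A := 1) 0 hs (by simp)).tsum_eq_zero_add]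
    have : ((1 : ℕ → ℂ) 0 * g 0 s 0) = 0 := by simp [g]
    rw [this, zero_add]
    refine tendsto_nhds_unique hg.hasSum.tendsto_sum_nat ?_
    have h2 : ∀ N : ℕ, ∑ n ∈ range N, (1 : ℕ → ℂ) (n+1) * g 0 s (n+1)
        = ∑ n ∈ range N, d n + h ((N:ℝ)+1) - h 1 := by
      intro N; induction N with
      | zero => simp
      | succ N ih =>
        rw [sum_range_succ, ih, sum_range_succ]; simp only [d, g]
        push_cast; simp [Complex.cpow_neg]; ring
    simp_rw [h2]
    simpa using (hdS.hasSum.tendsto_sum_nat.add hh).sub_const (h 1)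
  rw [e]
  refine (norm_sub_le _ _).trans ?_
  have : ‖h 1‖ = 1 / ‖s - 1‖ := by simp [h, norm_sub_rev]
  rw [this]
  nlinarith
end BD
namespace BD
open Finset Topology
noncomputable abbrev lc {q : ℕ} (χ : DirichletCharacter ℂ q) (r : ℕ) (s : ℂ) : ℂ := ell (fun n => χ n) r s
lemma lc_bound (r : ℕ) {ε : ℝ} (hε : 0 < ε) (hε1 : ε ≤ 1) : ∃ K : ℝ, 1 ≤ K ∧ ∀ (q : ℕ) [NeZero q]
    (χ : DirichletCharacter ℂ q), χ ≠ 1 → ∀ s : ℂ, 1 < s.re → s.re ≤ 2 →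
    ‖lc χ r s‖ ≤ K * (1 + |s.im|) * (q:ℝ)^ε := by
  obtain ⟨K, hK, h⟩ := series_bound r hε hε1
  refine ⟨K, hK, fun q _ χ hχ s hs hs2 => ?_⟩
  rw [lc, ell_eq]
  exact h _ q (fun n => χ.norm_le_one _) (char_sum_bound hχ) s hs hs2
lemma lc_one_bound {ε : ℝ} (hε : 0 < ε) (hε1 : ε ≤ 1) : ∃ K : ℝ, 1 ≤ K ∧ ∀ (q : ℕ) [NeZero q]
    (s : ℂ), 1 < s.re → s.re ≤ 2 →
    ‖lc (1 : DirichletCharacter ℂ q) 0 s‖ ≤ 1 / ‖s - 1‖ + K * (1 + |s.im|) * (q:ℝ)^ε := by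
  obtain ⟨K, hK, h⟩ := series_bound 0 hε hε1
  obtain ⟨K', hK', h'⟩ := zeta_bound
  refine ⟨K + K', by linarith, fun q _ s hs hs2 => ?_⟩
  set m : ℂ := (∑ x : ZMod q, (1 : DirichletCharacter ℂ q) x) / q with hm
  have hq0 : (q:ℂ) ≠ 0 := by exact_mod_cast NeZero.ne q
  have hq1 : (1:ℝ) ≤ (q:ℝ)^ε := one_le_rpow (by exact_mod_cast NeZero.one_le) hε.le
  obtain ⟨μ, hμ, hμ0, hμ1⟩ : ∃ μ : ℝ, m = μ ∧ 0 ≤ μ ∧ μ ≤ 1 := by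
    refine ⟨((∑ x : ZMod q, if IsUnit x then (1:ℝ) else 0)) / q, ?_, by positivity, ?_⟩
    · rw [hm]; push_cast; congr 1
      refine sum_congr rfl fun x _ => ?_
      split_ifs with hx
      · rw [MulChar.one_apply hx]; simp
      · rw [MulChar.map_nonunit _ hx]; simp
    · rw [div_le_one (by exact_mod_cast NeZero.pos q)]
      calc _ ≤ ∑ x : ZMod q, (1:ℝ) := sum_le_sum fun x _ => by split_ifs <;> norm_num
        _ = q := by simp
  have e : (fun n : ℕ => (1 : DirichletCharacter ℂ q) n) =
      (fun n : ℕ => (1 : DirichletCharacter ℂ q) n - m) + fun _ => m := by ext n; simp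
  have ha : ∀ n : ℕ, ‖(1 : DirichletCharacter ℂ q) n - m‖ ≤ 1 := by
    intro n
    rw [hμ]
    by_cases hx : IsUnit (n : ZMod q)
    · rw [MulChar.one_apply hx, ← Complex.ofReal_one, ← Complex.ofReal_sub, Complex.norm_real, norm_eq_abs,
        abs_le]; constructor <;> linarith
    · rw [MulChar.map_nonunit _ hx, zero_sub, norm_neg, Complex.norm_real, norm_eq_abs,
        abs_le]; constructor <;> linarith
  rw [lc, e, ell_add 0 ha (B := 1) (by intro n; rw [hμ, Complex.norm_real, norm_of_nonneg hμ0]; exact hμ1) hs]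
  have h2 : ‖ell (fun _ => m) 0 s‖ ≤ 1 / ‖s - 1‖ + K' * (1 + |s.im|) := by
    have : ell (fun _ => m) 0 s = m * ell 1 0 s := by
      simp_rw [ell_eq, ← tsum_mul_left]; congr 1; ext n; simp
    rw [this, norm_mul, hμ, Complex.norm_real, norm_of_nonneg hμ0]
    exact (mul_le_of_le_one_left (norm_nonneg _) hμ1).trans (h' s hs hs2)
  have h1 := h (fun n : ℕ => (1 : DirichletCharacter ℂ q) n - m) q ha (periodic_sum_bound ha (by simp)
    (NeZero.pos q) (by
      rw [sum_sub_distrib, char_period_sum]; simp [hm]; field_simp; simp)) s hs hs2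
  rw [← ell_eq] at h1
  refine (norm_add_le _ _).trans ((add_le_add h1 h2).trans ?_)
  have : K' * (1 + |s.im|) ≤ K' * (1 + |s.im|) * (q:ℝ)^ε := le_mul_of_one_le_right (by positivity) hq1
  linarith
lemma one_real_bound : ∃ K : ℝ, 1 ≤ K ∧ ∀ (q : ℕ) (x : ℝ), 0 < x → x ≤ 1 →
    ‖lc (1 : DirichletCharacter ℂ q) 0 (1 + x)‖ ≤ K / x ∧ ∑' n : ℕ, (n:ℝ)^(-(1+x)) ≤ K / x := by
  obtain ⟨K', hK', h'⟩ := zeta_bound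
  refine ⟨1 + K', by linarith, fun q x hx hx1 => ?_⟩
  have hs : 1 < (1 + (x:ℂ)).re := by simp [hx]
  have hsm := (a_g_summable (a := 1) (A := 1) 0 hs (by simp))
  have hgn : ∀ n : ℕ, ‖g 0 (1+x) n‖ = (n:ℝ)^(-(1+x)) := by
    intro n
    rcases Nat.eq_zero_or_pos n with rfl | hn
    · simp [g]; rw [zero_rpow (by linarith)]
    · simp only [g, if_neg hn.ne', pow_zero, norm_div, norm_one, Complex.norm_natCast_cpow_of_pos hn]
      rw [rpow_neg (by positivity)]; simp
  have hgc : ∀ n : ℕ, g 0 (1+x) n = (((n:ℝ)^(-(1+x)) : ℝ) : ℂ) := by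
    intro n
    rcases Nat.eq_zero_or_pos n with rfl | hn
    · simp [g]; rw [zero_rpow (by linarith)]; simp
    · simp only [g, if_neg hn.ne', pow_zero]
      rw [Complex.ofReal_cpow (by positivity)]; push_cast
      rw [Complex.cpow_neg, one_div]
  have h2 : ∑' n : ℕ, (n:ℝ)^(-(1+x)) ≤ (1+K') / x := by
    have h3 := h' (1+x) hs (by simp; linarith)
    have h4 : ell 1 0 (1+x) = ((∑' n : ℕ, (n:ℝ)^(-(1+x)) : ℝ) : ℂ) := by
      rw [ell_eq, Complex.ofReal_tsum]; congr 1; ext n; rw [hgc]; simp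
    rw [h4, Complex.norm_real, norm_of_nonneg (tsum_nonneg fun n => by positivity)] at h3
    refine h3.trans ?_
    simp [abs_of_pos hx]
    rw [add_div, one_div]; gcongr
    rw [le_div_iff₀ hx]; nlinarith
  refine ⟨le_trans ?_ h2, h2⟩
  rw [lc, ell_eq]
  refine tsum_of_norm_bounded (Summable.hasSum ?_) fun n => ?_
  · exact hsm.norm.congr fun n => by simp [hgn]
  · rw [norm_mul, hgn]; exact mul_le_of_le_one_left (by positivity) (DirichletCharacter.norm_le_one _ _)
lemma lc_deriv {q : ℕ} [NeZero q] (χ : DirichletCharacter ℂ q) {s : ℂ} (hs : 1 < s.re) :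
    HasDerivAt (lc χ 0) (- lc χ 1 s) s := by
  have h1 : LSeries.abscissaOfAbsConv (fun n => χ n) < s.re := by
    rw [DirichletCharacter.absicssaOfAbsConv_eq_one (NeZero.ne q)]; exact_mod_cast hs
  have := LSeries_hasDerivAt h1
  have e : lc χ 0 = LSeries (fun n => χ n) := by ext z; simp [lc, ell_zero]
  rw [e]; convert! this using 2
  simp only [lc, ell]; congr 1; ext n; simp [LSeries.logMul]; ring
lemma lc_lower : ∃ c : ℝ, 0 < c ∧ ∀ (q : ℕ) [NeZero q] (χ : DirichletCharacter ℂ q) (B t : ℝ), 1 ≤ B →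
    (∀ σ : ℝ, 1 < σ → σ ≤ 2 → ‖lc (χ^2) 0 (σ + 2 * Complex.I * t)‖ ≤ B) →
    (∀ σ : ℝ, 1 < σ → σ ≤ 2 → ‖lc χ 1 (σ + Complex.I * t)‖ ≤ B) →
    ∀ σ : ℝ, 1 < σ → σ ≤ 2 → c / B^4 ≤ ‖lc χ 0 (σ + Complex.I * t)‖ := by
  obtain ⟨K, hK, hK'⟩ := one_real_bound
  have hK3 : 1 ≤ K^3 := one_le_pow₀ hK
  refine ⟨1 / (16 * K^3), by positivity, fun q _ χ B t hB h2 h1 σ hσ hσ2 => ?_⟩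
  have base : ∀ x : ℝ, 0 < x → x ≤ 1 → x^3 ≤ K^3 * B * ‖lc χ 0 ((1+x:ℝ) + Complex.I * t)‖^4 := by
    intro x hx hx1
    have := DirichletCharacter.norm_LSeries_product_ge_one χ hx t
    simp only [← ell_zero, norm_mul, norm_pow] at this
    have a1 := (hK' q x hx hx1).1
    have a2 := h2 (1+x) (by linarith) (by linarith)
    push_cast at a2 ⊢
    rw [ge_iff_le] at this
    have : 1 ≤ (K/x)^3 * ‖lc χ 0 (1 + x + Complex.I * t)‖^4 * B := this.trans (by gcongr)
    rw [div_pow] at this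
    have e : K^3 / x^3 * ‖lc χ 0 (1 + x + Complex.I * t)‖^4 * B =
      (K^3 * B * ‖lc χ 0 (1 + x + Complex.I * t)‖^4) / x^3 := by ring
    rw [e, le_div_iff₀ (by positivity)] at this
    linarith
  set η : ℝ := 1 / (16 * K^3 * B^5) with hη
  have hη0 : 0 < η := by positivity
  have hB5 : 1 ≤ B^5 := one_le_pow₀ hB
  have hη1 : η ≤ 1 := by
    rw [hη, div_le_one (by positivity)]; nlinarith
  have hBη : 1 / (16 * K^3) / B^4 = B * η := by rw [hη]; field_simp
  have key : ∀ x, η ≤ x → x ≤ 1 → 2 * (B * η) ≤ ‖lc χ 0 ((1+x:ℝ) + Complex.I * t)‖ := by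
    intro x hx hx1
    by_contra! hlt
    have b := base x (by linarith) hx1
    have : ‖lc χ 0 ((1+x:ℝ) + Complex.I * t)‖^4 < (2 * (B*η))^4 := by gcongr
    have h3 : η^3 ≤ x^3 := by gcongr
    have h4 : K^3 * B * (2 * (B*η))^4 = η^3 * (16 * K^3 * B^5 * η) := by ring
    have h5 : 16 * K^3 * B^5 * η = 1 := by rw [hη]; field_simp
    rw [h5] at h4
    have : K^3 * B * ‖lc χ 0 ((1+x:ℝ) + Complex.I * t)‖^4 < K^3 * B * (2 * (B*η))^4 := by gcongr
    linarith
  rw [hBη]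
  have hBη0 : 0 < B * η := by positivity
  rcases le_total (1 + η) σ with h | h
  · have := key (σ - 1) (by linarith) (by linarith)
    rw [add_sub_cancel] at this; linarith
  · have k1 := key η le_rfl hη1
    have := Convex.norm_image_sub_le_of_norm_hasDerivWithin_le (𝕜 := ℝ) (x := 1 + η) (y := σ)
      (f := fun u : ℝ => lc χ 0 (u + Complex.I * t)) (f' := fun u : ℝ => (-lc χ 1 (u + Complex.I * t)))
      (s := Set.Icc σ (1+η)) (C := B) ?_ ?_ (convex_Icc _ _) (by simp [h]) (by simp [h])
    · have h6 : ‖σ - (1 + η)‖ ≤ η := by rw [norm_sub_rev, norm_of_nonneg (by linarith)]; linarith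
      have h7 := norm_sub_norm_le (lc χ 0 ((1 + η : ℝ) + Complex.I * t)) (lc χ 0 (σ + Complex.I * t))
      rw [norm_sub_rev] at h7
      have : B * ‖σ - (1 + η)‖ ≤ B * η := by gcongr
      linarith
    · intro u hu
      have hd := lc_deriv χ (s := (u:ℂ) + Complex.I * t) (by simp; linarith [hu.1])
      have h8 : HasDerivAt (fun u : ℝ => (u:ℂ) + Complex.I * t) 1 u :=
        (hasDerivAt_id u).ofReal_comp.add_const _
      have := HasDerivAt.comp u hd h8
      rw [mul_one] at this; exact this.hasDerivWithinAt
    · intro u hu; rw [norm_neg]; exact h1 u (by linarith [hu.1]) (by linarith [hu.2])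
end BD
namespace BD
open Finset Topology
def Good (A L : ℝ) : Prop := ∀ (q : ℕ) [NeZero q] (χ : DirichletCharacter ℂ q), (q:ℝ) ≤ L^A →
  χ.IsPrimitive → χ ≠ 1 → χ^2 = 1 → L^(-(1/100):ℝ) ≤ ‖DirichletCharacter.LFunction χ 1‖
lemma lip {q : ℕ} [NeZero q] {χ : DirichletCharacter ℂ q} (hχ : χ ≠ 1) {M : ℝ}
    (hM : ∀ s : ℂ, 1 < s.re → s.re ≤ 2 → |s.im| ≤ 1 → ‖lc χ 1 s‖ ≤ M) {s : ℂ} (h1 : 1 < s.re)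
    (h2 : s.re ≤ 2) (h3 : |s.im| ≤ 1) :
    ‖lc χ 0 s - DirichletCharacter.LFunction χ 1‖ ≤ M * ‖s - 1‖ := by
  have hconv : Convex ℝ {z : ℂ | 1 < z.re ∧ z.re ≤ 2 ∧ -1 ≤ z.im ∧ z.im ≤ 1} :=
    (convex_halfSpace_re_gt 1).inter ((convex_halfSpace_re_le 2).inter
      ((convex_halfSpace_im_ge (-1)).inter (convex_halfSpace_im_le 1)))
  have heq : ∀ z : ℂ, 1 < z.re → lc χ 0 z = DirichletCharacter.LFunction χ z := fun z hz => by
    rw [lc, ell_zero, DirichletCharacter.LFunction_eq_LSeries χ hz]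
  have key : ∀ᶠ δ : ℝ in 𝓝[>] 0, ‖lc χ 0 s - DirichletCharacter.LFunction χ (1 + δ)‖ ≤ M * ‖s - (1 + δ)‖ := by
    filter_upwards [Ioc_mem_nhdsGT (zero_lt_one (α := ℝ))] with δ hδ
    have hm : (1 + δ : ℂ) ∈ {z : ℂ | 1 < z.re ∧ z.re ≤ 2 ∧ -1 ≤ z.im ∧ z.im ≤ 1} := by
      refine ⟨?_, ?_, ?_, ?_⟩ <;> simp <;> linarith [hδ.1, hδ.2]
    rw [← heq (1+δ) hm.1]
    refine Convex.norm_image_sub_le_of_norm_hasDerivWithin_le (𝕜 := ℂ) (f' := fun z => -lc χ 1 z)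
      (fun z hz => (lc_deriv χ hz.1).hasDerivWithinAt) (fun z hz => ?_) hconv hm
      ⟨h1, h2, (abs_le.1 h3).1, (abs_le.1 h3).2⟩
    rw [norm_neg]; exact hM z hz.1 hz.2.1 (abs_le.2 hz.2.2)
  have hc : Tendsto (fun δ : ℝ => (1 + δ : ℂ)) (𝓝[>] 0) (𝓝 1) := by
    have : ContinuousAt (fun δ : ℝ => (1 + δ : ℂ)) 0 := by fun_prop
    have := this.tendsto.mono_left (nhdsWithin_le_nhds (s := Set.Ioi 0)); simpa using this
  have hL := (DirichletCharacter.differentiable_LFunction hχ).continuous.continuousAt (x := 1) |>.tendsto.comp hc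
  exact le_of_tendsto_of_tendsto (tendsto_const_nhds.sub hL).norm
    ((tendsto_const_nhds.sub hc).norm.const_mul M) key
lemma prim_ext {q₁ q₂ : ℕ} [NeZero q₁] [NeZero q₂] {χ₁ : DirichletCharacter ℂ q₁} {χ₂ : DirichletCharacter ℂ q₂}
    (h1 : χ₁.IsPrimitive) (h2 : χ₂.IsPrimitive)
    (h : DirichletCharacter.changeLevel (dvd_mul_right q₁ q₂) χ₁ =
      DirichletCharacter.changeLevel (dvd_mul_left q₂ q₁) χ₂) :
    (⟨q₁, χ₁⟩ : Σ q, DirichletCharacter ℂ q) = ⟨q₂, χ₂⟩ := by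
  have hq : q₁ = q₂ := by
    have := congrArg DirichletCharacter.conductor h
    rw [DirichletCharacter.conductor_changeLevel, DirichletCharacter.conductor_changeLevel] at this
    rw [h1, h2] at this; exact this
  subst hq
  rw [DirichletCharacter.changeLevel_injective _ h]
noncomputable def pc {q₁ q₂ : ℕ} (χ₁ : DirichletCharacter ℂ q₁) (χ₂ : DirichletCharacter ℂ q₂) :
    DirichletCharacter ℂ (q₁ * q₂) :=
  DirichletCharacter.changeLevel (dvd_mul_right q₁ q₂) χ₁ * DirichletCharacter.changeLevel (dvd_mul_left q₂ q₁) χ₂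
lemma pc_apply {q₁ q₂ : ℕ} (χ₁ : DirichletCharacter ℂ q₁) (χ₂ : DirichletCharacter ℂ q₂) (n : ℕ) :
    pc χ₁ χ₂ n = χ₁ n * χ₂ n := by
  unfold pc
  by_cases h : Nat.Coprime n (q₁ * q₂)
  · have hu := (ZMod.isUnit_iff_coprime n (q₁ * q₂)).2 h
    obtain ⟨u, hu⟩ := hu
    rw [MulChar.mul_apply, ← hu, DirichletCharacter.changeLevel_eq_cast_of_dvd,
      DirichletCharacter.changeLevel_eq_cast_of_dvd, hu, ZMod.cast_natCast (dvd_mul_right _ _),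
      ZMod.cast_natCast (dvd_mul_left _ _)]
  · rw [MulChar.map_nonunit _ (by rwa [ZMod.isUnit_iff_coprime])]
    rw [Nat.coprime_mul_iff_right, not_and_or] at h
    rcases h with h | h
    · rw [MulChar.map_nonunit χ₁ (by rwa [ZMod.isUnit_iff_coprime]), zero_mul]
    · rw [MulChar.map_nonunit χ₂ (by rwa [ZMod.isUnit_iff_coprime]), mul_zero]
lemma pc_ne_one {q₁ q₂ : ℕ} [NeZero q₁] [NeZero q₂] {χ₁ : DirichletCharacter ℂ q₁} {χ₂ : DirichletCharacter ℂ q₂}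
    (h1 : χ₁.IsPrimitive) (h2 : χ₂.IsPrimitive)
    (h : (⟨q₁, χ₁⟩ : Σ q, DirichletCharacter ℂ q) ≠ ⟨q₂, χ₂⟩) : pc χ₁ χ₂⁻¹ ≠ 1 := by
  intro h'
  unfold pc at h'
  rw [map_inv, mul_inv_eq_one] at h'
  exact h (prim_ext h1 h2 h')
lemma landau {q₁ q₂ : ℕ} (χ₁ : DirichletCharacter ℂ q₁) (χ₂ : DirichletCharacter ℂ q₂) (h1 : χ₁^2 = 1)
    (h2 : χ₂^2 = 1) {x : ℝ} (hx : 0 < x) :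
    1 ≤ ‖lc (1 : DirichletCharacter ℂ 1) 0 (1+x)‖ * ‖lc χ₁ 0 (1+x)‖ * (‖lc χ₂ 0 (1+x)‖ * ‖lc (pc χ₁ χ₂) 0 (1+x)‖) := by
  have hs : 1 < (1 + (x:ℂ)).re := by simp [hx]
  have P := ((DirichletCharacter.LSeries_eulerProduct_hasProd (1 : DirichletCharacter ℂ 1) hs).mul
    (DirichletCharacter.LSeries_eulerProduct_hasProd χ₁ hs)).mul
    ((DirichletCharacter.LSeries_eulerProduct_hasProd χ₂ hs).mul
    (DirichletCharacter.LSeries_eulerProduct_hasProd (pc χ₁ χ₂) hs))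
  have P' := P.norm
  simp only [norm_mul] at P'
  simp only [lc, ell_zero]
  refine ge_of_tendsto' P' fun S => ?_
  refine Finset.prod_induction _ (fun y : ℝ => 1 ≤ y) (fun _ _ => one_le_mul_of_one_le_of_one_le) le_rfl fun p _ => ?_
  set u : ℝ := (p:ℝ)^(-(1+x)) with hu
  have hp2 : (2:ℝ) ≤ p := by exact_mod_cast p.2.two_le
  have hu0 : 0 < u := by rw [hu]; positivity
  have hu1 : u < 1 := by
    rw [hu]; exact rpow_lt_one_of_one_lt_of_neg (by linarith) (by linarith)
  have e : ((p:ℕ):ℂ)^(-(1+(x:ℂ))) = u := by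
    rw [hu, Complex.ofReal_cpow (by positivity)]; push_cast; ring_nf
  have tri : ∀ {q : ℕ} (χ : DirichletCharacter ℂ q), χ^2 = 1 → ∃ a : ℝ, χ (p:ℕ) = a ∧ (a = 0 ∨ a = 1 ∨ a = -1) := by
    intro q χ h
    by_cases hp : IsUnit ((p:ℕ) : ZMod q)
    · have := congrArg (fun ψ : DirichletCharacter ℂ q => ψ (p:ℕ)) h
      simp only [MulChar.pow_apply' _ two_ne_zero, MulChar.one_apply hp] at this
      rcases mul_self_eq_one_iff.1 ((sq _).symm.trans this) with h | h
      · exact ⟨1, by simp [h], by simp⟩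
      · exact ⟨-1, by simp [h], by simp⟩
    · exact ⟨0, by simp [MulChar.map_nonunit _ hp], by simp⟩
  obtain ⟨a, ha, ha'⟩ := tri χ₁ h1
  obtain ⟨b, hb, hb'⟩ := tri χ₂ h2
  have h11 : (1 : DirichletCharacter ℂ 1) ((p:ℕ) : ZMod 1) = ((1:ℝ):ℂ) := by
    rw [Complex.ofReal_one]; exact MulChar.one_apply (isUnit_of_subsingleton _)
  rw [pc_apply, ha, hb, h11, e]
  have : ∀ y : ℝ, ‖((1 - (y:ℂ) * u)⁻¹)‖ = (|1 - y * u|)⁻¹ := by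
    intro y; rw [norm_inv, ← norm_eq_abs, ← Complex.norm_real]; push_cast; rfl
  rw [← Complex.ofReal_mul a b, this, this, this, this, ← mul_inv, ← mul_inv, ← mul_inv,
    one_le_inv₀]
  · rcases ha' with rfl | rfl | rfl <;> rcases hb' with rfl | rfl | rfl <;> norm_num <;>
      (try rw [abs_of_pos (by linarith : 0 < 1 - u)]) <;> (try rw [abs_of_pos (by linarith : 0 < 1 + u)]) <;>
      nlinarith [mul_pos hu0 hu0, mul_pos hu0 (sub_pos.2 hu1), mul_pos (mul_pos hu0 (sub_pos.2 hu1)) (sub_pos.2 hu1)]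
  · have : ∀ y : ℝ, (y = 0 ∨ y = 1 ∨ y = -1) → 0 < |1 - y * u| := by
      intro y hy; rw [abs_pos]; rcases hy with rfl | rfl | rfl <;> intro h <;> linarith
    have hab : a * b = 0 ∨ a * b = 1 ∨ a * b = -1 := by
      rcases ha' with rfl | rfl | rfl <;> rcases hb' with rfl | rfl | rfl <;> norm_num
    have t1 := this 1 (by simp); have t2 := this a ha'; have t3 := this b hb'; have t4 := this _ hab
    positivity
lemma exists_good {A : ℝ} (hA : 0 < A) : ∃ᶠ L : ℝ in atTop, Good A L := by
  intro hbad
  set δ : ℝ := min 1 (1/(1000*A)) with hδ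
  have hδ0 : 0 < δ := by rw [hδ]; positivity
  have hδA : A * δ ≤ 1/1000 := by
    calc A * δ ≤ A * (1/(1000*A)) := by gcongr; exact min_le_right _ _
      _ = 1/1000 := by field_simp
  obtain ⟨K, hK, hz⟩ := one_real_bound
  obtain ⟨K0, hK0, h0⟩ := lc_bound 0 hδ0 (min_le_left _ _)
  obtain ⟨K1, hK1, h1⟩ := lc_bound 1 hδ0 (min_le_left _ _)
  have hlim : Tendsto (fun L : ℝ => K * (3*K1)^2 * K0 * L^(-(6/1000):ℝ)) atTop (𝓝 (K * (3*K1)^2 * K0 * 0)) :=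
    (tendsto_rpow_neg_atTop (by norm_num)).const_mul _
  rw [mul_zero] at hlim
  obtain ⟨L0, hL0⟩ := eventually_atTop.1 (hbad.and ((hlim.eventually_lt_const one_pos).and (eventually_ge_atTop 1)))
  have bad : ∀ L, L0 ≤ L → ∃ (q : ℕ) (_ : NeZero q) (χ : DirichletCharacter ℂ q), (q:ℝ) ≤ L^A ∧
      χ.IsPrimitive ∧ χ ≠ 1 ∧ χ^2 = 1 ∧ ‖DirichletCharacter.LFunction χ 1‖ < L^(-(1/100):ℝ) := by
    intro L hL
    have := (hL0 L hL).1
    unfold Good at this; push Not at this; exact this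
  obtain ⟨q₁, _, χ₁, hq₁, hp₁, hn₁, hs₁, hb₁⟩ := bad L0 le_rfl
  have hL01 := (hL0 L0 le_rfl).2.2
  set ν := ‖DirichletCharacter.LFunction χ₁ 1‖ with hν
  have hν0 : 0 < ν := norm_pos_iff.2 (DirichletCharacter.LFunction_apply_one_ne_zero hn₁)
  set L1 := ν^(-100:ℝ) with hL1
  have hL10 : L0 ≤ L1 := by
    calc L0 = (L0^(-(1/100):ℝ))^(-100:ℝ) := by rw [← rpow_mul (by linarith)]; norm_num
      _ ≤ _ := rpow_le_rpow_of_nonpos hν0 hb₁.le (by norm_num)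
  have hνL : ν = L1^(-(1/100):ℝ) := by rw [hL1, ← rpow_mul hν0.le]; norm_num
  obtain ⟨q₂, _, χ₂, hq₂, hp₂, hn₂, hs₂, hb₂⟩ := bad L1 hL10
  have hL11 := (hL0 L1 hL10).2.2
  have hL1p : 0 < L1 := by linarith
  have hne : (⟨q₁, χ₁⟩ : Σ q, DirichletCharacter ℂ q) ≠ ⟨q₂, χ₂⟩ := by
    intro h; cases h; rw [← hνL] at hb₂; exact lt_irrefl _ hb₂
  have hpc : pc χ₁ χ₂ ≠ 1 := by
    have := pc_ne_one hp₁ hp₂ hne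
    rwa [inv_eq_of_mul_eq_one_left (a := χ₂) (b := χ₂) (by rw [← sq]; exact hs₂)] at this
  have hq₁' : (q₁:ℝ) ≤ L1^A := hq₁.trans (rpow_le_rpow (by linarith) hL10 hA.le)
  have hqδ : ∀ q : ℕ, (q:ℝ) ≤ L1^A → (q:ℝ)^δ ≤ L1^(1/1000:ℝ) := fun q hq => by
    calc (q:ℝ)^δ ≤ (L1^A)^δ := by gcongr
      _ = L1^(A*δ) := by rw [← rpow_mul hL1p.le]
      _ ≤ _ := rpow_le_rpow_of_exponent_le hL11 hδA
  set x := L1^(-(1/100):ℝ) with hx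
  have hx0 : 0 < x := by positivity
  have hx1 : x ≤ 1 := rpow_le_one_of_one_le_of_nonpos hL11 (by norm_num)
  have hone : 1 ≤ L1^(1/1000:ℝ) := one_le_rpow hL11 (by norm_num)
  have bd : ∀ (q : ℕ) [NeZero q] (χ : DirichletCharacter ℂ q), (q:ℝ) ≤ L1^A → χ ≠ 1 →
      ‖DirichletCharacter.LFunction χ 1‖ ≤ x → ‖lc χ 0 (1+x)‖ ≤ 3 * K1 * L1^(1/1000:ℝ) * x := by
    intro q _ χ hq hχ hle
    have := lip hχ (M := 2 * K1 * L1^(1/1000:ℝ)) (fun s a b c => (h1 q χ hχ s a b).trans (by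
      have := hqδ q hq
      calc K1 * (1 + |s.im|) * (q:ℝ)^δ ≤ K1 * (1 + 1) * L1^(1/1000:ℝ) := by gcongr
        _ = _ := by ring)) (s := 1 + x) (by simp [hx0]) (by simp; linarith) (by simp)
    have e : ‖(1 + (x:ℂ)) - 1‖ = x := by simp [abs_of_pos hx0]
    rw [e] at this
    have h4 := norm_sub_norm_le (lc χ 0 (1+x)) (DirichletCharacter.LFunction χ 1)
    have : x ≤ K1 * L1^(1/1000:ℝ) * x := by
      have : 1 ≤ K1 * L1^(1/1000:ℝ) := by nlinarith
      nlinarith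
    linarith
  have B1 := bd q₁ χ₁ hq₁' hn₁ (by rw [← hν, hνL])
  have B2 := bd q₂ χ₂ hq₂ hn₂ hb₂.le
  have B0 := (hz 1 x hx0 hx1).1
  have B3 : ‖lc (pc χ₁ χ₂) 0 (1+x)‖ ≤ K0 * (L1^(1/1000:ℝ) * L1^(1/1000:ℝ)) := by
    have := h0 (q₁*q₂) (pc χ₁ χ₂) hpc (1+x) (by simp [hx0]) (by simp; linarith)
    have a1 := hqδ q₁ hq₁'
    have a2 := hqδ q₂ hq₂
    push_cast at this
    rw [mul_rpow (by positivity) (by positivity)] at this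
    refine this.trans ?_
    simp only [Complex.add_im, Complex.one_im, Complex.ofReal_im, add_zero, abs_zero, mul_one]
    gcongr
  have := landau χ₁ χ₂ hs₁ hs₂ hx0
  have h5 : (1:ℝ) ≤ K / x * (3 * K1 * L1^(1/1000:ℝ) * x) * ((3 * K1 * L1^(1/1000:ℝ) * x) *
    (K0 * (L1^(1/1000:ℝ) * L1^(1/1000:ℝ)))) := this.trans (by gcongr)
  have h6 : K / x * (3 * K1 * L1^(1/1000:ℝ) * x) * ((3 * K1 * L1^(1/1000:ℝ) * x) *
    (K0 * (L1^(1/1000:ℝ) * L1^(1/1000:ℝ)))) = K * (3*K1)^2 * K0 * L1^(-(6/1000):ℝ) := by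
    have e1 : L1^(-(6/1000):ℝ) = x * (L1^(1/1000:ℝ) * L1^(1/1000:ℝ) * L1^(1/1000:ℝ) * L1^(1/1000:ℝ)) := by
      rw [hx, ← rpow_add hL1p, ← rpow_add hL1p, ← rpow_add hL1p, ← rpow_add hL1p]; norm_num
    rw [e1]; field_simp
  have h7 := (hL0 L1 hL10).2.1
  linarith
lemma lc_inv {A : ℝ} (hA : 0 < A) : ∃ c L0 : ℝ, 0 < c ∧ ∀ L, L0 ≤ L → Good A L → ∀ (q : ℕ) [NeZero q]
    (χ : DirichletCharacter ℂ q), (q:ℝ) ≤ L^A → χ.IsPrimitive → χ ≠ 1 → ∀ t : ℝ,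
    c * L^(-(1/8):ℝ) * ((1 + |t|)^4)⁻¹ ≤ ‖lc χ 0 ((1 + 1/L : ℝ) + Complex.I * t)‖ := by
  set δ : ℝ := min 1 (1/(200*A)) with hδ
  have hδ0 : 0 < δ := by rw [hδ]; positivity
  have hδA : A * δ ≤ 1/200 := by
    calc A * δ ≤ A * (1/(200*A)) := by gcongr; exact min_le_right _ _
      _ = 1/200 := by field_simp
  obtain ⟨K, hK, h⟩ := lc_one_bound hδ0 (min_le_left _ _)
  obtain ⟨K0, hK0, h0⟩ := lc_bound 0 hδ0 (min_le_left _ _)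
  obtain ⟨K1, hK1, h1⟩ := lc_bound 1 hδ0 (min_le_left _ _)
  obtain ⟨c, hc, low⟩ := lc_lower
  have hlim : Tendsto (fun L : ℝ => 8 * K1 * L^(-(1/200):ℝ)) atTop (𝓝 (8 * K1 * 0)) :=
    (tendsto_rpow_neg_atTop (by norm_num)).const_mul _
  rw [mul_zero] at hlim
  obtain ⟨L0, hL0⟩ := eventually_atTop.1 ((hlim.eventually_lt_const one_pos).and (eventually_ge_atTop 2))
  set M := 1 + 2 * K + 2 * K0 + K1 with hM
  refine ⟨min (c / M^4) (1/2), L0, by positivity, fun L hL good q _ χ hq hp hχ t => ?_⟩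
  obtain ⟨hl, hL2⟩ := hL0 L hL
  have hLp : 0 < L := by linarith
  have hL1 : 1 ≤ L := by linarith
  have hqδ : (q:ℝ)^δ ≤ L^(1/200:ℝ) := by
    calc (q:ℝ)^δ ≤ (L^A)^δ := by gcongr
      _ = L^(A*δ) := by rw [← rpow_mul hLp.le]
      _ ≤ _ := rpow_le_rpow_of_exponent_le hL1 hδA
  have ht := abs_nonneg t
  have hinv : 1 / L ≤ 1 := by rw [div_le_one hLp]; exact hL1
  have hLi : 0 < 1/L := by positivity
  have mono : ∀ a b : ℝ, a ≤ b → L^a ≤ L^b := fun a b hab => rpow_le_rpow_of_exponent_le hL1 hab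
  -- the generic case
  have gen : (∀ σ : ℝ, 1 < σ → σ ≤ 2 → ‖lc (χ^2) 0 (σ + 2 * Complex.I * t)‖ ≤ (1 + 2*K+2*K0) * (1+|t|) * L^(2/100:ℝ)) →
      min (c / M^4) (1/2) * L^(-(1/8):ℝ) * ((1 + |t|)^4)⁻¹ ≤ ‖lc χ 0 ((1 + 1/L : ℝ) + Complex.I * t)‖ := by
    intro hsq
    have hone : 1 ≤ L^(2/100:ℝ) := one_le_rpow hL1 (by norm_num)
    have := low q χ (M * (1+|t|) * L^(2/100:ℝ)) t (by
        have : 1 ≤ M * (1+|t|) := by nlinarith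
        nlinarith)
      (fun σ a b => (hsq σ a b).trans (by gcongr; linarith)) (fun σ a b => (h1 q χ hχ _ (by simpa using a) (by simpa using b)).trans (by
        have e : |((σ:ℂ) + Complex.I * t).im| = |t| := by simp
        rw [e]
        have : (q:ℝ)^δ ≤ L^(2/100:ℝ) := hqδ.trans (mono _ _ (by norm_num))
        gcongr; linarith)) (1 + 1/L) (by linarith) (by linarith)
    refine le_trans ?_ this
    calc min (c / M^4) (1/2) * L^(-(1/8):ℝ) * ((1 + |t|)^4)⁻¹ ≤ (c / M^4) * L^(-(8/100):ℝ) * ((1 + |t|)^4)⁻¹ := by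
          have m1 := mono (-(1/8)) (-(8/100)) (by norm_num)
          have m2 := min_le_left (c / M^4) (1/2)
          exact mul_le_mul_of_nonneg_right (mul_le_mul m2 m1 (by positivity) (by positivity)) (by positivity)
      _ = _ := by
          rw [mul_pow, mul_pow, ← rpow_natCast (L^(2/100:ℝ)), ← rpow_mul hLp.le, rpow_neg hLp.le]
          norm_num; field_simp
  have im2 : ∀ σ : ℝ, |((σ:ℂ) + 2 * Complex.I * t).im| ≤ 2 * |t| := fun σ => by simp [abs_mul]
  have tail : ∀ K2 : ℝ, 1 ≤ K2 → ∀ σ : ℝ, K2 * (1 + |((σ:ℂ) + 2 * Complex.I * t).im|) * (q:ℝ)^δ ≤ 2 * K2 * (1+|t|) * L^(2/100:ℝ) := by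
    intro K2 hK2 σ
    have := im2 σ
    have h3 : (q:ℝ)^δ ≤ L^(2/100:ℝ) := hqδ.trans (mono _ _ (by norm_num))
    calc _ ≤ K2 * (1 + 2 * |t|) * L^(2/100:ℝ) := by gcongr
      _ ≤ _ := mul_le_mul_of_nonneg_right (by nlinarith) (by positivity)
  have pos1 : 0 ≤ (1 + |t|) * L^(2/100:ℝ) := by positivity
  by_cases hsq : χ^2 = 1
  · rcases le_or_gt (L^(-(2/100):ℝ)) |t| with htl | htl
    · refine gen fun σ a b => ?_
      rw [hsq]
      refine (h q _ (by simpa using a) (by simpa using b)).trans ?_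
      have h2 : 1 / ‖(σ:ℂ) + 2 * Complex.I * t - 1‖ ≤ L^(2/100:ℝ) := by
        have : |t| ≤ ‖(σ:ℂ) + 2 * Complex.I * t - 1‖ := by
          refine le_trans ?_ (Complex.abs_im_le_norm _)
          simp [abs_mul]; linarith
        rw [rpow_neg hLp.le] at htl
        calc 1 / ‖(σ:ℂ) + 2 * Complex.I * t - 1‖ ≤ 1 / (L^(2/100:ℝ))⁻¹ := by
              gcongr; exact htl.trans this
          _ = _ := by simp
      have h3 := tail K hK σ
      have : 0 ≤ |t| * L^(2/100:ℝ) := by positivity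
      nlinarith [mul_nonneg (by linarith : 0 ≤ K0) pos1]
    · have ht1 : |t| ≤ 1 := htl.le.trans (rpow_le_one_of_one_le_of_nonpos hL1 (by norm_num))
      have := lip hχ (M := 2 * K1 * L^(1/200:ℝ)) (fun s a b c => (h1 q χ hχ s a b).trans (by
        calc K1 * (1 + |s.im|) * (q:ℝ)^δ ≤ K1 * (1 + 1) * L^(1/200:ℝ) := by gcongr
          _ = _ := by ring)) (s := (1 + 1/L : ℝ) + Complex.I * t) (by simp; linarith) (by
            simp only [Complex.add_re, Complex.ofReal_re, Complex.mul_re, Complex.I_re, Complex.I_im, Complex.ofReal_im]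
            linarith) (by simpa using ht1)
      have h4 := norm_sub_norm_le (DirichletCharacter.LFunction χ 1) (lc χ 0 ((1 + 1/L : ℝ) + Complex.I * t))
      rw [norm_sub_rev] at h4
      have g1 := good q χ hq hp hχ hsq
      have h5 : ‖((1 + 1/L : ℝ) + Complex.I * t : ℂ) - 1‖ ≤ 2 * L^(-(2/100):ℝ) := by
        have e : ((1 + 1/L : ℝ) + Complex.I * t : ℂ) - 1 = ((1/L:ℝ):ℂ) + Complex.I * t := by push_cast; ring
        rw [e]
        refine (norm_add_le _ _).trans ?_
        rw [Complex.norm_real, norm_of_nonneg hLi.le, norm_mul, Complex.norm_I, one_mul, Complex.norm_real, norm_eq_abs]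
        have : 1/L ≤ L^(-(2/100):ℝ) := by
          rw [one_div, ← rpow_neg_one]; exact mono _ _ (by norm_num)
        linarith
      have h6 : 2 * K1 * L^(1/200:ℝ) * ‖((1 + 1/L : ℝ) + Complex.I * t : ℂ) - 1‖ ≤ 1/2 * L^(-(1/100):ℝ) := by
        calc _ ≤ 2 * K1 * L^(1/200:ℝ) * (2 * L^(-(2/100):ℝ)) := by gcongr
          _ = 1/2 * (8 * K1 * L^(-(1/200):ℝ)) * L^(-(1/100):ℝ) := by
              have : L^(1/200:ℝ) * L^(-(2/100):ℝ) = L^(-(1/200):ℝ) * L^(-(1/100):ℝ) := by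
                rw [← rpow_add hLp, ← rpow_add hLp]; norm_num
              linear_combination 4 * K1 * this
          _ ≤ _ := by nlinarith [rpow_pos_of_pos hLp (-(1/100):ℝ)]
      calc min (c / M^4) (1/2) * L^(-(1/8):ℝ) * ((1 + |t|)^4)⁻¹ ≤ 1/2 * L^(-(1/100):ℝ) * 1 := by
            have m1 := mono (-(1/8)) (-(1/100)) (by norm_num)
            have m2 := min_le_right (c / M^4) (1/2)
            have m3 : ((1 + |t|)^4)⁻¹ ≤ 1 := inv_le_one_of_one_le₀ (one_le_pow₀ (by linarith))
            exact mul_le_mul (mul_le_mul m2 m1 (by positivity) (by positivity)) m3 (by positivity) (by positivity)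
        _ ≤ _ := by linarith
  · refine gen fun σ a b => ?_
    refine (h0 q _ hsq _ (by simpa using a) (by simpa using b)).trans ((tail K0 hK0 σ).trans ?_)
    nlinarith [mul_nonneg (by linarith : 0 ≤ K) pos1]
end BD
namespace BD
open Finset Topology MeasureTheory
open scoped FourierTransform SchwartzMap ContDiff
noncomputable def tw (ψ : ℝ → ℂ) (L : ℝ) (f : ℕ → ℂ) : ℂ :=
  ∑' n, LSeries.term f ((1 + 1/L : ℝ) : ℂ) n * ψ (Real.log n - L)
lemma inversion (ψ : 𝓢(ℝ, ℂ)) (u : ℝ) :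
    ψ u = ∫ v : ℝ, Complex.exp ((2 * π * v * u : ℝ) * Complex.I) * (𝓕 ψ) v := by
  have h1 : 𝓕⁻ (𝓕 ψ) = ψ := FourierPair.fourierInv_fourier_eq ψ
  have h2 : (𝓕⁻ (𝓕 ψ)) u = ψ u := by rw [h1]
  rw [← h2, SchwartzMap.fourierInv_coe, Real.fourierInv_eq']
  simp [mul_assoc, mul_comm, mul_left_comm]
lemma term_shift (f : ℕ → ℂ) (σ t : ℝ) (n : ℕ) :
    LSeries.term f (σ : ℂ) n * Complex.exp ((t * Real.log n : ℝ) * Complex.I) =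
    LSeries.term f (σ + Complex.I * (-t : ℝ)) n := by
  rcases Nat.eq_zero_or_pos n with rfl | hn
  · simp
  · rw [LSeries.term_of_ne_zero hn.ne', LSeries.term_of_ne_zero hn.ne']
    have hn' : (n : ℂ) ≠ 0 := by exact_mod_cast hn.ne'
    rw [Complex.cpow_add _ _ hn', Complex.cpow_def_of_ne_zero hn' (Complex.I * _), ← Complex.natCast_log, div_mul_eq_div_div,
      div_eq_mul_inv _ (Complex.exp _), ← Complex.exp_neg]
    congr 2; push_cast; ring
lemma summable_line {f : ℕ → ℂ} {σ : ℝ} (h : LSeriesSummable f σ) (t : ℝ) :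
    LSeriesSummable f (σ + Complex.I * t) := by
  refine LSeriesSummable.of_re_le_re ?_ h
  simp
lemma tw_bound (ψ : 𝓢(ℝ, ℂ)) (N : ℕ) : ∃ C : ℝ, 0 ≤ C ∧ ∀ (f : ℕ → ℂ) (L H : ℝ),
    LSeriesSummable f ((1 + 1/L : ℝ) : ℂ) →
    (∀ t : ℝ, ‖LSeries f ((1 + 1/L : ℝ) + Complex.I * t)‖ ≤ H * (1 + |t|)^N) → ‖tw ψ L f‖ ≤ C * H := by
  have hint : Integrable (fun v : ℝ => ‖(𝓕 ψ) v‖ * (1 + |-(2 * π * v)|)^N) := by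
    have : Integrable (fun v : ℝ => ∑ i ∈ range (N+1), ((N.choose i) * (2 * π)^i) * (‖v‖^i * ‖(𝓕 ψ) v‖)) :=
      integrable_finsetSum _ fun i _ => ((𝓕 ψ).integrable_pow_mul volume i).const_mul _
    refine this.congr (Eventually.of_forall fun v => ?_)
    simp only [abs_neg, abs_mul, abs_two, abs_of_pos pi_pos]
    rw [add_comm (1:ℝ), add_pow, mul_sum]
    refine sum_congr rfl fun i _ => ?_
    rw [norm_eq_abs, one_pow, mul_pow]; ring
  refine ⟨∫ v : ℝ, ‖(𝓕 ψ) v‖ * (1 + |-(2 * π * v)|)^N, integral_nonneg fun v => by positivity, fun f L H hf hH => ?_⟩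
  set σ : ℝ := 1 + 1/L
  set F : ℕ → ℝ → ℂ := fun n v => LSeries.term f (σ:ℂ) n *
    (Complex.exp ((2 * π * v * (Real.log n - L) : ℝ) * Complex.I) * (𝓕 ψ) v)
  have hFn : ∀ n v, ‖F n v‖ = ‖LSeries.term f (σ:ℂ) n‖ * ‖(𝓕 ψ) v‖ := fun n v => by
    simp only [F, norm_mul, Complex.norm_exp_ofReal_mul_I, one_mul]
  have hFi : ∀ n, Integrable (F n) := fun n => by
    refine Integrable.const_mul ?_ _
    refine (𝓕 ψ).integrable.bdd_mul (c := 1) (Continuous.aestronglyMeasurable (by fun_prop)) ?_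
    filter_upwards with v
    rw [Complex.norm_exp_ofReal_mul_I]
  have hFs : Summable fun n => ∫ v, ‖F n v‖ := by
    simp only [hFn, integral_const_mul]
    exact hf.norm.mul_right _
  have e1 : tw ψ L f = ∫ v, ∑' n, F n v := by
    rw [← integral_tsum_of_summable_integral_norm hFi hFs]
    unfold tw
    congr 1; ext n
    rw [integral_const_mul, ← inversion]
  have e2 : ∀ v, ∑' n, F n v = (𝓕 ψ) v * Complex.exp ((-(2 * π * v * L) : ℝ) * Complex.I) *
      LSeries f (σ + Complex.I * (-(2 * π * v) : ℝ)) := fun v => by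
    rw [LSeries, ← tsum_mul_left]
    congr 1; ext n
    rw [← term_shift]
    have : Complex.exp ((2 * π * v * (Real.log n - L) : ℝ) * Complex.I) =
      Complex.exp ((-(2 * π * v * L) : ℝ) * Complex.I) * Complex.exp ((2 * π * v * Real.log n : ℝ) * Complex.I) := by
      rw [← Complex.exp_add]; congr 1; push_cast; ring
    simp only [F, this]; ring
  rw [e1, mul_comm, ← integral_const_mul]
  refine norm_integral_le_of_norm_le (hint.const_mul _) (Eventually.of_forall fun v => ?_)
  rw [e2, norm_mul, norm_mul, Complex.norm_exp_ofReal_mul_I, mul_one]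
  calc _ ≤ ‖(𝓕 ψ) v‖ * (H * (1 + |-(2 * π * v)|)^N) := by gcongr; exact hH _
    _ = _ := by ring
lemma tw_add {ψ : 𝓢(ℝ, ℂ)} {L : ℝ} {f : ℕ → ℂ} (hf : LSeriesSummable f ((1 + 1/L : ℝ) : ℂ)) :
    Summable fun n : ℕ => LSeries.term f ((1 + 1/L : ℝ) : ℂ) n * ψ (Real.log n - L) := by
  obtain ⟨C, hC⟩ := ψ.decay 0 0
  refine (hf.norm.mul_right C).of_norm_bounded fun n => ?_
  rw [norm_mul]
  gcongr
  simpa using hC.2 (Real.log n - L)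
lemma tw_lin {ψ : 𝓢(ℝ, ℂ)} {L : ℝ} {ι : Type*} (s : Finset ι) (c : ι → ℂ) (f : ι → ℕ → ℂ)
    (hf : ∀ i ∈ s, LSeriesSummable (f i) ((1 + 1/L : ℝ) : ℂ)) :
    tw ψ L (∑ i ∈ s, c i • f i) = ∑ i ∈ s, c i * tw ψ L (f i) := by
  unfold tw
  simp_rw [← tsum_mul_left]
  rw [← Summable.tsum_finsetSum fun i hi => (tw_add (hf i hi)).mul_left _]
  congr 1; ext n
  rw [LSeries.term_sum, Finset.sum_apply, sum_mul]
  refine sum_congr rfl fun i _ => ?_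
  rw [LSeries.term_smul, Pi.smul_apply, smul_eq_mul, mul_assoc]
lemma tw_family (ψ : 𝓢(ℝ, ℂ)) (N : ℕ) : ∃ C : ℝ, 0 ≤ C ∧ ∀ {ι : Type} (s : Finset ι) (f : ι → ℕ → ℂ) (L H : ℝ),
    (∀ i ∈ s, LSeriesSummable (f i) ((1 + 1/L : ℝ) : ℂ)) →
    (∀ t : ℝ, ∑ i ∈ s, ‖LSeries (f i) ((1 + 1/L : ℝ) + Complex.I * t)‖ ≤ H * (1 + |t|)^N) →
    ∑ i ∈ s, ‖tw ψ L (f i)‖ ≤ C * H := by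
  obtain ⟨C, hC, h⟩ := tw_bound ψ N
  refine ⟨C, hC, fun {ι} s f L H hs hH => ?_⟩
  have : ∀ z : ℂ, ∃ c : ℂ, ‖c‖ ≤ 1 ∧ c * z = ‖z‖ := fun z => by
    rcases eq_or_ne z 0 with rfl | hz
    · exact ⟨0, by simp⟩
    · refine ⟨‖z‖ / z, ?_, by field_simp⟩
      rw [norm_div, Complex.norm_real, norm_norm, div_self (norm_ne_zero_iff.2 hz)]
  choose c hc1 hc2 using this
  have e := tw_lin (ψ := ψ) s (fun i => c (tw ψ L (f i))) f hs
  simp only [hc2] at e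
  have e' : ‖tw ψ L (∑ i ∈ s, c (tw ψ L (f i)) • f i)‖ = ∑ i ∈ s, ‖tw ψ L (f i)‖ := by
    rw [e, ← Complex.ofReal_sum, Complex.norm_real, norm_of_nonneg (by positivity)]
  rw [← e']
  have hs' : ∀ i ∈ s, ∀ t : ℝ, LSeriesSummable (c (tw ψ L (f i)) • f i) ((1 + 1/L : ℝ) + Complex.I * t) :=
    fun i hi t => (summable_line (hs i hi) t).smul _
  refine h _ L H ?_ fun t => ?_
  · refine LSeriesSummable.sum fun i hi => ?_
    exact (hs i hi).smul _
  · rw [LSeries_sum fun i hi => hs' i hi t]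
    refine le_trans ((norm_sum_le _ _).trans (sum_le_sum fun i _ => ?_)) (hH t)
    rw [LSeries_smul, norm_mul]
    exact mul_le_of_le_one_left (norm_nonneg _) (hc1 _)
end BD
namespace BD
open Finset Topology MeasureTheory
open scoped FourierTransform SchwartzMap ContDiff
open ArithmeticFunction (vonMangoldt)
noncomputable def bmp : ContDiffBump (0:ℝ) := ⟨3, 4, by norm_num, by norm_num⟩
noncomputable def psi (m : ℕ) : 𝓢(ℝ, ℂ) :=
  HasCompactSupport.toSchwartzMap (f := fun u : ℝ => ((-u : ℝ) : ℂ)^m * ((bmp u : ℝ) : ℂ))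
    (HasCompactSupport.mul_left (by
      exact bmp.hasCompactSupport.comp_left (g := fun x : ℝ => (x:ℂ)) (by simp)))
    (by
      have h1 : ContDiff ℝ ∞ (fun u : ℝ => ((bmp u : ℝ) : ℂ)) :=
        Complex.ofRealCLM.contDiff.comp bmp.contDiff
      have h2 : ContDiff ℝ ∞ (fun u : ℝ => ((-u : ℝ) : ℂ)) :=
        Complex.ofRealCLM.contDiff.comp contDiff_neg
      exact (h2.pow m).mul h1)
lemma psi_apply (m : ℕ) (u : ℝ) : psi m u = ((-u : ℝ) : ℂ)^m * ((bmp u : ℝ) : ℂ) := rfl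
noncomputable def vL {q : ℕ} (χ : DirichletCharacter ℂ q) (i : ℕ) (n : ℕ) : ℂ :=
  χ n * (vonMangoldt n : ℂ) * (Real.log n : ℂ)^i
lemma summable_of_le {f : ℕ → ℂ} {g : ℕ → ℂ} {s : ℂ} (h : ∀ n, ‖f n‖ ≤ ‖g n‖) (hg : LSeriesSummable g s) :
    LSeriesSummable f s :=
  hg.norm.of_norm_bounded fun n => LSeries.norm_term_le s (h n)
lemma vL_summable {q : ℕ} (χ : DirichletCharacter ℂ q) (i : ℕ) {s : ℂ} (hs : 1 < s.re) :
    LSeriesSummable (vL χ i) s := by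
  refine summable_of_le (fun n => ?_) (ell_summable (a := 1) (A := 1) (i+1) (by simp) hs)
  simp only [vL, norm_mul, Complex.norm_real, norm_pow, Pi.one_apply, one_mul]
  rw [pow_succ', norm_of_nonneg ArithmeticFunction.vonMangoldt_nonneg, norm_of_nonneg (log_natCast_nonneg n)]
  have := ArithmeticFunction.vonMangoldt_le_log (n := n)
  have h2 := DirichletCharacter.norm_le_one χ n
  have h3 := ArithmeticFunction.vonMangoldt_nonneg (n := n)
  have : ‖χ n‖ * vonMangoldt n ≤ Real.log n := by nlinarith
  have := log_natCast_nonneg n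
  gcongr
lemma vL_rec {q : ℕ} (χ : DirichletCharacter ℂ q) (i : ℕ) {s : ℂ} (hs : 1 < s.re) :
    ∑ r ∈ range (i+1), (i.choose r : ℂ) * (LSeries (vL χ r) s * lc χ (i - r) s) = lc χ (i+1) s := by
  have hl : ∀ r, LSeriesSummable (fun n : ℕ => χ n * (Real.log n : ℂ)^r) s := fun r =>
    ell_summable (A := 1) r (fun n => DirichletCharacter.norm_le_one χ n) hs
  simp only [lc, ell]
  have e : ∀ r ∈ range (i+1), (i.choose r : ℂ) * (LSeries (vL χ r) s * LSeries (fun n => χ n * (Real.log n : ℂ)^(i-r)) s)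
      = LSeries ((i.choose r : ℂ) • LSeries.convolution (vL χ r) (fun n => χ n * (Real.log n : ℂ)^(i-r))) s := fun r _ => by
    rw [LSeries_smul, LSeries_convolution' (vL_summable χ r hs) (hl _)]
  rw [sum_congr rfl e, ← LSeries_sum fun r _ => ((vL_summable χ r hs).convolution (hl _)).smul _]
  refine LSeries_congr (fun {n} hn => ?_) s
  simp only [Finset.sum_apply, Pi.smul_apply, LSeries.convolution_def, smul_eq_mul, mul_sum]
  rw [sum_comm]
  have e2 : ∀ p ∈ n.divisorsAntidiagonal, ∑ r ∈ range (i+1), (i.choose r : ℂ) * (vL χ r p.1 * (χ p.2 * (Real.log p.2 : ℂ)^(i-r)))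
      = χ n * (Real.log n : ℂ)^i * (vonMangoldt p.1 : ℂ) := fun p hp => by
    obtain ⟨h1, h2⟩ := Nat.mem_divisorsAntidiagonal.1 hp
    have h3 : p.1 ≠ 0 := fun h => by simp [h] at h1; omega
    have h4 : p.2 ≠ 0 := fun h => by simp [h] at h1; omega
    rw [← h1, Nat.cast_mul, Nat.cast_mul, map_mul, Real.log_mul (by exact_mod_cast h3) (by exact_mod_cast h4), Complex.ofReal_add,
      add_pow, mul_sum, sum_mul]
    refine sum_congr rfl fun r _ => ?_
    simp only [vL]; ring
  rw [sum_congr rfl e2, ← mul_sum, Nat.sum_divisorsAntidiagonal (fun d _ => (vonMangoldt d : ℂ)), ← Complex.ofReal_sum,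
    ArithmeticFunction.vonMangoldt_sum]
  ring
lemma vL_bound (i : ℕ) : ∃ c : ℝ, 0 ≤ c ∧ ∀ (q : ℕ) (χ : DirichletCharacter ℂ q) (s : ℂ) (B : ℝ), 1 < s.re → 1 ≤ B →
    (∀ r ≤ i + 1, ‖lc χ r s‖ ≤ B) → B⁻¹ ≤ ‖lc χ 0 s‖ → ‖LSeries (vL χ i) s‖ ≤ c * B^(2*(i+1)) := by
  induction i using Nat.strong_induction_on with
  | _ i ih =>
  choose! c hc h using ih
  refine ⟨1 + ∑ r ∈ range i, (i.choose r) * c r, by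
    have := sum_nonneg fun r hr => mul_nonneg (Nat.cast_nonneg (α := ℝ) (i.choose r)) (hc r (mem_range.1 hr))
    linarith, fun q χ s B hs hB hl h0 => ?_⟩
  have hrec := vL_rec χ i hs
  rw [sum_range_succ, Nat.choose_self, Nat.sub_self, Nat.cast_one, one_mul] at hrec
  have hBp : 0 < B := by linarith
  have e : LSeries (vL χ i) s * lc χ 0 s = lc χ (i+1) s - ∑ r ∈ range i, (i.choose r : ℂ) * (LSeries (vL χ r) s * lc χ (i - r) s) := by
    rw [← hrec]; ring
  have h1 : ‖LSeries (vL χ i) s * lc χ 0 s‖ ≤ B^(2*i+1) + ∑ r ∈ range i, (i.choose r) * c r * B^(2*i+1) := by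
    rw [e]
    refine (norm_sub_le _ _).trans (add_le_add ((hl _ le_rfl).trans (le_self_pow₀ hB (by omega))) ((norm_sum_le _ _).trans (sum_le_sum fun r hr => ?_)))
    have hr' := mem_range.1 hr
    rw [norm_mul, norm_mul, Complex.norm_natCast, mul_assoc]
    have a1 := h r hr' q χ s B hs hB (fun r' hr'' => hl r' (by omega)) h0
    have a2 := hl (i-r) (by omega)
    have a3 := hc r hr'
    have : B^(2*(r+1)) * B ≤ B^(2*i+1) := by rw [← pow_succ]; exact pow_le_pow_right₀ hB (by omega)
    refine mul_le_mul_of_nonneg_left ?_ (by positivity)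
    calc _ ≤ c r * B^(2*(r+1)) * B := by gcongr
      _ = c r * (B^(2*(r+1)) * B) := by ring
      _ ≤ _ := by gcongr
  rw [norm_mul] at h1
  have h2 : ‖LSeries (vL χ i) s‖ * B⁻¹ ≤ ‖LSeries (vL χ i) s‖ * ‖lc χ 0 s‖ := by gcongr
  have h3 := h2.trans h1
  rw [← div_eq_mul_inv, div_le_iff₀ hBp] at h3
  refine h3.trans (le_of_eq ?_)
  rw [← sum_mul]; ring
lemma tw_expand {q : ℕ} (χ : DirichletCharacter ℂ q) {L : ℝ} (hL : 0 < L) (j : ℕ) :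
    (L:ℂ)^j * tw (psi 0) L (vL χ 0) = ∑ i ∈ range (j+1), (j.choose i : ℂ) * tw (psi (j - i)) L (vL χ i) := by
  have hs : ∀ i, LSeriesSummable (vL χ i) ((1 + 1/L : ℝ) : ℂ) := fun i =>
    vL_summable χ i (by simp [hL])
  unfold tw
  simp_rw [← tsum_mul_left]
  rw [← Summable.tsum_finsetSum fun i _ => (tw_add (hs i)).mul_left _]
  congr 1; ext n
  rcases Nat.eq_zero_or_pos n with rfl | hn
  · simp
  simp only [psi_apply, LSeries.term_of_ne_zero hn.ne', vL]
  have : (L:ℂ) = (Real.log n : ℂ) + ((-(Real.log n - L) : ℝ) : ℂ) := by push_cast; ring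
  conv_lhs => rw [this, add_pow, sum_mul]
  refine sum_congr rfl fun i _ => ?_
  simp only [pow_zero]; ring
theorem siegel {A : ℝ} (hA : 0 < A) (m : ℕ) : ∃ C L0 : ℝ, 0 ≤ C ∧ ∀ L, L0 ≤ L → Good A L → ∀ (q : ℕ) [NeZero q]
    (χ : DirichletCharacter ℂ q), (q:ℝ) ≤ L^A → χ.IsPrimitive → χ ≠ 1 →
    ‖tw (psi 0) L (vL χ 0)‖ ≤ C * L^(-(m:ℝ)) := by
  set δ : ℝ := min 1 (1/(8*A)) with hδ
  have hδ0 : 0 < δ := by rw [hδ]; positivity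
  have hδA : A * δ ≤ 1/8 := by
    calc A * δ ≤ A * (1/(8*A)) := by gcongr; exact min_le_right _ _
      _ = 1/8 := by field_simp
  set j := 2 * m + 1 with hj
  obtain ⟨c, L0, hc, hlow⟩ := lc_inv hA
  choose K hK hK' using fun r => lc_bound r hδ0 (min_le_left 1 (1/(8*A)))
  choose d hd hd' using vL_bound
  choose T hT hT' using fun m => fun N => tw_bound (psi m) N
  set M := 1/c + ∑ r ∈ range (j+2), K r with hM
  have hKs : ∀ r ≤ j + 1, K r ≤ ∑ r ∈ range (j+2), K r := fun r hr =>
    single_le_sum (f := K) (fun i _ => by linarith [hK i]) (mem_range.2 (by omega))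
  have hM1 : 1 ≤ M := by
    have := (hK 0).trans (hKs 0 (by omega)); have : 0 < 1/c := by positivity
    linarith
  refine ⟨∑ i ∈ range (j+1), (j.choose i) * (T (j-i) (8*(i+1)) * (d i * M^(2*(i+1)))), max L0 1, ?_, fun L hL good q _ χ hq hp hχ => ?_⟩
  · refine sum_nonneg fun i _ => ?_
    have := hd i; have := hT (j-i) (8*(i+1)); positivity
  have hL1 : 1 ≤ L := (le_max_right _ _).trans hL
  have hLp : 0 < L := by linarith
  have hqδ : (q:ℝ)^δ ≤ L^(1/8:ℝ) := by
    calc (q:ℝ)^δ ≤ (L^A)^δ := by gcongr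
      _ = L^(A*δ) := by rw [← rpow_mul hLp.le]
      _ ≤ _ := rpow_le_rpow_of_exponent_le hL1 hδA
  have hLi : 0 < 1/L := by positivity
  have hLi1 : 1/L ≤ 1 := by rw [div_le_one hLp]; exact hL1
  have key : ∀ i ≤ j, ‖tw (psi (j-i)) L (vL χ i)‖ ≤ T (j-i) (8*(i+1)) * (d i * M^(2*(i+1))) * L^((j+1)/4:ℝ) := fun i hi => by
    have := hT' (j-i) (8*(i+1)) (vL χ i) L ((d i * M^(2*(i+1))) * L^((j+1)/4:ℝ)) (vL_summable χ i (by simp [hLp])) fun t => by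
      have ht := abs_nonneg t
      have ht1 : 1 ≤ (1 + |t|)^4 := one_le_pow₀ (by linarith)
      have ht4 : 1 + |t| ≤ (1 + |t|)^4 := le_self_pow₀ (by linarith) (by norm_num)
      have hl8 : 1 ≤ L^(1/8:ℝ) := one_le_rpow hL1 (by norm_num)
      have hB1 : 1 ≤ M * L^(1/8:ℝ) * (1 + |t|)^4 := by
        have : 1 ≤ M * L^(1/8:ℝ) := by nlinarith
        nlinarith
      have := hd' i q χ ((1 + 1/L : ℝ) + Complex.I * t) (M * L^(1/8:ℝ) * (1 + |t|)^4) (by simp [hLp]) hB1 (fun r hr => by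
          refine (hK' r q χ hχ _ (by simp [hLp]) (by simp; rw [← one_div]; linarith)).trans ?_
          have e : |(((1 + 1/L : ℝ):ℂ) + Complex.I * t).im| = |t| := by simp
          have hKM : K r ≤ M := by have := hKs r (by omega); have : 0 < 1/c := by positivity
                                   linarith
          have := hK r
          rw [e]
          calc K r * (1 + |t|) * (q:ℝ)^δ ≤ M * (1 + |t|)^4 * L^(1/8:ℝ) := by gcongr
            _ = _ := by ring) (by
          refine le_trans ?_ (hlow L ((le_max_left _ _).trans hL) good q χ hq hp hχ t)
          rw [mul_inv, mul_inv, rpow_neg hLp.le]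
          gcongr
          rw [inv_le_comm₀ (by linarith) hc, ← one_div]
          have := sum_nonneg fun r (_ : r ∈ range (j+2)) => zero_le_one.trans (hK r)
          linarith)
      refine this.trans ?_
      rw [mul_pow, mul_pow, ← pow_mul, ← rpow_natCast (L^(1/8:ℝ)), ← rpow_mul hLp.le]
      have e1 : L^((1/8:ℝ) * ((2*(i+1):ℕ):ℝ)) ≤ L^((j+1)/4:ℝ) := by
        refine rpow_le_rpow_of_exponent_le hL1 ?_
        have : (i:ℝ) ≤ j := by exact_mod_cast hi
        push_cast; linarith
      have e2 : 4 * (2 * (i+1)) = 8 * (i+1) := by ring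
      rw [e2]
      have := hd i
      calc d i * (M^(2*(i+1)) * L^((1/8:ℝ) * ((2*(i+1):ℕ):ℝ)) * (1+|t|)^(8*(i+1))) ≤ d i * (M^(2*(i+1)) * L^((j+1)/4:ℝ) * (1+|t|)^(8*(i+1))) := by gcongr
        _ = _ := by ring
    linarith
  have h1 : L^j * ‖tw (psi 0) L (vL χ 0)‖ ≤ (∑ i ∈ range (j+1), (j.choose i) * (T (j-i) (8*(i+1)) * (d i * M^(2*(i+1))))) * L^((j+1)/4:ℝ) := by
    have := congrArg norm (tw_expand χ hLp j)
    rw [norm_mul, norm_pow, Complex.norm_real, norm_of_nonneg hLp.le] at this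
    rw [this, sum_mul]
    refine (norm_sum_le _ _).trans (sum_le_sum fun i hi => ?_)
    rw [norm_mul, Complex.norm_natCast, mul_assoc]
    gcongr
    exact key i (by have := mem_range.1 hi; omega)
  set S := (∑ i ∈ range (j+1), (j.choose i) * (T (j-i) (8*(i+1)) * (d i * M^(2*(i+1))))) with hS
  have hS0 : 0 ≤ S := by
    refine sum_nonneg fun i _ => ?_
    have := hd i; have := hT (j-i) (8*(i+1)); positivity
  have h2 : ‖tw (psi 0) L (vL χ 0)‖ ≤ S * L^((j+1)/4:ℝ) / L^j := by
    rw [le_div_iff₀ (by positivity)]; linarith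
  refine h2.trans ?_
  rw [mul_div_assoc, ← rpow_natCast L j, ← rpow_sub hLp]
  refine mul_le_mul_of_nonneg_left (rpow_le_rpow_of_exponent_le hL1 ?_) hS0
  rw [hj]; push_cast; linarith [Nat.cast_nonneg (α := ℝ) m]
end BD
namespace BD
open Finset Topology
open ArithmeticFunction (vonMangoldt)
lemma large_sieve {ι : Type*} (s : Finset ι) (u : ι → ℕ → ℂ) (w : ℕ → ℝ) (hw0 : ∀ n, 0 ≤ w n) (hw : Summable w)
    (hu : ∀ i n, ‖u i n‖ ≤ 1) {D0 D : ℝ} (hD0 : 0 < D0) (hD : 0 ≤ D) (hd : ∑' n, w n ≤ D0)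
    (ho : ∀ i ∈ s, ∀ j ∈ s, i ≠ j → ‖∑' n, (w n : ℂ) * (u i n * (starRingEnd ℂ) (u j n))‖ ≤ D)
    (a : ℕ → ℂ) (ha : Summable fun n => w n * ‖a n‖^2) :
    ∑ i ∈ s, ‖∑' n, (w n : ℂ) * a n * u i n‖^2 ≤ (D0 + #s * D) * ∑' n, w n * ‖a n‖^2 := by
  classical
  set A : ι → ℂ := fun i => ∑' n, (w n : ℂ) * a n * u i n with hA
  set S : ℝ := ∑ i ∈ s, ‖A i‖^2 with hS
  set v : ℕ → ℂ := fun n => ∑ i ∈ s, (starRingEnd ℂ) (A i) * u i n with hv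
  set l := D0 + #s * D with hl
  have hlp : 0 < l := by positivity
  have hwu : ∀ i j, Summable fun n => (w n : ℂ) * (u i n * (starRingEnd ℂ) (u j n)) := fun i j => by
    refine hw.of_norm_bounded fun n => ?_
    rw [norm_mul, norm_mul, Complex.norm_real, norm_of_nonneg (hw0 n), RCLike.norm_conj]
    exact mul_le_of_le_one_right (hw0 n) (mul_le_one₀ (hu i n) (norm_nonneg _) (hu j n))
  have hwa : ∀ i, Summable fun n => (w n : ℂ) * a n * u i n := fun i => by
    refine (hw.add ha).of_norm_bounded fun n => ?_
    rw [norm_mul, norm_mul, Complex.norm_real, norm_of_nonneg (hw0 n)]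
    have := hw0 n; have := hu i n; have h3 := norm_nonneg (a n)
    calc w n * ‖a n‖ * ‖u i n‖ ≤ w n * ‖a n‖ * 1 := by gcongr
      _ ≤ w n * (1 + ‖a n‖^2) := by rw [mul_one]; gcongr; nlinarith [sq_nonneg (‖a n‖ - 1)]
      _ = _ := by ring
  -- G
  have hG : ∀ i ∈ s, ∀ j ∈ s, ‖∑' n, (w n : ℂ) * (u i n * (starRingEnd ℂ) (u j n))‖ ≤ D + if i = j then D0 else 0 := by
    intro i hi j hj
    by_cases hij : i = j
    · rw [if_pos hij]
      have : ‖∑' n, (w n : ℂ) * (u i n * (starRingEnd ℂ) (u j n))‖ ≤ ∑' n, w n := by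
        refine tsum_of_norm_bounded hw.hasSum fun n => ?_
        rw [norm_mul, norm_mul, Complex.norm_real, norm_of_nonneg (hw0 n), RCLike.norm_conj]
        exact mul_le_of_le_one_right (hw0 n) (mul_le_one₀ (hu i n) (norm_nonneg _) (hu j n))
      linarith
    · rw [if_neg hij, add_zero]; exact ho i hi j hj hij
  have hv2 : ∀ n, ((w n * ‖v n‖^2 : ℝ) : ℂ) = ∑ i ∈ s, ∑ j ∈ s, (starRingEnd ℂ) (A i) * A j * ((w n : ℂ) * (u i n * (starRingEnd ℂ) (u j n))) := fun n => by
    rw [Complex.ofReal_mul, Complex.ofReal_pow, ← Complex.mul_conj', hv]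
    simp only [map_sum, map_mul, Complex.conj_conj]
    rw [sum_mul_sum, mul_sum]
    refine sum_congr rfl fun i _ => ?_
    rw [mul_sum]
    exact sum_congr rfl fun j _ => by ring
  have hvs : HasSum (fun n => ((w n * ‖v n‖^2 : ℝ) : ℂ)) (∑ i ∈ s, ∑ j ∈ s, (starRingEnd ℂ) (A i) * A j *
      ∑' n, ((w n : ℂ) * (u i n * (starRingEnd ℂ) (u j n)))) := by
    simp_rw [hv2]
    exact hasSum_sum fun i _ => hasSum_sum fun j _ => (hwu i j).hasSum.mul_left _
  have hvs' : Summable fun n => w n * ‖v n‖^2 := Complex.summable_ofReal.1 hvs.summable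
  have hW : ∑' n, w n * ‖v n‖^2 ≤ l * S := by
    have e : ‖((∑' n, w n * ‖v n‖^2 : ℝ) : ℂ)‖ = ∑' n, w n * ‖v n‖^2 := by
      rw [Complex.norm_real, norm_of_nonneg (tsum_nonneg fun n => mul_nonneg (hw0 n) (by positivity))]
    rw [← e, Complex.ofReal_tsum, hvs.tsum_eq]
    calc _ ≤ ∑ i ∈ s, ∑ j ∈ s, ‖A i‖ * ‖A j‖ * (D + if i = j then D0 else 0) := by
          refine (norm_sum_le _ _).trans (sum_le_sum fun i hi => (norm_sum_le _ _).trans (sum_le_sum fun j hj => ?_))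
          rw [norm_mul, norm_mul, RCLike.norm_conj]
          gcongr
          exact hG i hi j hj
      _ = D * (∑ i ∈ s, ‖A i‖)^2 + D0 * S := by
          simp only [mul_add, sum_add_distrib, mul_ite, mul_zero, sum_ite_eq]
          congr 1
          · rw [sq, sum_mul_sum, mul_sum]
            refine sum_congr rfl fun i _ => ?_
            rw [mul_sum]
            exact sum_congr rfl fun j _ => by ring
          · rw [hS, mul_sum]
            exact sum_congr rfl fun i hi => by rw [if_pos hi]; ring
      _ ≤ D * (#s * S) + D0 * S := by gcongr; exact sq_sum_le_card_mul_sum_sq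
      _ = _ := by rw [hl]; ring
  have hSe : (S : ℂ) = ∑' n, (w n : ℂ) * a n * v n := by
    have : HasSum (fun n => (w n : ℂ) * a n * v n) (∑ i ∈ s, (starRingEnd ℂ) (A i) * A i) := by
      have h1 : ∀ n, (w n : ℂ) * a n * v n = ∑ i ∈ s, (starRingEnd ℂ) (A i) * ((w n : ℂ) * a n * u i n) := fun n => by
        rw [hv, mul_sum]; exact sum_congr rfl fun i _ => by ring
      simp_rw [h1]
      exact hasSum_sum fun i _ => (hwa i).hasSum.mul_left _
    rw [this.tsum_eq, hS, Complex.ofReal_sum]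
    exact sum_congr rfl fun i _ => by rw [Complex.conj_mul', Complex.ofReal_pow]
  have hfin : S ≤ ∑' n, (l/2 * (w n * ‖a n‖^2) + 1/(2*l) * (w n * ‖v n‖^2)) := by
    have hS0 : 0 ≤ S := by positivity
    have : S = ‖(S:ℂ)‖ := by rw [Complex.norm_real, norm_of_nonneg hS0]
    rw [this, hSe]
    refine tsum_of_norm_bounded ((ha.mul_left _).add (hvs'.mul_left _)).hasSum fun n => ?_
    rw [norm_mul, norm_mul, Complex.norm_real, norm_of_nonneg (hw0 n)]
    have h1 : ‖a n‖ * ‖v n‖ ≤ l/2 * ‖a n‖^2 + 1/(2*l) * ‖v n‖^2 := by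
      have := sq_nonneg (l * ‖a n‖ - ‖v n‖)
      rw [← sub_nonneg]
      have e : l/2 * ‖a n‖^2 + 1/(2*l) * ‖v n‖^2 - ‖a n‖ * ‖v n‖ = (l * ‖a n‖ - ‖v n‖)^2 / (2*l) := by
        field_simp; ring
      rw [e]; positivity
    calc _ = w n * (‖a n‖ * ‖v n‖) := by ring
      _ ≤ w n * _ := mul_le_mul_of_nonneg_left h1 (hw0 n)
      _ = _ := by ring
  rw [Summable.tsum_add (ha.mul_left _) (hvs'.mul_left _), tsum_mul_left, tsum_mul_left] at hfin
  have : 1/(2*l) * ∑' n, w n * ‖v n‖^2 ≤ S / 2 := by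
    calc _ ≤ 1/(2*l) * (l * S) := by gcongr
      _ = _ := by field_simp
  linarith
lemma nonneg_LSeries {f : ℕ → ℂ} {σ : ℝ} (h0 : ∀ n, f n = (‖f n‖ : ℂ)) :
    ‖LSeries f σ‖ = ∑' n, ‖LSeries.term f σ n‖ := by
  have e : LSeries f σ = ((∑' n, ‖LSeries.term f σ n‖ : ℝ) : ℂ) := by
    rw [Complex.ofReal_tsum, LSeries]
    congr 1; ext n
    rcases Nat.eq_zero_or_pos n with rfl | hn
    · simp
    rw [LSeries.norm_term_eq, if_neg hn.ne', LSeries.term_of_ne_zero hn.ne', h0 n]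
    push_cast
    rw [Complex.ofReal_cpow (by positivity)]; simp
  rw [e, Complex.norm_real, norm_of_nonneg (tsum_nonneg fun n => norm_nonneg _)]
lemma nterm (f : ℕ → ℂ) {σ : ℝ} (hσ : 1 < σ) (n : ℕ) : ‖LSeries.term f σ n‖ = (n:ℝ)^(-σ) * ‖f n‖ := by
  rw [LSeries.norm_term_eq]
  rcases Nat.eq_zero_or_pos n with rfl | hn
  · simp [zero_rpow (by linarith : -σ ≠ 0)]
  · rw [if_neg hn.ne', rpow_neg (by positivity), Complex.ofReal_re]; field_simp
lemma nsum {σ : ℝ} (hσ : 1 < σ) : Summable fun n : ℕ => (n:ℝ)^(-σ) := by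
  rw [Real.summable_nat_rpow]; linarith
lemma mom1 : ∃ C : ℝ, 0 ≤ C ∧ ∀ L : ℝ, 1 ≤ L → (Summable fun n : ℕ => (n:ℝ)^(-(1+1/L)) * (vonMangoldt n)^2) ∧
    ∑' n : ℕ, (n:ℝ)^(-(1+1/L)) * (vonMangoldt n)^2 ≤ C * L^3 := by
  obtain ⟨K, hK, h⟩ := one_real_bound
  refine ⟨32 * K, by linarith, fun L hL => ?_⟩
  have hLp : 0 < L := by linarith
  have h1 := (h 1 (1/(2*L)) (by positivity) (by rw [div_le_one (by positivity)]; linarith)).2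
  have hs : Summable fun n : ℕ => 16 * L^2 * (n:ℝ)^(-(1+1/(2*L))) :=
    (nsum (by have : 0 < 1/(2*L) := by positivity
              linarith)).mul_left _
  have hle : ∀ n : ℕ, (n:ℝ)^(-(1+1/L)) * (vonMangoldt n)^2 ≤ 16 * L^2 * (n:ℝ)^(-(1+1/(2*L))) := fun n => by
    rcases Nat.eq_zero_or_pos n with rfl | hn
    · simp; positivity
    have hn0 : (0:ℝ) < n := by exact_mod_cast hn
    have a1 : vonMangoldt n ≤ 4 * L * (n:ℝ)^(1/(4*L)) := by
      refine ArithmeticFunction.vonMangoldt_le_log.trans ((log_le_rpow_div hn0.le (ε := 1/(4*L)) (by positivity)).trans (le_of_eq ?_))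
      field_simp
    calc (n:ℝ)^(-(1+1/L)) * (vonMangoldt n)^2 ≤ (n:ℝ)^(-(1+1/L)) * (4 * L * (n:ℝ)^(1/(4*L)))^2 := by
          have := ArithmeticFunction.vonMangoldt_nonneg (n := n); gcongr
      _ = 16 * L^2 * ((n:ℝ)^(-(1+1/L)) * ((n:ℝ)^(1/(4*L)) * (n:ℝ)^(1/(4*L)))) := by ring
      _ = _ := by
          rw [← rpow_add hn0, ← rpow_add hn0]; congr 2; field_simp; ring
  have hs' := hs.of_nonneg_of_le (fun n => by positivity) hle
  refine ⟨hs', (hs'.tsum_le_tsum hle hs).trans ?_⟩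
  rw [tsum_mul_left]
  calc _ ≤ 16 * L^2 * (K / (1/(2*L))) := by gcongr
    _ = _ := by field_simp; norm_num
lemma tau_sq (n : ℕ) : (#n.divisors)^2 ≤ ∑ p ∈ n.divisorsAntidiagonal, #p.1.divisors * #p.2.divisors := by
  have : ∀ p ∈ n.divisorsAntidiagonal, #n.divisors ≤ #p.1.divisors * #p.2.divisors := fun p hp => by
    rw [← (Nat.mem_divisorsAntidiagonal.1 hp).1, Nat.divisors_mul]
    exact card_mul_le
  calc _ = ∑ p ∈ n.divisorsAntidiagonal, #n.divisors := by
        rw [sum_const, smul_eq_mul, sq, ← Nat.map_div_right_divisors, card_map]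
    _ ≤ _ := sum_le_sum this
lemma mom2 : ∃ C : ℝ, 0 ≤ C ∧ ∀ L : ℝ, 1 ≤ L → (Summable fun n : ℕ => (n:ℝ)^(-(1+1/L)) * (#n.divisors : ℝ)^2) ∧
    ∑' n : ℕ, (n:ℝ)^(-(1+1/L)) * (#n.divisors : ℝ)^2 ≤ C * L^4 := by
  obtain ⟨K, hK, h⟩ := one_real_bound
  refine ⟨K^4, by positivity, fun L hL => ?_⟩
  have hLp : 0 < L := by linarith
  have hσ : 1 < 1 + 1/L := by have : 0 < 1/L := by positivity
                              linarith
  have h1 := (h 1 (1/L) (by positivity) (by rw [div_le_one (by positivity)]; linarith)).2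
  have hone : LSeriesSummable (1 : ℕ → ℂ) ((1+1/L:ℝ):ℂ) := LSeriesSummable_one_iff.2 (by simpa using hσ)
  set d : ℕ → ℂ := LSeries.convolution 1 1 with hd
  have hdn : ∀ n, d n = (#n.divisors : ℂ) := fun n => by
    rw [hd, LSeries.convolution_def]; simp [← Nat.map_div_right_divisors]
  have hds : LSeriesSummable d ((1+1/L:ℝ):ℂ) := hone.convolution hone
  have hdd := hds.convolution hds
  have hddn : ∀ n, LSeries.convolution d d n = ((∑ p ∈ n.divisorsAntidiagonal, #p.1.divisors * #p.2.divisors : ℕ) : ℂ) := fun n => by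
    rw [LSeries.convolution_def]; simp [hdn]
  have h2 := nonneg_LSeries (f := LSeries.convolution d d) (σ := 1+1/L) (fun n => by rw [hddn, Complex.norm_natCast]; simp)
  have h3 := nonneg_LSeries (f := 1) (σ := 1+1/L) (fun n => by simp)
  rw [LSeries_convolution' hds hds, LSeries_convolution' hone hone] at h2
  simp only [nterm _ hσ, norm_mul] at h2 h3
  rw [h3] at h2
  have hle : ∀ n : ℕ, (n:ℝ)^(-(1+1/L)) * (#n.divisors : ℝ)^2 ≤ (n:ℝ)^(-(1+1/L)) * ‖LSeries.convolution d d n‖ := fun n => by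
    rw [hddn, Complex.norm_natCast]
    gcongr
    exact_mod_cast tau_sq n
  have hsum : Summable fun n : ℕ => (n:ℝ)^(-(1+1/L)) * ‖LSeries.convolution d d n‖ := by
    simpa only [nterm _ hσ] using hdd.norm
  have hs' := hsum.of_nonneg_of_le (fun n => by positivity) hle
  refine ⟨hs', (hs'.tsum_le_tsum hle hsum).trans ?_⟩
  rw [← h2]
  simp only [Pi.one_apply, norm_one, mul_one]
  have : 0 ≤ ∑' n : ℕ, (n:ℝ)^(-(1+1/L)) := tsum_nonneg fun n => by positivity
  calc _ ≤ (K / (1/L)) * (K / (1/L)) * ((K / (1/L)) * (K / (1/L))) := by gcongr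
    _ = _ := by field_simp
end BD
namespace BD
open Finset Topology
open ArithmeticFunction (vonMangoldt)
open scoped ArithmeticFunction.Moebius ArithmeticFunction.zeta
noncomputable def lo (U : ℕ) (f : ArithmeticFunction ℂ) : ArithmeticFunction ℂ := ⟨fun n => if n ≤ U then f n else 0, by simp⟩
noncomputable def hi (U : ℕ) (f : ArithmeticFunction ℂ) : ArithmeticFunction ℂ := ⟨fun n => if U < n then f n else 0, by simp⟩
noncomputable def lamC : ArithmeticFunction ℂ := ⟨fun n => (vonMangoldt n : ℂ), by simp⟩
noncomputable def logC : ArithmeticFunction ℂ := ⟨fun n => (Real.log n : ℂ), by simp⟩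
noncomputable abbrev muC : ArithmeticFunction ℂ := (μ : ArithmeticFunction ℂ)
noncomputable abbrev zC : ArithmeticFunction ℂ := (ζ : ArithmeticFunction ℂ)
lemma lo_apply (U f n) : lo U f n = if n ≤ U then f n else 0 := rfl
lemma hi_apply (U f n) : hi U f n = if U < n then f n else 0 := rfl
lemma lamC_apply (n) : lamC n = (vonMangoldt n : ℂ) := rfl
lemma logC_apply (n) : logC n = (Real.log n : ℂ) := rfl
lemma lo_add_hi (U f) : lo U f + hi U f = f := by
  ext n; simp only [ArithmeticFunction.add_apply, lo_apply, hi_apply]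
  split_ifs <;> first | omega | simp
lemma lam_z : lamC * zC = logC := by
  ext n; rw [ArithmeticFunction.coe_mul_zeta_apply, logC_apply, ← ArithmeticFunction.vonMangoldt_sum]; simp [lamC_apply]
lemma vaughan (U : ℕ) : lamC = lo U lamC + lo U muC * logC - lo U lamC * lo U muC * zC +
    hi U lamC * (hi U muC * zC) := by
  have h1 : hi U lamC = lamC - lo U lamC := by rw [eq_sub_iff_add_eq, add_comm, lo_add_hi]
  have h2 : hi U muC = muC - lo U muC := by rw [eq_sub_iff_add_eq, add_comm, lo_add_hi]
  have h3 : muC * zC = 1 := ArithmeticFunction.coe_moebius_mul_coe_zeta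
  rw [h1, h2]
  linear_combination (lo U muC) * lam_z + (-lamC + lo U lamC) * h3
noncomputable def vF (U V : ℕ) : ArithmeticFunction ℂ :=
  lo U muC * hi V logC - lo U lamC * lo U muC * hi V zC + hi U lamC * (hi U muC * zC)
lemma mul_hi {f h : ArithmeticFunction ℂ} {M V n : ℕ} (hf : ∀ m, M < m → f m = 0) (hn : M * V < n) : (f * h) n = (f * hi V h) n := by
  rw [ArithmeticFunction.mul_apply, ArithmeticFunction.mul_apply]
  refine sum_congr rfl fun p hp => ?_
  have := (Nat.mem_divisorsAntidiagonal.1 hp).1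
  rcases le_or_gt p.1 M with h1 | h1
  · rw [hi_apply, if_pos]
    by_contra h2
    have := Nat.mul_le_mul h1 (not_lt.1 h2); omega
  · rw [hf _ h1]; simp
lemma lolo (U : ℕ) (f h : ArithmeticFunction ℂ) (m : ℕ) (hm : U * U < m) : (lo U f * lo U h) m = 0 := by
  rw [ArithmeticFunction.mul_apply]
  refine sum_eq_zero fun p hp => ?_
  have h3 := (Nat.mem_divisorsAntidiagonal.1 hp).1
  rw [lo_apply, lo_apply]
  split_ifs with h1 h2 <;> try simp
  have := Nat.mul_le_mul h1 h2; omega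
lemma vF_eq {U V n : ℕ} (hU : 1 ≤ U) (hV : 1 ≤ V) (hn : U * U * V < n) : vF U V n = (vonMangoldt n : ℂ) := by
  rw [← lamC_apply]
  conv_rhs => rw [vaughan U]
  have e0 : U ≤ U * U * V := by nlinarith [Nat.mul_le_mul hU hV]
  have e1 : U * V < n := lt_of_le_of_lt (by nlinarith) hn
  have h0 : lo U lamC n = 0 := by rw [lo_apply, if_neg (by omega)]
  have h1 := mul_hi (h := logC) (V := V) (n := n) (f := lo U muC) (M := U) (fun m hm => by rw [lo_apply, if_neg (by omega)]) e1
  have h2 := mul_hi (h := zC) (V := V) (n := n) (lolo U lamC muC) hn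
  simp only [vF, ArithmeticFunction.add_apply, sub_eq_add_neg, ArithmeticFunction.neg_apply, h0, h1, h2, zero_add]
lemma vM_le (n : ℕ) : vonMangoldt n ≤ n :=
  ArithmeticFunction.vonMangoldt_le_log.trans (by
    rcases Nat.eq_zero_or_pos n with rfl | hn
    · simp
    · have := log_le_sub_one_of_pos (x := n) (by exact_mod_cast hn); linarith)
lemma mu_le (n : ℕ) : ‖muC n‖ ≤ 1 := by
  simp only [ArithmeticFunction.intCoe_apply, Complex.norm_intCast]
  exact_mod_cast ArithmeticFunction.abs_moebius_le_one
lemma lo_mu_le (U n : ℕ) : ‖lo U muC n‖ ≤ n := by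
  rw [lo_apply]; split_ifs
  · rcases Nat.eq_zero_or_pos n with rfl | hn
    · simp
    · exact (mu_le n).trans (by exact_mod_cast hn)
  · simp
lemma lo_lam_mu_le (U n : ℕ) : ‖(lo U lamC * lo U muC) n‖ ≤ n := by
  rw [ArithmeticFunction.mul_apply]
  calc _ ≤ ∑ p ∈ n.divisorsAntidiagonal, vonMangoldt p.1 := by
        refine (norm_sum_le _ _).trans (sum_le_sum fun p hp => ?_)
        rw [norm_mul]
        have h1 : ‖lo U lamC p.1‖ ≤ vonMangoldt p.1 := by
          rw [lo_apply]; split_ifs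
          · simp [lamC_apply, abs_of_nonneg ArithmeticFunction.vonMangoldt_nonneg]
          · simp
        have h2 : ‖lo U muC p.2‖ ≤ 1 := by
          rw [lo_apply]; split_ifs
          · exact mu_le _
          · simp
        calc _ ≤ vonMangoldt p.1 * 1 := by gcongr
          _ = _ := mul_one _
    _ = Real.log n := by
        rw [Nat.sum_divisorsAntidiagonal (fun d _ => vonMangoldt d), ArithmeticFunction.vonMangoldt_sum]
    _ ≤ n := by
      rcases Nat.eq_zero_or_pos n with rfl | hn
      · simp
      · have := log_le_sub_one_of_pos (x := n) (by exact_mod_cast hn); linarith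
lemma c_le (U n : ℕ) : ‖(hi U muC * zC) n‖ ≤ #n.divisors := by
  rw [ArithmeticFunction.coe_mul_zeta_apply]
  refine (norm_sum_le _ _).trans ?_
  rw [card_eq_sum_ones, Nat.cast_sum]
  refine sum_le_sum fun d _ => ?_
  rw [hi_apply]; split_ifs
  · simpa using mu_le d
  · simp
lemma c_zero {U n : ℕ} (h : n ≤ U) : (hi U muC * zC) n = 0 := by
  rw [ArithmeticFunction.coe_mul_zeta_apply]
  refine sum_eq_zero fun d hd => ?_
  rw [hi_apply, if_neg]
  have := Nat.divisor_le hd; omega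
noncomputable def tws {q : ℕ} (χ : DirichletCharacter ℂ q) (f : ArithmeticFunction ℂ) (n : ℕ) : ℂ := χ n * f n
lemma tws_mul {q : ℕ} (χ : DirichletCharacter ℂ q) {f h : ArithmeticFunction ℂ} {s : ℂ} (hf : LSeriesSummable (tws χ f) s)
    (hh : LSeriesSummable (tws χ h) s) : LSeriesSummable (tws χ (f * h)) s ∧
    LSeries (tws χ (f * h)) s = LSeries (tws χ f) s * LSeries (tws χ h) s := by
  have e : tws χ (f * h) = LSeries.convolution (tws χ f) (tws χ h) := by
    have := DirichletCharacter.mul_convolution_distrib χ f h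
    rw [ArithmeticFunction.coe_mul] at this
    exact this.symm
  rw [e]
  exact ⟨hf.convolution hh, LSeries_convolution' hf hh⟩
lemma finite_L {f : ℕ → ℂ} {N : ℕ} (h0 : ∀ n, N < n → f n = 0) (h1 : ∀ n, ‖f n‖ ≤ n) {s : ℂ} (hs : 1 ≤ s.re) :
    LSeriesSummable f s ∧ ‖LSeries f s‖ ≤ N := by
  have hz : ∀ n ∉ Icc 1 N, LSeries.term f s n = 0 := fun n hn => by
    rcases Nat.eq_zero_or_pos n with rfl | h
    · simp
    · have : N < n := by by_contra h2; exact hn (mem_Icc.2 ⟨h, by omega⟩)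
      simp [LSeries.term_def, h0 n this]
  refine ⟨summable_of_ne_finset_zero hz, ?_⟩
  rw [LSeries, tsum_eq_sum hz]
  calc _ ≤ ∑ n ∈ Icc 1 N, (1:ℝ) := by
        refine (norm_sum_le _ _).trans (sum_le_sum fun n hn => ?_)
        have hn1 : 1 ≤ n := (mem_Icc.1 hn).1
        have hn1' : (1:ℝ) ≤ n := by exact_mod_cast hn1
        rw [LSeries.norm_term_eq, if_neg (by omega), div_le_one (by positivity)]
        exact (h1 n).trans (by simpa using rpow_le_rpow_of_exponent_le hn1' hs)
    _ = N := by simp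
lemma tws_norm {q : ℕ} (χ : DirichletCharacter ℂ q) (f : ArithmeticFunction ℂ) (n : ℕ) : ‖tws χ f n‖ ≤ ‖f n‖ := by
  rw [tws, norm_mul]; exact mul_le_of_le_one_left (norm_nonneg _) (DirichletCharacter.norm_le_one χ _)
lemma hi_L (r : ℕ) : ∃ K : ℝ, 1 ≤ K ∧ ∀ (q : ℕ) [NeZero q] (χ : DirichletCharacter ℂ q) (V : ℕ) (f : ArithmeticFunction ℂ),
    (∀ n ≠ 0, f n = (Real.log n : ℂ)^r) → χ ≠ 1 → 1 ≤ V → ∀ s : ℂ, 1 < s.re → s.re ≤ 2 → LSeriesSummable (tws χ (hi V f)) s ∧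
    ‖LSeries (tws χ (hi V f)) s‖ ≤ K * (1 + |s.im|) * q * (V:ℝ)^(-(1/2):ℝ) := by
  obtain ⟨K, hK, h⟩ := tail_bound r
  refine ⟨K, hK, fun q _ χ V f hf hχ hV s hs hs2 => ⟨?_, ?_⟩⟩
  · refine summable_of_le (fun n => (tws_norm χ _ n).trans ?_) (ell_summable (a := 1) (A := 1) r (by simp) hs)
    rw [hi_apply]
    split_ifs with h1
    · rw [hf n (by omega)]; simp
    · simp
  · have := h (fun n => χ n) q V hV (fun n => DirichletCharacter.norm_le_one χ _) (fun N => char_sum_bound hχ N) s hs hs2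
    refine le_trans (le_of_eq ?_) this
    congr 1
    rw [LSeries]
    congr 1; ext n
    rcases Nat.eq_zero_or_pos n with rfl | hn
    · simp [g]
    rw [LSeries.term_of_ne_zero hn.ne', g, if_neg hn.ne', tws, hi_apply, hf n hn.ne']
    split_ifs <;> simp [mul_div_assoc]
lemma U_half {L a : ℝ} (hL : 0 ≤ L) (ha : 0 ≤ a) : (1:ℕ) ≤ ⌊exp (a * L)⌋₊ ∧ ((⌊exp (a * L)⌋₊ : ℕ) : ℝ)^(-(1/2):ℝ) ≤ 2 * exp (-(a/2 * L)) := by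
  have h1 : 1 ≤ exp (a * L) := one_le_exp (by positivity)
  have h2 : (1:ℕ) ≤ ⌊exp (a * L)⌋₊ := Nat.le_floor (by simpa using h1)
  refine ⟨h2, ?_⟩
  have h3 : exp (a * L) / 4 ≤ (⌊exp (a * L)⌋₊ : ℕ) := by
    have := Nat.lt_floor_add_one (exp (a * L))
    have h2' : (1:ℝ) ≤ (⌊exp (a * L)⌋₊ : ℕ) := by exact_mod_cast h2
    linarith
  calc _ ≤ (exp (a * L) / 4)^(-(1/2):ℝ) := rpow_le_rpow_of_nonpos (by positivity) h3 (by norm_num)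
    _ = 2 * exp (-(a/2 * L)) := by
      rw [div_rpow (by positivity) (by norm_num), ← exp_mul, div_eq_mul_inv, ← rpow_neg (by norm_num), mul_comm]
      congr 1
      · rw [show (4:ℝ) = 2^(2:ℝ) by norm_num, ← rpow_mul (by norm_num)]; norm_num
      · congr 1; ring
end BD
namespace BD
open Finset Topology
open ArithmeticFunction (vonMangoldt)
abbrev DX := Σ q : ℕ, DirichletCharacter ℂ q
noncomputable def cut (U : ℕ) (σ : ℝ) (n : ℕ) : ℝ := if U < n then (n:ℝ)^(-σ) else 0
noncomputable def uu (t : ℝ) (p : DX) (n : ℕ) : ℂ := p.2 n * Complex.exp (((-t) * Real.log n : ℝ) * Complex.I)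
lemma cut_nonneg (U σ n) : 0 ≤ cut U σ n := by unfold cut; split_ifs <;> positivity
lemma cut_le (U σ n) : cut U σ n ≤ (n:ℝ)^(-σ) := by
  unfold cut; split_ifs
  · exact le_rfl
  · positivity
lemma LS_cut {f : ArithmeticFunction ℂ} {U : ℕ} (hf : ∀ n ≤ U, f n = 0) (p : DX) (σ t : ℝ) :
    LSeries (tws p.2 f) (σ + Complex.I * t) = ∑' n, (cut U σ n : ℂ) * f n * uu t p n := by
  rw [LSeries]
  congr 1; ext n
  have := term_shift (tws p.2 f) σ (-t) n
  rw [neg_neg] at this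
  rw [← this]
  rcases Nat.eq_zero_or_pos n with rfl | hn
  · simp
  rw [LSeries.term_of_ne_zero hn.ne', uu, cut, tws]
  split_ifs with h
  · rw [Complex.ofReal_cpow (by positivity), Complex.ofReal_neg, Complex.cpow_neg, Complex.ofReal_natCast]; ring
  · rw [hf n (by omega)]; simp
lemma off_diag : ∃ K : ℝ, 1 ≤ K ∧ ∀ (p p' : DX) (U : ℕ) (σ t : ℝ), p.1 ≠ 0 → p'.1 ≠ 0 → p.2.IsPrimitive → p'.2.IsPrimitive →
    p ≠ p' → 1 ≤ U → 1 < σ → σ ≤ 2 → ‖∑' n, (cut U σ n : ℂ) * (uu t p n * (starRingEnd ℂ) (uu t p' n))‖ ≤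
      K * (p.1 * p'.1) * (U:ℝ)^(-(1/2):ℝ) := by
  obtain ⟨K, hK, h⟩ := tail_bound 0
  refine ⟨K, hK, fun p p' U σ t h1 h2 hp hp' hne hU hσ hσ2 => ?_⟩
  obtain ⟨q, χ⟩ := p
  obtain ⟨q', χ'⟩ := p'
  have : NeZero q := ⟨h1⟩
  have : NeZero q' := ⟨h2⟩
  have : NeZero (q * q') := ⟨mul_ne_zero h1 h2⟩
  have hpc := pc_ne_one hp hp' hne
  have := h (fun n => pc χ χ'⁻¹ n) ((q * q' : ℕ) : ℝ) U hU (fun n => DirichletCharacter.norm_le_one _ _) (fun N => char_sum_bound hpc N)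
    (σ:ℂ) (by simpa using hσ) (by simpa using hσ2)
  simp only [Complex.ofReal_im, abs_zero, add_zero, mul_one, Nat.cast_mul] at this
  refine le_trans (le_of_eq ?_) this
  congr 2; ext n
  rcases Nat.eq_zero_or_pos n with rfl | hn
  · simp [cut, g]
  rw [g, if_neg hn.ne', cut, pc_apply, uu, uu]
  have e1 : (starRingEnd ℂ) (χ' n) = χ'⁻¹ n := MulChar.star_apply' χ' n
  have e2 : Complex.exp (((-t) * Real.log n : ℝ) * Complex.I) * (starRingEnd ℂ) (Complex.exp (((-t) * Real.log n : ℝ) * Complex.I)) = 1 := by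
    rw [Complex.mul_conj, Complex.normSq_eq_norm_sq, Complex.norm_exp_ofReal_mul_I]; simp
  rw [map_mul, e1]
  split_ifs with h
  · rw [Complex.ofReal_cpow (by positivity), Complex.ofReal_neg, Complex.cpow_neg, Complex.ofReal_natCast, pow_zero, one_div]
    linear_combination ((n:ℂ)^(σ:ℂ))⁻¹ * χ n * χ'⁻¹ n * e2
  · simp
set_option maxHeartbeats 1000000 in
theorem mean_value : ∃ C L0 : ℝ, 0 ≤ C ∧ ∀ L, L0 ≤ L → ∀ s : Finset DX, (∀ p ∈ s, p.1 ≠ 0 ∧ (p.1:ℝ) ≤ exp (L/100) ∧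
    p.2.IsPrimitive ∧ p.2 ≠ 1) → (#s : ℝ) ≤ exp (L/50) → ∑ p ∈ s, ‖tw (psi 0) L (vL p.2 0)‖ ≤ C * L^5 := by
  obtain ⟨T, hT, hT'⟩ := tw_family (psi 0) 1
  obtain ⟨K1, hK1, h1⟩ := hi_L 1
  obtain ⟨K0, hK0, h0⟩ := hi_L 0
  obtain ⟨K2, hK2, h2⟩ := off_diag
  obtain ⟨C1, hC1, hm1⟩ := mom1
  obtain ⟨C2, hC2, hm2⟩ := mom2
  obtain ⟨K3, hK3, h3⟩ := one_real_bound
  refine ⟨T * (2 * K1 + 2 * K0 + (K3 + 2 * K2) * (C1 + C2)), 20, by positivity, fun L hL s hs hcard => ?_⟩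
  have hL1 : 1 ≤ L := by linarith
  have hLp : 0 < L := by linarith
  have hLi : 0 < 1/L := by positivity
  have hLi1 : 1/L ≤ 1 := by rw [div_le_one hLp]; exact hL1
  obtain ⟨hU, hU2⟩ := U_half hLp.le (a := 1/10) (by norm_num)
  obtain ⟨hV, hV2⟩ := U_half hLp.le (a := 1/2) (by norm_num)
  set U := ⌊exp (1/10 * L)⌋₊
  set V := ⌊exp (1/2 * L)⌋₊
  have hUe : (U:ℝ) ≤ exp (1/10 * L) := Nat.floor_le (by positivity)
  have hVe : (V:ℝ) ≤ exp (1/2 * L) := Nat.floor_le (by positivity)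
  have hUVe : (U:ℝ) * U * V ≤ exp (7/10 * L) := by
    calc (U:ℝ) * U * V ≤ exp (1/10 * L) * exp (1/10 * L) * exp (1/2 * L) := by gcongr
      _ = _ := by rw [← exp_add, ← exp_add]; congr 1; ring
  set σ : ℝ := 1 + 1/L with hσ
  have hσ1 : 1 < σ := by linarith
  have hσ2 : σ ≤ 2 := by linarith
  have hs1 : 1 < (σ:ℂ).re := by simpa using hσ1
  -- the terms
  have hmain : ∀ t : ℝ, ∀ p ∈ s, LSeriesSummable (tws p.2 (vF U V)) (σ + Complex.I * t) ∧
      ‖LSeries (tws p.2 (vF U V)) (σ + Complex.I * t)‖ ≤ (2 * K1 + 2 * K0) * (1 + |t|) * exp (-(1/50 * L)) +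
      (‖∑' n, (cut U σ n : ℂ) * hi U lamC n * uu t p n‖^2 + ‖∑' n, (cut U σ n : ℂ) * (hi U muC * zC) n * uu t p n‖^2) := by
    intro t p hp
    obtain ⟨hp0, hpQ, hpp, hp1⟩ := hs p hp
    have : NeZero p.1 := ⟨hp0⟩
    have hre : 1 < ((σ:ℂ) + Complex.I * t).re := by simpa using hσ1
    have hre2 : ((σ:ℂ) + Complex.I * t).re ≤ 2 := by simpa using hσ2
    have him : ((σ:ℂ) + Complex.I * t).im = t := by simp
    obtain ⟨a1, a2⟩ := h1 p.1 p.2 V logC (fun n _ => by simp [logC_apply]) hp1 hV _ hre hre2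
    obtain ⟨b1, b2⟩ := h0 p.1 p.2 V zC (fun n hn => by simp [hn]) hp1 hV _ hre hre2
    rw [him] at a2 b2
    obtain ⟨c1, c2⟩ := finite_L (f := tws p.2 (lo U muC)) (N := U) (fun n hn => by rw [tws, lo_apply, if_neg (by omega), mul_zero])
      (fun n => (tws_norm _ _ n).trans (lo_mu_le U n)) hre.le
    obtain ⟨d1, d2⟩ := finite_L (f := tws p.2 (lo U lamC * lo U muC)) (N := U * U) (fun n hn => by rw [tws, lolo U _ _ n hn, mul_zero])
      (fun n => (tws_norm _ _ n).trans (lo_lam_mu_le U n)) hre.le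
    have e1 : LSeriesSummable (tws p.2 (hi U lamC)) (σ + Complex.I * t) := by
      refine summable_of_le (fun n => (tws_norm _ _ n).trans ?_) (ell_summable (a := 1) (A := 1) 1 (by simp) hre)
      rw [hi_apply]; split_ifs
      · simp only [lamC_apply, Pi.one_apply, one_mul, pow_one, Complex.norm_real]
        rw [norm_of_nonneg ArithmeticFunction.vonMangoldt_nonneg, norm_of_nonneg (log_natCast_nonneg n)]
        exact ArithmeticFunction.vonMangoldt_le_log
      · simp
    have e0 : ∀ f : ArithmeticFunction ℂ, (∀ n, ‖f n‖ ≤ 1) → LSeriesSummable (tws p.2 f) (σ + Complex.I * t) := fun f hf => by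
      refine summable_of_le (fun n => (tws_norm _ _ n).trans ?_) (ell_summable (a := 1) (A := 1) 0 (by simp) hre)
      simpa using hf n
    have e2 := tws_mul p.2 (e0 (hi U muC) fun n => by
        rw [hi_apply]; split_ifs
        · exact mu_le n
        · simp) (e0 zC fun n => by
        rw [ArithmeticFunction.natCoe_apply, ArithmeticFunction.zeta_apply]; split_ifs <;> simp)
    obtain ⟨f1, f2⟩ := tws_mul p.2 c1 a1
    obtain ⟨g1, g2⟩ := tws_mul p.2 d1 b1
    obtain ⟨k1, k2⟩ := tws_mul p.2 e1 e2.1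
    have eF : tws p.2 (vF U V) = tws p.2 (lo U muC * hi V logC) - tws p.2 (lo U lamC * lo U muC * hi V zC) + tws p.2 (hi U lamC * (hi U muC * zC)) := by
      ext n
      simp only [tws, vF, Pi.add_apply, Pi.sub_apply, ArithmeticFunction.add_apply, sub_eq_add_neg, ArithmeticFunction.neg_apply,
        Pi.neg_apply]; ring
    rw [eF]
    refine ⟨(f1.sub g1).add k1, ?_⟩
    rw [LSeries_add (f1.sub g1) k1, LSeries_sub f1 g1, f2, g2, k2, LS_cut (f := hi U lamC) (U := U) (fun n hn => by rw [hi_apply, if_neg (by omega)]),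
      LS_cut (f := hi U muC * zC) (U := U) (fun n hn => c_zero hn)]
    have ht := abs_nonneg t
    have hU1 : (1:ℝ) ≤ U := by exact_mod_cast hU
    have hUU : (U:ℝ) * U * exp (L/100) * (2 * exp (-(1/2/2*L))) ≤ 2 * exp (-(1/50 * L)) := by
      calc _ ≤ exp (1/10 * L) * exp (1/10 * L) * exp (L/100) * (2 * exp (-(1/2/2*L))) := by gcongr
        _ = 2 * exp (-(1/25 * L)) := by
          rw [← exp_add, ← exp_add, mul_left_comm, ← exp_add]; congr 2; ring
        _ ≤ _ := by gcongr; linarith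
    have key : ∀ (K : ℝ) (x y : ℂ), 1 ≤ K → ‖x‖ ≤ (U * U : ℝ) → ‖y‖ ≤ K * (1 + |t|) * p.1 * (V:ℝ)^(-(1/2):ℝ) → ‖x * y‖ ≤
        2 * K * (1 + |t|) * exp (-(1/50 * L)) := by
      intro K x y hK hx hy
      rw [norm_mul]
      calc _ ≤ (U * U : ℝ) * (K * (1 + |t|) * exp (L/100) * (2 * exp (-(1/2/2*L)))) := by
            refine mul_le_mul hx (hy.trans ?_) (norm_nonneg _) (by positivity)
            gcongr
        _ = K * (1 + |t|) * ((U:ℝ) * U * exp (L/100) * (2 * exp (-(1/2/2*L)))) := by ring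
        _ ≤ K * (1 + |t|) * (2 * exp (-(1/50 * L))) := by gcongr
        _ = _ := by ring
    have t1 := key K1 _ _ hK1 (c2.trans (by nlinarith)) a2
    have t2 := key K0 _ _ hK0 (d2.trans (by push_cast; exact le_rfl)) b2
    refine (norm_add_le _ _).trans (add_le_add ((norm_sub_le _ _).trans (by linarith)) ?_)
    rw [norm_mul]
    nlinarith [sq_nonneg (‖∑' n, (cut U σ n : ℂ) * hi U lamC n * uu t p n‖ - ‖∑' n, (cut U σ n : ℂ) * (hi U muC * zC) n * uu t p n‖),
      sq_nonneg (‖∑' n, (cut U σ n : ℂ) * hi U lamC n * uu t p n‖), sq_nonneg (‖∑' n, (cut U σ n : ℂ) * (hi U muC * zC) n * uu t p n‖)]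
  -- large sieve
  have hcs : Summable (cut U σ) := (nsum hσ1).of_nonneg_of_le (cut_nonneg U σ) (cut_le U σ)
  have hls : ∀ t : ℝ, ∀ (a : ℕ → ℂ) (b : ℕ → ℝ) (M : ℝ), (∀ n, ‖a n‖ ≤ b n) → (Summable fun n : ℕ => (n:ℝ)^(-σ) * (b n)^2) →
      ∑' n : ℕ, (n:ℝ)^(-σ) * (b n)^2 ≤ M → ∑ p ∈ s, ‖∑' n, (cut U σ n : ℂ) * a n * uu t p n‖^2 ≤ (K3 * L + 2 * K2) * M := by
    intro t a b M hab hb hM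
    have hle : ∀ n, cut U σ n * ‖a n‖^2 ≤ (n:ℝ)^(-σ) * (b n)^2 := fun n => by
      have := cut_nonneg U σ n
      gcongr
      · exact cut_le U σ n
      · exact hab n
    have hsm : Summable fun n => cut U σ n * ‖a n‖^2 := hb.of_nonneg_of_le (fun n => mul_nonneg (cut_nonneg _ _ _) (by positivity)) hle
    have h4 := large_sieve s (uu t) (cut U σ) (cut_nonneg U σ) hcs (fun p n => by
        rw [uu, norm_mul, Complex.norm_exp_ofReal_mul_I, mul_one]; exact DirichletCharacter.norm_le_one _ _)
      (D0 := K3 * L) (D := K2 * (exp (L/100) * exp (L/100)) * (2 * exp (-(1/10/2*L)))) (by positivity) (by positivity) (by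
        refine (hcs.tsum_le_tsum (cut_le U σ) (nsum hσ1)).trans ((h3 1 (1/L) hLi hLi1).2.trans (le_of_eq (by field_simp)))) (by
        intro p hp p' hp' hne
        obtain ⟨x1, x2, x3, x4⟩ := hs p hp
        obtain ⟨y1, y2, y3, y4⟩ := hs p' hp'
        refine (h2 p p' U σ t x1 y1 x3 y3 hne hU hσ1 hσ2).trans ?_
        gcongr) a hsm
    refine h4.trans (mul_le_mul ?_ ((hsm.tsum_le_tsum hle hb).trans hM) (tsum_nonneg fun n => mul_nonneg (cut_nonneg _ _ _) (by positivity)) (by positivity))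
    refine add_le_add le_rfl ?_
    calc (#s : ℝ) * (K2 * (exp (L/100) * exp (L/100)) * (2 * exp (-(1/10/2*L)))) ≤ exp (L/50) * (K2 * (exp (L/100) * exp (L/100)) * (2 * exp (-(1/10/2*L)))) := by
          gcongr
      _ = 2 * K2 * (exp (L/50) * (exp (L/100) * exp (L/100)) * exp (-(1/10/2*L))) := by ring
      _ = 2 * K2 * exp (-(1/100 * L)) := by rw [← exp_add, ← exp_add, ← exp_add]; congr 2; ring
      _ ≤ 2 * K2 * 1 := by gcongr; exact exp_le_one_iff.2 (by linarith)
      _ = _ := mul_one _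
  have htw : ∀ p ∈ s, tw (psi 0) L (vL p.2 0) = tw (psi 0) L (tws p.2 (vF U V)) := fun p hp => by
    unfold tw
    congr 1; ext n
    rcases Nat.eq_zero_or_pos n with rfl | hn
    · simp
    by_cases hz : bmp (Real.log n - L) = 0
    · rw [psi_apply, hz]; simp
    · have hball : Real.log n - L ∈ Function.support bmp := hz
      rw [bmp.support_eq, Metric.mem_ball, dist_zero_right, norm_eq_abs] at hball
      have hlog : L - 4 < Real.log n := by
        have := (abs_lt.1 hball).1
        have : bmp.rOut = 4 := rfl
        linarith
      have hn' : exp (7/10 * L) < n := by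
        rw [← exp_log (by exact_mod_cast hn : (0:ℝ) < n)]
        exact exp_lt_exp.2 (by linarith)
      have hlt : U * U * V < n := by exact_mod_cast lt_of_le_of_lt hUVe hn'
      rw [LSeries.term_of_ne_zero hn.ne', LSeries.term_of_ne_zero hn.ne', tws, vF_eq hU hV hlt, vL, pow_zero, mul_one]
  rw [sum_congr rfl fun p hp => by rw [htw p hp]]
  have := hT' s (fun p => tws p.2 (vF U V)) L ((2 * K1 + 2 * K0 + (K3 + 2 * K2) * (C1 + C2)) * L^5) (fun p hp => by
    have := (hmain 0 p hp).1
    rwa [Complex.ofReal_zero, mul_zero, add_zero] at this) fun t => by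
      refine (sum_le_sum fun p hp => (hmain t p hp).2).trans ?_
      rw [sum_add_distrib, sum_add_distrib, sum_const, nsmul_eq_mul]
      have q1 := hls t (hi U lamC) (fun n => vonMangoldt n) _ (fun n => by
        rw [hi_apply]; split_ifs
        · rw [lamC_apply, Complex.norm_real, norm_of_nonneg ArithmeticFunction.vonMangoldt_nonneg]
        · simpa using ArithmeticFunction.vonMangoldt_nonneg) (hm1 L hL1).1 (hm1 L hL1).2
      have q2 := hls t (fun n => (hi U muC * zC) n) (fun n => #n.divisors) _ (fun n => c_le U n) (hm2 L hL1).1 (hm2 L hL1).2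
      have ht := abs_nonneg t
      have hL4 : 1 ≤ L^4 := one_le_pow₀ hL1
      have q3 : (#s : ℝ) * ((2 * K1 + 2 * K0) * (1 + |t|) * exp (-(1/50 * L))) ≤ (2 * K1 + 2 * K0) * (1 + |t|) * L^5 := by
        calc _ ≤ exp (L/50) * ((2 * K1 + 2 * K0) * (1 + |t|) * exp (-(1/50 * L))) := by gcongr
          _ = (2 * K1 + 2 * K0) * (1 + |t|) * (exp (L/50) * exp (-(1/50 * L))) := by ring
          _ = (2 * K1 + 2 * K0) * (1 + |t|) * 1 := by rw [← exp_add]; congr 1; rw [exp_eq_one_iff]; ring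
          _ ≤ _ := by gcongr; exact one_le_pow₀ hL1
      have q4 : (K3 * L + 2 * K2) * (C1 * L^3) + (K3 * L + 2 * K2) * (C2 * L^4) ≤ (K3 + 2 * K2) * (C1 + C2) * L^5 := by
        have : K3 * L + 2 * K2 ≤ (K3 + 2 * K2) * L := by nlinarith
        calc _ = (K3 * L + 2 * K2) * (C1 * L^3 + C2 * L^4) := by ring
          _ ≤ ((K3 + 2 * K2) * L) * (C1 * L^4 + C2 * L^4) := by gcongr <;> norm_num
          _ = _ := by ring
      have q5 : (K3 + 2 * K2) * (C1 + C2) * L^5 ≤ (K3 + 2 * K2) * (C1 + C2) * L^5 * (1 + |t|) :=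
        le_mul_of_one_le_right (by positivity) (by linarith)
      rw [pow_one]
      calc _ ≤ (2 * K1 + 2 * K0) * (1 + |t|) * L^5 + (K3 + 2 * K2) * (C1 + C2) * L^5 * (1 + |t|) := by linarith
        _ = _ := by ring
  linarith
end BD
namespace BD
open Finset Topology
noncomputable def pw (P : Finset ℕ) (z : ℝ) : Finset (Finset ℕ) := P.powerset.filter fun S => ((∏ p ∈ S, p : ℕ) : ℝ) ≤ z
noncomputable def PP (a b : ℕ) : Finset ℕ := (Finset.Ioc a b).filter Nat.Prime
noncomputable def om (S : Finset ℕ) : ℝ := ∏ p ∈ S, (1 / ((p:ℝ) - 1))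
noncomputable def VV (P : Finset ℕ) (z : ℝ) : ℝ := ∑ S ∈ pw P z, om S
def Prm (P : Finset ℕ) : Prop := ∀ p ∈ P, Nat.Prime p
lemma PP_prm (a b) : Prm (PP a b) := fun p hp => (mem_filter.1 hp).2
lemma Prm.mono {P Q : Finset ℕ} (h : Prm P) (hQ : Q ⊆ P) : Prm Q := fun p hp => h p (hQ hp)
lemma prod_pos' {S : Finset ℕ} (h : Prm S) : 0 < ∏ p ∈ S, p := Finset.prod_pos fun p hp => (h p hp).pos
lemma p_sub {p : ℕ} (hp : p.Prime) : (1:ℝ) ≤ (p:ℝ) - 1 := by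
  have : (2:ℝ) ≤ p := by exact_mod_cast hp.two_le
  linarith
lemma om_pos {S : Finset ℕ} (h : Prm S) : 0 < om S := Finset.prod_pos fun p hp => by
  have := p_sub (h p hp); positivity
lemma prod_mono {S T : Finset ℕ} (h : Prm S) (hT : T ⊆ S) : ∏ p ∈ T, p ≤ ∏ p ∈ S, p :=
  Finset.prod_le_prod_of_subset_of_one_le' hT fun p hp _ => (h p hp).one_le
lemma mem_pw {P : Finset ℕ} {z : ℝ} {S : Finset ℕ} : S ∈ pw P z ↔ S ⊆ P ∧ ((∏ p ∈ S, p : ℕ) : ℝ) ≤ z := by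
  rw [pw, mem_filter, mem_powerset]
lemma pw_sub {P : Finset ℕ} (hP : Prm P) {z : ℝ} {S T : Finset ℕ} (hS : S ∈ pw P z) (hT : T ⊆ S) : T ∈ pw P z := by
  rw [mem_pw] at *
  refine ⟨hT.trans hS.1, le_trans ?_ hS.2⟩
  exact_mod_cast prod_mono (hP.mono hS.1) hT
lemma sum_le_inj {ι κ : Type*} {s : Finset ι} {t : Finset κ} {f : ι → ℝ} {g : κ → ℝ} (e : ι → κ)
    (h1 : ∀ i ∈ s, e i ∈ t) (h2 : ∀ i ∈ s, ∀ j ∈ s, e i = e j → i = j) (h3 : ∀ i ∈ s, f i ≤ g (e i)) (h4 : ∀ k ∈ t, 0 ≤ g k) :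
    ∑ i ∈ s, f i ≤ ∑ k ∈ t, g k := by
  classical
  calc _ ≤ ∑ i ∈ s, g (e i) := sum_le_sum h3
    _ = ∑ k ∈ s.image e, g k := (sum_image fun i hi j hj h => h2 i hi j hj h).symm
    _ ≤ _ := sum_le_sum_of_subset_of_nonneg (image_subset_iff.2 h1) fun k hk _ => h4 k hk
lemma split_le {P : Finset ℕ} (hP : Prm P) (z : ℝ) (f g : Finset ℕ → ℝ) (hf : ∀ S ⊆ P, 0 ≤ f S) (hg : ∀ S ⊆ P, 0 ≤ g S) :
    ∑ S ∈ pw P z, ∑ T ∈ S.powerset, f T * g (S \ T) ≤ (∑ T ∈ pw P z, f T) * ∑ U ∈ pw P z, g U := by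
  rw [sum_mul_sum, ← sum_product', sum_sigma']
  refine sum_le_inj (fun x => (x.2, x.1 \ x.2)) ?_ ?_ (fun x _ => le_rfl) ?_
  · rintro ⟨S, T⟩ h
    obtain ⟨h1, h2⟩ := mem_sigma.1 h
    exact mem_product.2 ⟨pw_sub hP h1 (mem_powerset.1 h2), pw_sub hP h1 sdiff_subset⟩
  · rintro ⟨S, T⟩ h ⟨S', T'⟩ h' e
    have h2 := mem_powerset.1 (mem_sigma.1 h).2
    have h2' := mem_powerset.1 (mem_sigma.1 h').2
    obtain ⟨e1, e2⟩ := Prod.ext_iff.1 e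
    simp only at e1 e2 h2 h2'
    subst e1
    have : S = S' := by
      rw [← sdiff_union_of_subset h2, ← sdiff_union_of_subset h2', e2]
    subst this; rfl
  · rintro ⟨T, U⟩ h
    obtain ⟨h1, h2⟩ := mem_product.1 h
    exact mul_nonneg (hf _ (mem_pw.1 h1).1) (hg _ (mem_pw.1 h2).1)
lemma prod_inj {S T : Finset ℕ} (hS : Prm S) (hT : Prm T) (h : ∏ p ∈ S, p = ∏ p ∈ T, p) : S = T := by
  rw [← Nat.primeFactors_prod hS, h, Nat.primeFactors_prod hT]
lemma inv_sum_le {P : Finset ℕ} (hP : Prm P) {z : ℝ} (hz : 1 ≤ z) : ∑ S ∈ pw P z, ∏ p ∈ S, (1/(p:ℝ)) ≤ 1 + Real.log z := by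
  have h1 : ∑ S ∈ pw P z, ∏ p ∈ S, (1/(p:ℝ)) ≤ ∑ n ∈ Finset.Icc 1 ⌊z⌋₊, ((n:ℝ))⁻¹ := by
    refine sum_le_inj (fun S => ∏ p ∈ S, p) ?_ ?_ ?_ (fun _ _ => by positivity)
    · intro S hS
      rw [mem_pw] at hS
      exact Finset.mem_Icc.2 ⟨prod_pos' (hP.mono hS.1), Nat.le_floor hS.2⟩
    · intro S hS T hT h
      exact prod_inj (hP.mono (mem_pw.1 hS).1) (hP.mono (mem_pw.1 hT).1) h
    · intro S hS
      rw [Nat.cast_prod, ← Finset.prod_inv_distrib]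
      simp
  refine h1.trans ?_
  have := harmonic_floor_le_one_add_log z hz
  rw [harmonic_eq_sum_Icc] at this
  push_cast at this
  exact this
lemma tele (N : ℕ) : ∑ n ∈ Finset.Ioc 1 (N+1), 1/((n:ℝ) * ((n:ℝ)-1)) ≤ 1 - 1/((N:ℝ)+1) := by
  induction N with
  | zero => simp
  | succ N ih =>
    rw [Finset.sum_Ioc_succ_top (by omega)]
    push_cast
    have h : (1:ℝ) / (((N:ℝ)+1+1) * ((N:ℝ)+1+1-1)) = 1/((N:ℝ)+1) - 1/((N:ℝ)+1+1) := by
      have : (N:ℝ)+1 ≠ 0 := by positivity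
      have : (N:ℝ)+1+1 ≠ 0 := by positivity
      rw [add_sub_cancel_right]; field_simp; ring
    rw [h]; linarith
lemma tele' {P : Finset ℕ} (hP : Prm P) : ∑ p ∈ P, 1/((p:ℝ) * ((p:ℝ)-1)) ≤ 1 := by
  obtain ⟨N, hN⟩ : ∃ N, P ⊆ Finset.Ioc 1 (N+1) := ⟨P.sup id, fun p hp => Finset.mem_Ioc.2 ⟨(hP p hp).one_lt, (Finset.le_sup (f := id) hp).trans (by simp)⟩⟩
  calc _ ≤ ∑ n ∈ Finset.Ioc 1 (N+1), 1/((n:ℝ) * ((n:ℝ)-1)) := by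
        refine sum_le_sum_of_subset_of_nonneg hN fun n hn _ => ?_
        have : (1:ℝ) ≤ n := by exact_mod_cast (Finset.mem_Ioc.1 hn).1.le
        have : 0 ≤ (n:ℝ) - 1 := by linarith
        positivity
    _ ≤ 1 - 1/((N:ℝ)+1) := tele N
    _ ≤ 1 := by have : 0 ≤ 1/((N:ℝ)+1) := by positivity
                linarith
lemma prod_one_add_le {ι : Type*} (s : Finset ι) (f : ι → ℝ) (hf : ∀ i ∈ s, 0 ≤ f i) : ∏ i ∈ s, (1 + f i) ≤ exp (∑ i ∈ s, f i) := by
  rw [exp_sum]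
  exact Finset.prod_le_prod (fun i hi => by have := hf i hi; linarith) fun i _ => by rw [add_comm]; exact add_one_le_exp _
lemma VV_le {P : Finset ℕ} (hP : Prm P) {z : ℝ} (hz : 1 ≤ z) : VV P z ≤ exp 1 * (1 + Real.log z) := by
  have h1 : ∀ S ∈ pw P z, om S = ∑ T ∈ S.powerset, (∏ p ∈ T, (1/((p:ℝ) * ((p:ℝ)-1)))) * ∏ p ∈ S \ T, (1/(p:ℝ)) := by
    intro S hS
    rw [om, ← Finset.prod_add]
    refine Finset.prod_congr rfl fun p hp => ?_
    have h2 := p_sub (hP p ((mem_pw.1 hS).1 hp))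
    have h3 : (p:ℝ) ≠ 0 := by linarith
    have h4 : (p:ℝ) - 1 ≠ 0 := by linarith
    field_simp; ring
  have hp : ∀ S ⊆ P, 0 ≤ ∏ p ∈ S, (1/((p:ℝ) * ((p:ℝ)-1))) := fun S hS => Finset.prod_nonneg fun p hp => by
    have h2 := p_sub (hP p (hS hp))
    have h4 : 0 ≤ (p:ℝ) - 1 := by linarith
    positivity
  rw [VV, sum_congr rfl h1]
  refine (split_le hP z _ (fun U => ∏ p ∈ U, (1/(p:ℝ))) hp (fun S _ => by positivity)).trans ?_
  refine mul_le_mul ?_ (inv_sum_le hP hz) (sum_nonneg fun S _ => by positivity) (by positivity)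
  calc _ ≤ ∑ T ∈ P.powerset, ∏ p ∈ T, (1/((p:ℝ) * ((p:ℝ)-1))) :=
        sum_le_sum_of_subset_of_nonneg (filter_subset _ _) fun T hT _ => hp T (mem_powerset.1 hT)
    _ = ∏ p ∈ P, (1 + 1/((p:ℝ) * ((p:ℝ)-1))) := by rw [Finset.prod_one_add]
    _ ≤ exp (∑ p ∈ P, 1/((p:ℝ) * ((p:ℝ)-1))) := prod_one_add_le _ _ fun p hp => by
        have h2 := p_sub (hP p hp)
        have h4 : 0 ≤ (p:ℝ) - 1 := by linarith
        positivity
    _ ≤ exp 1 := exp_le_exp.2 (tele' hP)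
lemma VM_le {P : Finset ℕ} (hP : Prm P) {z : ℝ} (hz : 1 ≤ z) (M : ℕ) : ∑ S ∈ pw P z, (M:ℝ)^(#S) * om S ≤ (exp 1 * (1 + Real.log z))^M := by
  have hom : ∀ S ⊆ P, 0 ≤ om S := fun S hS => (om_pos (hP.mono hS)).le
  induction M with
  | zero =>
    rw [pow_zero]
    calc _ ≤ ∑ S ∈ pw P z, if S = ∅ then (1:ℝ) else 0 := sum_le_sum fun S _ => by
          split_ifs with h
          · subst h; simp [om]
          · simp [h]
      _ ≤ 1 := by rw [sum_ite_eq']; split_ifs <;> norm_num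
  | succ M ih =>
    have h1 : ∀ S ∈ pw P z, ((M+1:ℕ):ℝ)^(#S) * om S = ∑ T ∈ S.powerset, ((M:ℝ)^(#T) * om T) * om (S \ T) := by
      intro S hS
      calc _ = (∏ p ∈ S, ((M:ℝ) + 1)) * om S := by simp
        _ = ∑ T ∈ S.powerset, (M:ℝ)^(#T) * om S := by
          rw [Finset.prod_add, sum_mul]; simp
        _ = _ := sum_congr rfl fun T hT => by
          rw [mul_assoc]; congr 1
          rw [om, om, om, mul_comm, Finset.prod_sdiff (mem_powerset.1 hT)]
    rw [sum_congr rfl h1, pow_succ]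
    refine (split_le hP z _ om (fun S hS => mul_nonneg (by positivity) (hom S hS)) hom).trans ?_
    exact mul_le_mul ih (VV_le hP hz) (sum_nonneg fun S hS => hom S (mem_pw.1 hS).1) (by have := log_nonneg hz; positivity)
lemma VV_ge {R : ℕ} {z : ℝ} (hz : 1 ≤ z) (hR : z ≤ R) : 1/2 * Real.log z ≤ VV (PP 0 R) z := by
  have h0 : Real.log z ≤ ∑ n ∈ Finset.Icc 1 ⌊z⌋₊, ((n:ℝ))⁻¹ := by
    have := log_le_harmonic_floor z (by linarith)
    rw [harmonic_eq_sum_Icc] at this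
    push_cast at this
    exact this
  have h1 : ∑ n ∈ Finset.Icc 1 ⌊z⌋₊, ((n:ℝ))⁻¹ ≤ ∑ x ∈ (Finset.Icc 1 ⌊z⌋₊) ×ˢ pw (PP 0 R) z, 1/(x.1:ℝ)^2 * om x.2 := by
    choose a b hab hb using fun n : ℕ => Nat.sq_mul_squarefree n
    have key : ∀ n ∈ Finset.Icc 1 ⌊z⌋₊, a n ≠ 0 ∧ b n ≠ 0 ∧ a n ≤ n ∧ b n ≤ n ∧ (∏ p ∈ (a n).primeFactors, p) = a n := by
      intro n hn
      have hn1 := (Finset.mem_Icc.1 hn).1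
      have ha : a n ≠ 0 := fun h => by have := hab n; rw [h] at this; simp at this; omega
      have hb0 : b n ≠ 0 := fun h => by have := hab n; rw [h] at this; simp at this; omega
      refine ⟨ha, hb0, ?_, ?_, Nat.prod_primeFactors_of_squarefree (hb n)⟩
      · exact Nat.le_of_dvd hn1 ⟨_, (by rw [mul_comm]; exact (hab n).symm)⟩
      · exact Nat.le_of_dvd hn1 ⟨b n * a n, by rw [← mul_assoc, ← pow_two]; exact (hab n).symm⟩
    refine sum_le_inj (fun n => (b n, (a n).primeFactors)) ?_ ?_ ?_ ?_
    · intro n hn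
      obtain ⟨k1, k2, k3, k4, k5⟩ := key n hn
      have hnz := (Finset.mem_Icc.1 hn).2
      have hnz' : (n:ℝ) ≤ z := (Nat.le_floor_iff (by linarith)).1 hnz
      refine mem_product.2 ⟨Finset.mem_Icc.2 ⟨by omega, by simp only; omega⟩, mem_pw.2 ⟨fun p hp => ?_, ?_⟩⟩
      · have := Nat.prime_of_mem_primeFactors hp
        refine mem_filter.2 ⟨Finset.mem_Ioc.2 ⟨this.pos, ?_⟩, this⟩
        have h1 : p ≤ n := (Nat.le_of_mem_primeFactors hp).trans k3
        have h2 : (p:ℝ) ≤ R := le_trans (by exact_mod_cast h1) (hnz'.trans hR)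
        exact_mod_cast h2
      · simp only; rw [k5]; exact le_trans (by exact_mod_cast k3) hnz'
    · intro n hn n' hn' h
      obtain ⟨k1, k2, k3, k4, k5⟩ := key n hn
      obtain ⟨k1', k2', k3', k4', k5'⟩ := key n' hn'
      obtain ⟨e1, e2⟩ := Prod.ext_iff.1 h
      simp only at e1 e2
      rw [← hab n, ← hab n', ← k5, ← k5', e1, e2]
    · intro n hn
      obtain ⟨k1, k2, k3, k4, k5⟩ := key n hn
      have : (1:ℝ)/(a n) ≤ om (a n).primeFactors := by
        rw [← k5, Nat.cast_prod, one_div, ← Finset.prod_inv_distrib, om, Nat.primeFactors_prod fun p hp => Nat.prime_of_mem_primeFactors hp]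
        refine Finset.prod_le_prod (fun _ _ => by positivity) fun p hp => ?_
        have h2 := p_sub (Nat.prime_of_mem_primeFactors hp)
        rw [one_div]
        exact inv_anti₀ (by linarith) (by linarith)
      calc ((n:ℝ))⁻¹ = 1/(b n:ℝ)^2 * (1/(a n)) := by
            have := hab n
            rw [div_mul_div_comm, one_mul, one_div]; congr 1; exact_mod_cast this.symm
        _ ≤ _ := by simp only; gcongr
    · rintro ⟨m, S⟩ h
      exact mul_nonneg (by positivity) (om_pos ((PP_prm 0 R).mono (mem_pw.1 (mem_product.1 h).2).1)).le
  have h2 : ∀ N : ℕ, ∑ n ∈ Finset.Icc 1 (N+1), 1/(n:ℝ)^2 ≤ 2 - 1/((N:ℝ)+1) := fun N => by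
    induction N with
    | zero => norm_num
    | succ N ih =>
      rw [Finset.sum_Icc_succ_top (by omega)]
      push_cast
      have h : (1:ℝ) / ((N:ℝ)+1+1)^2 ≤ 1/((N:ℝ)+1) - 1/((N:ℝ)+1+1) := by
        rw [div_sub_div _ _ (by positivity) (by positivity), div_le_div_iff₀ (by positivity) (by positivity)]
        nlinarith [(Nat.cast_nonneg N : (0:ℝ) ≤ N)]
      linarith
  have hz' : 1 ≤ ⌊z⌋₊ := Nat.le_floor (by simpa using hz)
  obtain ⟨N, hN⟩ : ∃ N, ⌊z⌋₊ = N + 1 := ⟨⌊z⌋₊ - 1, by omega⟩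
  rw [sum_product] at h1
  simp only at h1
  rw [← sum_mul_sum] at h1
  have h3 := h2 N
  rw [← hN] at h3
  have h4 : 0 ≤ 1/((N:ℝ)+1) := by positivity
  have h5 : 0 ≤ VV (PP 0 R) z := sum_nonneg fun S hS => (om_pos ((PP_prm 0 R).mono (mem_pw.1 hS).1)).le
  have h6 : (∑ n ∈ Finset.Icc 1 ⌊z⌋₊, 1/(n:ℝ)^2) * VV (PP 0 R) z ≤ 2 * VV (PP 0 R) z := by gcongr; linarith
  have h7 : Real.log z ≤ 2 * VV (PP 0 R) z := h0.trans (h1.trans h6)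
  linarith
noncomputable def kap (D : ℕ) : ℝ := ∏ p ∈ PP 0 D, (1 - 1/(p:ℝ))
lemma kap_pos (D) : 0 < kap D := Finset.prod_pos fun p hp => by
  have := p_sub (PP_prm 0 D p hp)
  rw [sub_pos, div_lt_one (by linarith)]; linarith
lemma kap_inv (D) : ∑ T ∈ (PP 0 D).powerset, om T = (kap D)⁻¹ := by
  have := Finset.prod_one_add (f := fun p : ℕ => 1/((p:ℝ)-1)) (PP 0 D)
  rw [kap, ← Finset.prod_inv_distrib, ← Finset.prod_congr rfl (fun p hp => ?_), this]
  · rfl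
  · have := p_sub (PP_prm 0 D p hp)
    have h3 : (p:ℝ) ≠ 0 := by linarith
    have h4 : (p:ℝ) - 1 ≠ 0 := by linarith
    field_simp; ring
lemma PP_disj (D R) : Disjoint (PP 0 D) (PP D R) := by
  rw [Finset.disjoint_left]; intro p h1 h2
  simp only [PP, mem_filter, Finset.mem_Ioc] at h1 h2; omega
lemma VV_up {D R : ℕ} {z : ℝ} (hz : 1 ≤ z) : VV (PP D R) z ≤ kap D * (exp 1 * (1 + Real.log (z * (∏ p ∈ PP 0 D, p : ℕ)))) := by
  set W := ∏ p ∈ PP 0 D, p with hW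
  have hW1 : 1 ≤ W := prod_pos' (PP_prm 0 D)
  have hPU : Prm (PP 0 D ∪ PP D R) := fun p hp => (mem_union.1 hp).elim (PP_prm _ _ p) (PP_prm _ _ p)
  have h1 : (∑ T ∈ (PP 0 D).powerset, om T) * VV (PP D R) z ≤ VV (PP 0 D ∪ PP D R) (z * W) := by
    rw [VV, sum_mul_sum, ← sum_product']
    refine sum_le_inj (fun x => x.1 ∪ x.2) ?_ ?_ ?_ ?_
    · rintro ⟨T, S⟩ h
      obtain ⟨h1, h2⟩ := mem_product.1 h
      rw [mem_powerset] at h1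
      rw [mem_pw] at h2 ⊢
      refine ⟨union_subset_union h1 h2.1, ?_⟩
      have hd := (PP_disj D R).mono h1 h2.1
      simp only
      rw [Finset.prod_union hd, Nat.cast_mul, mul_comm]
      refine mul_le_mul h2.2 ?_ (by positivity) (by linarith)
      exact_mod_cast prod_mono (PP_prm 0 D) h1
    · rintro ⟨T, S⟩ h ⟨T', S'⟩ h' e
      obtain ⟨h1, h2⟩ := mem_product.1 h
      obtain ⟨h1', h2'⟩ := mem_product.1 h'
      rw [mem_powerset] at h1 h1'
      have hd := PP_disj D R
      rw [Finset.disjoint_left] at hd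
      have h3 := (mem_pw.1 h2).1
      have h3' := (mem_pw.1 h2').1
      simp only at e h1 h1' h3 h3'
      rw [Finset.ext_iff] at e
      simp only [mem_union] at e
      refine Prod.ext (Finset.ext fun p => ⟨fun hp => ?_, fun hp => ?_⟩) (Finset.ext fun p => ⟨fun hp => ?_, fun hp => ?_⟩)
      · exact ((e p).1 (Or.inl hp)).resolve_right fun h => hd (h1 hp) (h3' h)
      · exact ((e p).2 (Or.inl hp)).resolve_right fun h => hd (h1' hp) (h3 h)
      · exact ((e p).1 (Or.inr hp)).resolve_left fun h => hd (h1' h) (h3 hp)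
      · exact ((e p).2 (Or.inr hp)).resolve_left fun h => hd (h1 h) (h3' hp)
    · rintro ⟨T, S⟩ h
      obtain ⟨h1, h2⟩ := mem_product.1 h
      have hd := (PP_disj D R).mono (mem_powerset.1 h1) (mem_pw.1 h2).1
      simp only at hd ⊢
      rw [om, om, om, Finset.prod_union hd]
    · intro U hU
      exact (om_pos (hPU.mono (mem_pw.1 hU).1)).le
  have h2 := h1.trans (VV_le hPU (z := z * W) (by have : (1:ℝ) ≤ W := by exact_mod_cast hW1
                                                  nlinarith))
  rw [kap_inv, inv_mul_le_iff₀ (kap_pos D)] at h2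
  exact h2
lemma VV_lo {D R : ℕ} {z : ℝ} (hz : 1 ≤ z) (hR : z ≤ R) : kap D * (1/2 * Real.log z) ≤ VV (PP D R) z := by
  have h1 : VV (PP 0 R) z ≤ (∑ T ∈ (PP 0 D).powerset, om T) * VV (PP D R) z := by
    rw [VV, VV, sum_mul_sum, ← sum_product']
    have hfil : ∀ U ∈ pw (PP 0 R) z, U = U.filter (· ≤ D) ∪ U.filter (fun p => ¬ p ≤ D) := fun U _ => (filter_union_filter_not_eq _ _).symm
    refine sum_le_inj (fun U => (U.filter (· ≤ D), U.filter (fun p => ¬ p ≤ D))) ?_ ?_ ?_ ?_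
    · intro U hU
      have hU' := mem_pw.1 hU
      refine mem_product.2 ⟨mem_powerset.2 fun p hp => ?_, mem_pw.2 ⟨fun p hp => ?_, ?_⟩⟩
      · rw [mem_filter] at hp
        have := hU'.1 hp.1
        simp only [PP, mem_filter, Finset.mem_Ioc] at this ⊢; exact ⟨⟨this.1.1, hp.2⟩, this.2⟩
      · rw [mem_filter] at hp
        have := hU'.1 hp.1
        simp only [PP, mem_filter, Finset.mem_Ioc] at this ⊢; exact ⟨⟨by omega, this.1.2⟩, this.2⟩
      · refine le_trans ?_ hU'.2
        exact_mod_cast prod_mono ((PP_prm 0 R).mono hU'.1) (filter_subset _ _)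
    · intro U hU U' hU' h
      obtain ⟨e1, e2⟩ := Prod.ext_iff.1 h
      simp only at e1 e2
      rw [hfil U hU, hfil U' hU', e1, e2]
    · intro U hU
      simp only
      rw [om, om, om, Finset.prod_filter_mul_prod_filter_not]
    · rintro ⟨T, S⟩ h
      obtain ⟨h1, h2⟩ := mem_product.1 h
      exact mul_nonneg (om_pos ((PP_prm 0 D).mono (mem_powerset.1 h1))).le (om_pos ((PP_prm D R).mono (mem_pw.1 h2).1)).le
  have h2 := (VV_ge hz hR).trans h1
  rw [kap_inv, le_inv_mul_iff₀ (kap_pos D)] at h2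
  exact h2
end BD
namespace BD
open Finset Topology
open ArithmeticFunction (vonMangoldt)
noncomputable def ww (L : ℝ) (n : ℕ) : ℝ := (n:ℝ)^(-(1+1/L)) * bmp (Real.log n - L)
noncomputable def aw (L : ℝ) (n : ℕ) : ℝ := if n.Prime then Real.log n * ww L n else 0
noncomputable def NL (L : ℝ) : ℕ := ⌊exp (L+4)⌋₊
noncomputable def X1 (L : ℝ) : ℝ := ∑ n ∈ Finset.Ioc 0 (NL L), aw L n
noncomputable def T1 {q : ℕ} (χ : DirichletCharacter ℂ q) (L : ℝ) : ℂ := ∑ n ∈ Finset.Ioc 0 (NL L), χ n * (aw L n : ℂ)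
lemma ww_nonneg (L n) : 0 ≤ ww L n := mul_nonneg (by positivity) bmp.nonneg
lemma aw_nonneg (L n) : 0 ≤ aw L n := by
  unfold aw; split_ifs
  · exact mul_nonneg (log_natCast_nonneg n) (ww_nonneg L n)
  · rfl
lemma win {L : ℝ} {n : ℕ} (hn : 0 < n) (h : ww L n ≠ 0) : exp (L-4) < n ∧ (n:ℝ) < exp (L+4) := by
  have hz : bmp (Real.log n - L) ≠ 0 := fun hh => h (by rw [ww, hh, mul_zero])
  have hball : Real.log n - L ∈ Function.support bmp := hz
  rw [bmp.support_eq, Metric.mem_ball, dist_zero_right, norm_eq_abs, abs_lt] at hball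
  have h4 : bmp.rOut = 4 := rfl
  rw [h4] at hball
  rw [← exp_log (by exact_mod_cast hn : (0:ℝ) < n)]
  exact ⟨exp_lt_exp.2 (by linarith), exp_lt_exp.2 (by linarith)⟩
lemma aw_win {L : ℝ} {n : ℕ} (h : aw L n ≠ 0) : n.Prime ∧ exp (L-4) < n ∧ (n:ℝ) < exp (L+4) := by
  unfold aw at h
  split_ifs at h with hp
  · exact ⟨hp, win hp.pos (right_ne_zero_of_mul h)⟩
  · exact absurd rfl h
lemma ww_le {L : ℝ} (hL : 0 < L) {n : ℕ} (hn : 0 < n) : ww L n ≤ exp (4 - L) := by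
  by_cases h : ww L n = 0
  · rw [h]; positivity
  obtain ⟨h1, h2⟩ := win hn h
  have h1n : (1:ℝ) ≤ n := by exact_mod_cast hn
  calc ww L n ≤ (n:ℝ)^(-(1+1/L)) * 1 := mul_le_mul_of_nonneg_left bmp.le_one (by positivity)
    _ ≤ (n:ℝ)^(-1:ℝ) := by
      rw [mul_one]; exact rpow_le_rpow_of_exponent_le h1n (by have : 0 < 1/L := by positivity
                                                              linarith)
    _ = (n:ℝ)⁻¹ := rpow_neg_one _
    _ ≤ (exp (L-4))⁻¹ := inv_anti₀ (by positivity) h1.le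
    _ = _ := by rw [← exp_neg]; congr 1; ring
lemma aw_le {L : ℝ} (hL : 0 < L) (n : ℕ) : aw L n ≤ (L+4) * exp (4 - L) := by
  by_cases h : aw L n = 0
  · rw [h]; positivity
  obtain ⟨h0, h1, h2⟩ := aw_win h
  rw [aw, if_pos h0]
  refine mul_le_mul ?_ (ww_le hL h0.pos) (ww_nonneg _ _) (by positivity)
  have := log_le_log (by exact_mod_cast h0.pos) h2.le
  rwa [log_exp] at this
lemma theta_half : ∃ X0 : ℝ, ∀ x, X0 ≤ x → x/2 ≤ Chebyshev.theta x := by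
  obtain ⟨C, hC⟩ := Chebyshev.psi_sub_theta_le_mul_sqrt
  refine ⟨max 1 ((10 * (|C|+5))^2), fun x hx => ?_⟩
  have hx1 : 1 ≤ x := (le_max_left _ _).trans hx
  have hx2 := (le_max_right _ _).trans hx
  have h1 := hC x
  have h2 := Chebyshev.psi_ge' (x := x) (by linarith)
  have hs : 10 * (|C|+5) ≤ √x := Real.le_sqrt_of_sq_le hx2
  have hss : √x * √x = x := Real.mul_self_sqrt (by linarith)
  have h3 : Real.log (x+2) ≤ 4 * √x := by
    have e : Real.log (x+2) = 2 * Real.log (√(x+2)) := by rw [Real.log_sqrt (by linarith)]; ring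
    have e2 := Real.log_le_sub_one_of_pos (x := √(x+2)) (by positivity)
    have e3 : √(x+2) ≤ 2 * √x := Real.sqrt_le_iff.2 ⟨by positivity, by nlinarith⟩
    linarith
  have h4 : C * √x ≤ |C| * √x := by gcongr; exact le_abs_self C
  have h5 := Real.log_two_gt_d9
  have h6 := Real.log_two_lt_d9
  have h7 : (|C| + 5) * √x * 10 ≤ x := by nlinarith [Real.sqrt_nonneg x]
  have h8 : 1 ≤ √x := Real.one_le_sqrt.2 hx1
  nlinarith
lemma X1_ge : ∃ L0 : ℝ, ∀ L, L0 ≤ L → exp (-7) ≤ X1 L := by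
  obtain ⟨X0, hX⟩ := theta_half
  refine ⟨max 1 X0, fun L hL => ?_⟩
  have hL1 : 1 ≤ L := (le_max_left _ _).trans hL
  have h0 : X0 ≤ exp (L+3) := ((le_max_right _ _).trans hL).trans (by have := add_one_le_exp (L+3); linarith)
  have h1 := hX _ h0
  have h2 := Chebyshev.theta_le_log4_mul_x (x := exp (L-3)) (by positivity)
  have h3 : Chebyshev.theta (exp (L+3)) - Chebyshev.theta (exp (L-3)) ≤ exp (L+7) * X1 L := by
    have hsub : Finset.Ioc 0 ⌊exp (L-3)⌋₊ ⊆ Finset.Ioc 0 ⌊exp (L+3)⌋₊ :=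
      Finset.Ioc_subset_Ioc_right (Nat.floor_mono (exp_le_exp.2 (by linarith)))
    have hsub2 : Finset.Ioc 0 ⌊exp (L+3)⌋₊ ⊆ Finset.Ioc 0 (NL L) :=
      Finset.Ioc_subset_Ioc_right (Nat.floor_mono (exp_le_exp.2 (by linarith)))
    rw [Chebyshev.theta, Chebyshev.theta, sum_filter, sum_filter, ← sum_sdiff hsub, add_sub_cancel_right, X1, mul_sum]
    refine (sum_le_sum fun n hn => ?_).trans (sum_le_sum_of_subset_of_nonneg (sdiff_subset.trans hsub2) fun n _ _ => mul_nonneg (by positivity) (aw_nonneg L n))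
    rw [Finset.mem_sdiff, Finset.mem_Ioc, Finset.mem_Ioc] at hn
    rw [aw]
    split_ifs with hp
    · have hn0 : (0:ℝ) < n := by exact_mod_cast hp.pos
      have n1 : (n:ℝ) ≤ exp (L+3) := (Nat.le_floor_iff (by positivity)).1 hn.1.2
      have n2 : exp (L-3) < n := by
        refine (Nat.floor_lt (by positivity)).1 (by by_contra hh; exact hn.2 ⟨hp.pos, by omega⟩)
      have l1 : Real.log n ≤ L+3 := by rw [← log_exp (L+3)]; exact log_le_log hn0 n1
      have l2 : L-3 ≤ Real.log n := by rw [← log_exp (L-3)]; exact log_le_log (by positivity) n2.le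
      have hb : bmp (Real.log n - L) = 1 := bmp.one_of_mem_closedBall (by
        rw [Metric.mem_closedBall, dist_zero_right, norm_eq_abs, abs_le]
        have : bmp.rIn = 3 := rfl
        rw [this]; constructor <;> linarith)
      have hw : exp (-(L+7)) ≤ ww L n := by
        rw [ww, hb, mul_one, rpow_def_of_pos hn0, exp_le_exp]
        have e1 : Real.log n * (1/L) ≤ (L+3) * (1/L) := by gcongr
        have e2 : (L+3) * (1/L) = 1 + 3/L := by field_simp
        have e3 : 3/L ≤ 3 := by rw [div_le_iff₀ (by linarith)]; linarith
        linarith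
      have := log_natCast_nonneg n
      calc Real.log n = exp (L+7) * (Real.log n * exp (-(L+7))) := by
            rw [mul_left_comm, ← exp_add]; simp
        _ ≤ _ := by gcongr
    · simp
  have h4 : exp (L+3) = exp L * exp 3 := exp_add _ _
  have h5 : exp (L-3) = exp L * exp (-3) := by rw [← exp_add]; rfl
  have h6 : Real.log 4 ≤ 2 := by
    have : (4:ℝ) = 2^2 := by norm_num
    rw [this, log_pow]; have := Real.log_two_lt_d9; push_cast; linarith
  have h7 : exp (-3) ≤ 1/4 := by
    rw [exp_neg, inv_le_comm₀ (by positivity) (by norm_num)]; have := add_one_le_exp (3:ℝ); linarith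
  have h8 : (4:ℝ) ≤ exp 3 := by have := add_one_le_exp (3:ℝ); linarith
  have h9 : exp L ≤ exp (L+7) * X1 L := by
    have : Real.log 4 * exp (L-3) ≤ 2 * (exp L * (1/4)) := by rw [h5]; gcongr
    have : exp L * 4 ≤ exp (L+3) := by rw [h4]; gcongr
    have := exp_pos L
    linarith
  have : exp L = exp (L+7) * exp (-7) := by rw [← exp_add]; congr 1; ring
  rw [this] at h9
  exact le_of_mul_le_mul_left h9 (by positivity)
lemma T_eq {q : ℕ} (χ : DirichletCharacter ℂ q) (L : ℝ) :
    tw (psi 0) L (vL χ 0) = ∑ n ∈ Finset.Ioc 0 (NL L), χ n * ((vonMangoldt n * ww L n : ℝ) : ℂ) := by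
  have key : ∀ n : ℕ, LSeries.term (vL χ 0) ((1+1/L:ℝ):ℂ) n * psi 0 (Real.log n - L) = if n = 0 then 0 else χ n * ((vonMangoldt n * ww L n : ℝ) : ℂ) := by
    intro n
    split_ifs with hn
    · subst hn; simp
    · rw [LSeries.term_of_ne_zero hn, vL, psi_apply, ww]
      push_cast
      rw [Complex.ofReal_cpow (by positivity)]
      push_cast
      rw [Complex.cpow_neg]
      ring
  unfold tw
  rw [tsum_congr key, tsum_eq_sum (s := Finset.Ioc 0 (NL L))]
  · exact sum_congr rfl fun n hn => if_neg (by have := (Finset.mem_Ioc.1 hn).1; omega)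
  · intro n hn
    split_ifs with h0
    · rfl
    · have : ww L n = 0 := by
        by_contra h
        refine hn (Finset.mem_Ioc.2 ⟨by omega, Nat.le_floor (win (by omega) h).2.le⟩)
      rw [this]; simp
lemma T1_close : ∃ C : ℝ, 0 ≤ C ∧ ∀ L, 1 ≤ L → ∀ (q : ℕ) (χ : DirichletCharacter ℂ q), ‖T1 χ L‖ ≤ ‖tw (psi 0) L (vL χ 0)‖ + C * exp (-(L/2)) := by
  obtain ⟨C, hC⟩ := Chebyshev.psi_sub_theta_le_mul_sqrt
  refine ⟨|C| * exp 6, by positivity, fun L hL q χ => ?_⟩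
  have h : tw (psi 0) L (vL χ 0) - T1 χ L = ∑ n ∈ Finset.Ioc 0 (NL L) with ¬ n.Prime, χ n * ((vonMangoldt n * ww L n : ℝ) : ℂ) := by
    rw [T_eq, T1, ← sum_sub_distrib, sum_filter]
    refine sum_congr rfl fun n _ => ?_
    rw [aw]
    split_ifs with hp
    · rw [ArithmeticFunction.vonMangoldt_apply_prime hp, sub_self]
    · simp
  have h2 : ‖tw (psi 0) L (vL χ 0) - T1 χ L‖ ≤ exp (4-L) * (Chebyshev.psi (exp (L+4)) - Chebyshev.theta (exp (L+4))) := by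
    rw [h, Chebyshev.psi_sub_theta_eq_sum_not_prime, mul_sum]
    refine norm_sum_le_of_le _ fun n hn => ?_
    rw [norm_mul, Complex.norm_real, norm_of_nonneg (mul_nonneg ArithmeticFunction.vonMangoldt_nonneg (ww_nonneg _ _))]
    calc _ ≤ 1 * (vonMangoldt n * ww L n) := by
          gcongr
          · exact mul_nonneg ArithmeticFunction.vonMangoldt_nonneg (ww_nonneg _ _)
          · exact DirichletCharacter.norm_le_one _ _
      _ ≤ vonMangoldt n * exp (4-L) := by
          rw [one_mul]
          exact mul_le_mul_of_nonneg_left (ww_le (by linarith) (Finset.mem_Ioc.1 (mem_filter.1 hn).1).1) ArithmeticFunction.vonMangoldt_nonneg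
      _ = _ := mul_comm _ _
  have h3 : exp (4-L) * (Chebyshev.psi (exp (L+4)) - Chebyshev.theta (exp (L+4))) ≤ |C| * exp 6 * exp (-(L/2)) := by
    calc _ ≤ exp (4-L) * (|C| * √(exp (L+4))) := by
          gcongr
          exact (hC _).trans (by gcongr; exact le_abs_self C)
      _ = |C| * (exp (4-L) * exp ((L+4)/2)) := by rw [← Real.exp_half]; ring
      _ = _ := by rw [← exp_add, mul_assoc, ← exp_add]; congr 2; ring
  have h4 := norm_sub_norm_le (T1 χ L) (tw (psi 0) L (vL χ 0))
  rw [norm_sub_rev] at h4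
  linarith
end BD
namespace BD
open Finset Topology
noncomputable def Er (q : ℕ) (L : ℝ) : ℝ := by
  classical
  exact if h : q = 0 then 0 else (haveI : NeZero q := ⟨h⟩; 1/(q.totient:ℝ) * ∑ χ : DirichletCharacter ℂ q with χ ≠ 1, ‖T1 χ L‖)
lemma Er_eq (q : ℕ) [NeZero q] (L : ℝ) [DecidableEq (DirichletCharacter ℂ q)] :
    Er q L = 1/(q.totient:ℝ) * ∑ χ : DirichletCharacter ℂ q with χ ≠ 1, ‖T1 χ L‖ := by
  rw [Er, dif_neg (NeZero.ne q)]
  congr!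
lemma Er_nonneg (q L) : 0 ≤ Er q L := by
  unfold Er; split_ifs
  · rfl
  · exact mul_nonneg (by positivity) (sum_nonneg fun _ _ => norm_nonneg _)
lemma aw_coprime {L : ℝ} (hL : 5 ≤ L) {n q : ℕ} (hq : q ≠ 0) (hqL : (q:ℝ) ≤ exp (L/100)) (h : aw L n ≠ 0) : n.Coprime q := by
  obtain ⟨hp, h1, _⟩ := aw_win h
  have : q < n := by
    have : (q:ℝ) < n := lt_of_le_of_lt (hqL.trans (exp_le_exp.2 (by linarith))) h1
    exact_mod_cast this
  exact (Nat.Prime.coprime_iff_not_dvd hp).2 fun hd => by have := Nat.le_of_dvd (by omega) hd; omega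
lemma T1_prim {L : ℝ} (hL : 5 ≤ L) {q : ℕ} (hq : q ≠ 0) (hqL : (q:ℝ) ≤ exp (L/100)) (χ : DirichletCharacter ℂ q) :
    T1 χ L = T1 χ.primitiveCharacter L := by
  refine sum_congr rfl fun n _ => ?_
  by_cases h : aw L n = 0
  · rw [h]; simp
  congr 1
  have := χ.primitiveCharacter_apply_of_isCoprime (a := (n:ℤ)) (Nat.isCoprime_iff_coprime.2 (aw_coprime hL hq hqL h))
  simpa using this.symm
lemma progression {L : ℝ} (hL : 5 ≤ L) {q b : ℕ} (hq : q ≠ 0) (hqL : (q:ℝ) ≤ exp (L/100)) (hb : b.Coprime q) :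
    |(∑ n ∈ Finset.Ioc 0 (NL L) with n ≡ b [MOD q], aw L n) - X1 L / q.totient| ≤ Er q L := by
  classical
  have : NeZero q := ⟨hq⟩
  have hφ : (0:ℝ) < q.totient := by exact_mod_cast Nat.totient_pos.2 (by omega)
  have hu : IsUnit (b : ZMod q) := (ZMod.isUnit_iff_coprime b q).2 hb
  set S := ∑ n ∈ Finset.Ioc 0 (NL L) with n ≡ b [MOD q], aw L n with hS
  have h1 : (q.totient : ℂ) * (S : ℂ) = ∑ χ : DirichletCharacter ℂ q, χ (b : ZMod q)⁻¹ * T1 χ L := by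
    calc (q.totient : ℂ) * (S : ℂ) = ∑ n ∈ Finset.Ioc 0 (NL L), (∑ χ : DirichletCharacter ℂ q, χ (b : ZMod q)⁻¹ * χ n) * aw L n := by
          rw [hS, sum_filter]; push_cast; rw [mul_sum]
          refine sum_congr rfl fun n _ => ?_
          rw [DirichletCharacter.sum_char_inv_mul_char_eq ℂ hu]
          have : ((b:ZMod q) = n) ↔ n ≡ b [MOD q] := by rw [ZMod.natCast_eq_natCast_iff]; exact ⟨fun h => h.symm, fun h => h.symm⟩
          by_cases h : n ≡ b [MOD q]
          · rw [if_pos h, if_pos (this.2 h)]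
          · rw [if_neg h, if_neg (fun hh => h (this.1 hh))]; simp
      _ = _ := by
          simp_rw [sum_mul]; rw [sum_comm]
          refine sum_congr rfl fun χ _ => ?_
          rw [T1, mul_sum]; exact sum_congr rfl fun n _ => by ring
  have h2 : (1 : DirichletCharacter ℂ q) (b : ZMod q)⁻¹ * T1 (1 : DirichletCharacter ℂ q) L = X1 L := by
    have hu' : IsUnit ((b : ZMod q)⁻¹) := by
      rw [isUnit_iff_exists_inv]; exact ⟨b, by rw [mul_comm]; exact ZMod.mul_inv_of_unit _ hu⟩
    rw [MulChar.one_apply hu', one_mul, T1, X1]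
    push_cast
    refine sum_congr rfl fun n _ => ?_
    by_cases h : aw L n = 0
    · rw [h]; simp
    rw [MulChar.one_apply ((ZMod.isUnit_iff_coprime n q).2 (aw_coprime hL hq hqL h)), one_mul]
  rw [← add_sum_erase _ _ (mem_univ (1 : DirichletCharacter ℂ q)), h2] at h1
  have h3 : ‖((q.totient * S - X1 L : ℝ) : ℂ)‖ ≤ ∑ χ : DirichletCharacter ℂ q with χ ≠ 1, ‖T1 χ L‖ := by
    have : ((q.totient * S - X1 L : ℝ) : ℂ) = ∑ χ ∈ univ.erase (1 : DirichletCharacter ℂ q), χ (b : ZMod q)⁻¹ * T1 χ L := by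
      push_cast; rw [h1]; ring
    rw [this, filter_ne']
    refine norm_sum_le_of_le _ fun χ _ => ?_
    rw [norm_mul]
    exact mul_le_of_le_one_left (norm_nonneg _) (DirichletCharacter.norm_le_one _ _)
  rw [Complex.norm_real, norm_eq_abs] at h3
  rw [Er_eq, one_div, inv_mul_eq_div, le_div_iff₀ hφ]
  refine le_trans (le_of_eq ?_) h3
  rw [← abs_of_pos hφ, ← abs_mul, abs_of_pos hφ]
  congr 1; field_simp
noncomputable def dxs (c : ℕ) : Finset DX := by
  classical
  exact if h : c = 0 then ∅ else (haveI : NeZero c := ⟨h⟩;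
    (univ.filter fun χ : DirichletCharacter ℂ c => χ.IsPrimitive ∧ χ ≠ 1).map ⟨Sigma.mk c, sigma_mk_injective⟩)
lemma mem_dxs {c : ℕ} {p : DX} : p ∈ dxs c ↔ p.1 = c ∧ c ≠ 0 ∧ p.2.IsPrimitive ∧ p.2 ≠ 1 := by
  unfold dxs
  split_ifs with h
  · simp [h]
  · simp only [Finset.mem_map, mem_filter, mem_univ, true_and, Function.Embedding.coeFn_mk]
    constructor
    · rintro ⟨χ, h1, rfl⟩
      exact ⟨rfl, h, h1⟩
    · rintro ⟨rfl, h2, h3⟩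
      exact ⟨p.2, h3, rfl⟩
lemma card_dxs (c : ℕ) : #(dxs c) ≤ c := by
  classical
  unfold dxs
  split_ifs with h
  · simp
  · have : NeZero c := ⟨h⟩
    rw [card_map]
    refine (card_le_univ _).trans ?_
    rw [← Nat.card_eq_fintype_card, DirichletCharacter.card_eq_totient_of_hasEnoughRootsOfUnity]
    exact Nat.totient_le c
lemma dxs_one : dxs 1 = ∅ := by
  refine eq_empty_of_forall_notMem fun p hp => ?_
  obtain ⟨c, χ⟩ := p
  obtain ⟨h1, h2, h3, h4⟩ := mem_dxs.1 hp
  simp only at h1 h4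
  subst h1
  exact h4 (DirichletCharacter.level_one χ)
noncomputable def Bq (c : ℕ) (L : ℝ) : ℝ := ∑ p ∈ dxs c, ‖T1 p.2 L‖
lemma Bq_nonneg (c L) : 0 ≤ Bq c L := sum_nonneg fun _ _ => norm_nonneg _
lemma Er_le {L : ℝ} (hL : 5 ≤ L) {S : Finset ℕ} (hS : Prm S) (hq : ((∏ p ∈ S, p : ℕ):ℝ) ≤ exp (L/100)) :
    Er (∏ p ∈ S, p) L ≤ om S * ∑ T ∈ S.powerset, Bq (∏ p ∈ T, p) L := by
  classical
  set q := ∏ p ∈ S, p with hqd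
  have hq0 : q ≠ 0 := (prod_pos' hS).ne'
  have : NeZero q := ⟨hq0⟩
  have hpf : q.primeFactors = S := Nat.primeFactors_prod hS
  have hsq : Squarefree q := by
    refine Finset.squarefree_prod_of_pairwise_isCoprime (fun p hp p' hp' h => ?_) fun p hp => (hS p hp).prime.squarefree
    exact Nat.coprime_iff_isRelPrime.1 ((Nat.coprime_primes (hS p hp) (hS p' hp')).2 h)
  have hom : 1/(q.totient:ℝ) = om S := by
    rw [Nat.totient_eq_prod_factorization hq0, om, Nat.prod_factorization_eq_prod_primeFactors, hpf]
    rw [Nat.cast_prod, one_div, ← Finset.prod_inv_distrib]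
    refine Finset.prod_congr rfl fun p hp => ?_
    rw [Nat.factorization_eq_one_of_squarefree hsq (hS p hp) (Nat.dvd_of_mem_primeFactors (hpf ▸ hp))]
    rw [Nat.sub_self, pow_zero, one_mul, Nat.cast_sub (hS p hp).one_le, one_div]; simp
  rw [Er_eq, hom]
  refine mul_le_mul_of_nonneg_left ?_ (om_pos hS).le
  have : ∑ T ∈ S.powerset, Bq (∏ p ∈ T, p) L = ∑ x ∈ S.powerset.sigma fun T => dxs (∏ p ∈ T, p), ‖T1 x.2.2 L‖ := by
    rw [sum_sigma]; rfl
  rw [this]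
  refine sum_le_inj (fun χ => ⟨χ.conductor.primeFactors, ⟨χ.conductor, χ.primitiveCharacter⟩⟩) ?_ ?_ ?_ (fun _ _ => norm_nonneg _)
  · intro χ hχ
    have hχ1 := (mem_filter.1 hχ).2
    have hd := χ.conductor_dvd_level
    have hc0 : χ.conductor ≠ 0 := fun h => hq0 (Nat.eq_zero_of_zero_dvd (h ▸ hd))
    have hpr : ∏ p ∈ χ.conductor.primeFactors, p = χ.conductor := Nat.prod_primeFactors_of_squarefree (hsq.squarefree_of_dvd hd)
    refine mem_sigma.2 ⟨mem_powerset.2 (hpf ▸ Nat.primeFactors_mono hd hq0), mem_dxs.2 ⟨hpr.symm, by simpa only [hpr] using hc0, χ.primitiveCharacter_isPrimitive, fun h => hχ1 ?_⟩⟩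
    rw [← χ.changeLevel_primitiveCharacter]
    simp only at h
    rw [h]; simp
  · intro χ _ χ' _ h
    have h2 : (⟨χ.conductor, χ.primitiveCharacter⟩ : DX) = ⟨χ'.conductor, χ'.primitiveCharacter⟩ := (Sigma.mk.inj h).2.eq
    refine MulChar.ext fun u => ?_
    obtain ⟨a, ha⟩ := ZMod.intCast_surjective (u : ZMod q)
    have hc : IsCoprime a (q:ℤ) := by
      rw [isCoprime_comm, ← ZMod.coe_int_isUnit_iff_isCoprime, ha]; exact u.isUnit
    have e1 := χ.primitiveCharacter_apply_of_isCoprime hc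
    have e2 := χ'.primitiveCharacter_apply_of_isCoprime hc
    rw [← ha, ← e1, ← e2]
    exact congrArg (fun p : DX => p.2 a) h2
  · intro χ _
    exact (congrArg _ (T1_prim hL hq0 hq χ)).le
end BD
namespace BD
open Finset Topology
lemma Bsum : ∃ C L0 : ℝ, 0 ≤ C ∧ ∀ L, L0 ≤ L → ∀ P : Finset ℕ, Prm P → ∑ T ∈ pw P (exp (L/100)), Bq (∏ p ∈ T, p) L ≤ C * L^5 := by
  obtain ⟨C, L0, hC, h⟩ := mean_value
  obtain ⟨C', hC', h'⟩ := T1_close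
  refine ⟨C + C', max L0 1, by positivity, fun L hL P hP => ?_⟩
  have hL0 := (le_max_left _ _).trans hL
  have hL1 : 1 ≤ L := (le_max_right _ _).trans hL
  set Q := exp (L/100)
  set I := Finset.Icc 1 ⌊Q⌋₊ with hI
  have hle : ∀ c ∈ I, c ≠ 0 ∧ (c:ℝ) ≤ Q := fun c hc => by
    rw [hI, Finset.mem_Icc] at hc
    exact ⟨by omega, (Nat.le_floor_iff (by positivity)).1 hc.2⟩
  have h1 : ∑ T ∈ pw P Q, Bq (∏ p ∈ T, p) L ≤ ∑ c ∈ I, Bq c L := by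
    refine sum_le_inj (fun T => ∏ p ∈ T, p) ?_ ?_ (fun _ _ => le_rfl) (fun c _ => Bq_nonneg c L)
    · intro S hS
      rw [mem_pw] at hS
      exact Finset.mem_Icc.2 ⟨prod_pos' (hP.mono hS.1), Nat.le_floor hS.2⟩
    · intro S hS T hT h
      exact prod_inj (hP.mono (mem_pw.1 hS).1) (hP.mono (mem_pw.1 hT).1) h
  classical
  set s := I.biUnion dxs with hs
  have h2 : ∑ c ∈ I, Bq c L = ∑ p ∈ s, ‖T1 p.2 L‖ := by
    rw [hs, sum_biUnion]
    · rfl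
    · intro c _ c' _ hne
      rw [Function.onFun, Finset.disjoint_left]
      intro p hp hp'
      exact hne ((mem_dxs.1 hp).1.symm.trans (mem_dxs.1 hp').1)
  have h3 : (#s : ℝ) ≤ exp (L/50) := by
    calc (#s : ℝ) ≤ ∑ c ∈ I, (#(dxs c) : ℝ) := by exact_mod_cast card_biUnion_le
      _ ≤ ∑ c ∈ I, Q := sum_le_sum fun c hc => le_trans (by exact_mod_cast card_dxs c) (hle c hc).2
      _ = ⌊Q⌋₊ * Q := by rw [sum_const, nsmul_eq_mul, hI, Nat.card_Icc, Nat.add_sub_cancel]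
      _ ≤ Q * Q := by gcongr; exact Nat.floor_le (by positivity)
      _ = exp (L/50) := by rw [← exp_add]; congr 1; ring
  have h4 := h L hL0 s (fun p hp => by
    obtain ⟨c, hc, hpc⟩ := mem_biUnion.1 hp
    obtain ⟨e1, e2, e3, e4⟩ := mem_dxs.1 hpc
    exact ⟨by rw [e1]; exact e2, by rw [e1]; exact (hle c hc).2, e3, e4⟩) h3
  refine h1.trans (h2.le.trans ((sum_le_sum fun p _ => h' L hL1 p.1 p.2).trans ?_))
  rw [sum_add_distrib, sum_const, nsmul_eq_mul, add_mul]
  refine add_le_add h4 ?_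
  calc (#s:ℝ) * (C' * exp (-(L/2))) ≤ exp (L/50) * (C' * exp (-(L/2))) := by gcongr
    _ = C' * (exp (L/50) * exp (-(L/2))) := by ring
    _ = C' * exp (-(12/25 * L)) := by rw [← exp_add]; congr 2; ring
    _ ≤ C' * 1 := by gcongr; exact exp_le_one_iff.2 (by linarith)
    _ ≤ C' * L^5 := by gcongr; exact one_le_pow₀ hL1
lemma exp_small (m : ℕ) : ∃ C : ℝ, 0 ≤ C ∧ ∀ L : ℝ, 1 ≤ L → exp (-(L/2)) ≤ C * (L^m)⁻¹ := by
  refine ⟨(m.factorial : ℝ) * 2^m, by positivity, fun L hL => ?_⟩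
  have h := Real.pow_div_factorial_le_exp (L/2) (by linarith) m
  rw [exp_neg, ← div_eq_mul_inv, inv_le_iff_one_le_mul₀ (by positivity), div_mul_eq_mul_div, one_le_div (by positivity)]
  rw [div_le_iff₀ (by positivity), div_pow, div_le_iff₀ (by positivity)] at h
  calc L^m ≤ _ := h
    _ = _ := by ring
lemma Bsmall {A : ℝ} (hA : 0 < A) (m : ℕ) : ∃ C L0 : ℝ, 0 ≤ C ∧ ∀ L, L0 ≤ L → Good A L → ∀ c : ℕ, (c:ℝ) ≤ L^A → Bq c L ≤ c * (C * (L^m)⁻¹) := by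
  obtain ⟨C, L0, hC, h⟩ := siegel hA m
  obtain ⟨C', hC', h'⟩ := T1_close
  obtain ⟨C2, hC2, h2⟩ := exp_small m
  refine ⟨C + C' * C2, max L0 1, by positivity, fun L hL hG c hc => ?_⟩
  have hL0 := (le_max_left _ _).trans hL
  have hL1 : 1 ≤ L := (le_max_right _ _).trans hL
  calc Bq c L ≤ ∑ p ∈ dxs c, (C + C' * C2) * (L^m)⁻¹ := sum_le_sum fun p hp => by
        obtain ⟨e1, e2, e3, e4⟩ := mem_dxs.1 hp
        have : NeZero p.1 := ⟨by rw [e1]; exact e2⟩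
        have h3 := h L hL0 hG p.1 p.2 (by rw [e1]; exact hc) e3 e4
        rw [rpow_neg (by linarith), rpow_natCast] at h3
        have h5 : C' * exp (-(L/2)) ≤ C' * (C2 * (L^m)⁻¹) := by gcongr; exact h2 L hL1
        calc _ ≤ _ := h' L hL1 p.1 p.2
          _ ≤ C * (L^m)⁻¹ + C' * (C2 * (L^m)⁻¹) := add_le_add h3 h5
          _ = _ := by ring
    _ = #(dxs c) * ((C + C' * C2) * (L^m)⁻¹) := by rw [sum_const, nsmul_eq_mul]
    _ ≤ _ := by gcongr; exact card_dxs c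
lemma two_pow_le {T : Finset ℕ} (hT : Prm T) : 2^(#T) ≤ ∏ p ∈ T, p := by
  rw [← Finset.prod_const]
  exact Finset.prod_le_prod' fun p hp => (hT p hp).two_le
lemma om_le_one {T : Finset ℕ} (hT : Prm T) : om T ≤ 1 := Finset.prod_le_one (fun p hp => by have := p_sub (hT p hp); positivity) fun p hp => by
  rw [div_le_one (by have := p_sub (hT p hp); linarith)]; exact p_sub (hT p hp)
lemma Mom (M : ℕ) : ∃ K : ℝ, 0 ≤ K ∧ ∀ T : Finset ℕ, Prm T → (M:ℝ)^(#T) * om T ≤ K * (((∏ p ∈ T, p : ℕ):ℝ)^(1/2:ℝ))⁻¹ := by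
  set N := 4 * (M+1)^2
  refine ⟨(2*(M+1):ℝ)^N, by positivity, fun T hT => ?_⟩
  have h1 : (M:ℝ)^(#T) * om T ≤ ∏ p ∈ T, ((if p < N then (2*(M+1):ℝ) else 1) * ((p:ℝ)^(1/2:ℝ))⁻¹) := by
    rw [← Finset.prod_const, om, ← Finset.prod_mul_distrib]
    refine Finset.prod_le_prod (fun p hp => by have := p_sub (hT p hp); positivity) fun p hp => ?_
    have h2 := p_sub (hT p hp)
    have hp0 : (0:ℝ) < p := by linarith
    have hs : (0:ℝ) < (p:ℝ)^(1/2:ℝ) := by positivity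
    have hss : (p:ℝ)^(1/2:ℝ) * (p:ℝ)^(1/2:ℝ) = p := by rw [← rpow_add hp0]; norm_num
    have hs1 : (1:ℝ) ≤ (p:ℝ)^(1/2:ℝ) := one_le_rpow (by linarith) (by norm_num)
    rw [mul_one_div, ← div_eq_mul_inv, div_le_div_iff₀ (by linarith) hs]
    split_ifs with h
    · have h3 : (p:ℝ)^(1/2:ℝ) ≤ 2 * ((p:ℝ)-1) := by nlinarith
      have hM0 : (0:ℝ) ≤ M := Nat.cast_nonneg M
      calc (M:ℝ) * (p:ℝ)^(1/2:ℝ) ≤ M * (2 * ((p:ℝ)-1)) := by gcongr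
        _ ≤ _ := by nlinarith
    · have h4 : (N:ℝ) ≤ p := by exact_mod_cast not_lt.1 h
      have h5 : 2 * ((M:ℝ)+1) ≤ (p:ℝ)^(1/2:ℝ) := by
        by_contra hh
        push Not at hh
        have : (p:ℝ) < (2 * ((M:ℝ)+1)) * (2 * ((M:ℝ)+1)) := by
          rw [← hss]; exact mul_lt_mul'' hh hh hs.le hs.le
        have hN : (N:ℝ) = 4 * ((M:ℝ)+1)^2 := by simp [N]
        nlinarith
      nlinarith [(Nat.cast_nonneg M : (0:ℝ) ≤ M)]
  refine h1.trans ?_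
  rw [Finset.prod_mul_distrib, Nat.cast_prod, ← Real.finset_prod_rpow _ _ (fun p _ => by positivity), ← Finset.prod_inv_distrib]
  refine mul_le_mul_of_nonneg_right ?_ (by positivity)
  rw [← Finset.prod_filter, Finset.prod_const]
  refine pow_le_pow_right₀ (by have := (Nat.cast_nonneg M : (0:ℝ) ≤ M); linarith) ?_
  calc _ ≤ #(Finset.range N) := card_le_card fun p hp => Finset.mem_range.2 (mem_filter.1 hp).2
    _ = N := Finset.card_range N
theorem BV (M : ℕ) : ∃ A K L0 : ℝ, 0 < A ∧ ∀ L, L0 ≤ L → Good A L → ∀ P : Finset ℕ, Prm P →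
    ∑ S ∈ pw P (exp (L/100)), (M:ℝ)^(#S) * Er (∏ p ∈ S, p) L ≤ K / L := by
  obtain ⟨C5, L5, hC5, h5⟩ := Bsum
  set a : ℕ := 2 * M + 12 with ha
  have ha0 : (0:ℝ) < (a:ℝ) := by rw [ha]; positivity
  set m : ℕ := a * (M+2) + M + 1 with hm
  obtain ⟨C6, L6, hC6, h6⟩ := Bsmall ha0 m
  obtain ⟨K, hK, hM⟩ := Mom M
  refine ⟨a, (C6 + K * C5) * (2 * exp 1)^M, max (max L5 L6) 5, ha0, fun L hL hG P hP => ?_⟩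
  have hL5 := ((le_max_left _ _).trans (le_max_left _ _)).trans hL
  have hL6 := ((le_max_right _ _).trans (le_max_left _ _)).trans hL
  have hLf : 5 ≤ L := (le_max_right _ _).trans hL
  have hLp : 0 < L := by linarith
  have hL1 : 1 ≤ L := by linarith
  set Q := exp (L/100)
  have hom : ∀ S ⊆ P, 0 ≤ om S := fun S hS => (om_pos (hP.mono hS)).le
  have s1 : ∑ S ∈ pw P Q, (M:ℝ)^(#S) * Er (∏ p ∈ S, p) L ≤
      ∑ S ∈ pw P Q, ∑ T ∈ S.powerset, ((M:ℝ)^(#T) * om T * Bq (∏ p ∈ T, p) L) * ((M:ℝ)^(#(S \ T)) * om (S \ T)) := by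
    refine sum_le_sum fun S hS => ?_
    have hS' := mem_pw.1 hS
    calc _ ≤ (M:ℝ)^(#S) * (om S * ∑ T ∈ S.powerset, Bq (∏ p ∈ T, p) L) := by
          gcongr; exact Er_le hLf (hP.mono hS'.1) hS'.2
      _ = _ := by
          rw [← mul_assoc, mul_sum]
          refine sum_congr rfl fun T hT => ?_
          have hT := mem_powerset.1 hT
          have e1 : om S = om (S \ T) * om T := (Finset.prod_sdiff hT).symm
          have e2 : (M:ℝ)^(#S) = (M:ℝ)^(#(S \ T)) * (M:ℝ)^(#T) := by rw [← pow_add, card_sdiff_add_card_eq_card hT]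
          rw [e1, e2]; ring
  have s2 := s1.trans (split_le hP Q (fun T => (M:ℝ)^(#T) * om T * Bq (∏ p ∈ T, p) L) (fun U => (M:ℝ)^(#U) * om U)
    (fun S hS => mul_nonneg (mul_nonneg (by positivity) (hom S hS)) (Bq_nonneg _ _)) (fun S hS => mul_nonneg (by positivity) (hom S hS)))
  have s3 : ∑ U ∈ pw P Q, (M:ℝ)^(#U) * om U ≤ (2 * exp 1)^M * L^M := by
    refine (VM_le hP (z := Q) (by rw [Real.one_le_exp_iff]; linarith) M).trans ?_
    rw [← mul_pow, Real.log_exp]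
    refine pow_le_pow_left₀ (by positivity) ?_ _
    have := exp_pos 1
    nlinarith
  have s4 : ∑ T ∈ pw P Q, (M:ℝ)^(#T) * om T * Bq (∏ p ∈ T, p) L ≤ (C6 + K * C5) * (L^(M+1))⁻¹ := by
    rw [← sum_filter_add_sum_filter_not _ (fun T => ((∏ p ∈ T, p : ℕ):ℝ) ≤ L^a), add_mul]
    refine add_le_add ?_ ?_
    · calc _ ≤ ∑ T ∈ pw P Q with ((∏ p ∈ T, p : ℕ):ℝ) ≤ L^a, C6 * (L^m)⁻¹ * (L^a)^(M+1) := by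
            refine sum_le_sum fun T hT => ?_
            obtain ⟨h1, h2⟩ := mem_filter.1 hT
            have hT' := hP.mono (mem_pw.1 h1).1
            have e1 : (M:ℝ)^(#T) ≤ (L^a)^M := by
              calc (M:ℝ)^(#T) ≤ ((2:ℝ)^M)^(#T) := by gcongr; exact_mod_cast (Nat.lt_two_pow_self).le
                _ = ((2^(#T) : ℕ):ℝ)^M := by push_cast; rw [← pow_mul, ← pow_mul, mul_comm]
                _ ≤ (L^a)^M := by
                  refine pow_le_pow_left₀ (by positivity) (le_trans ?_ h2) _
                  exact_mod_cast two_pow_le hT'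
            have e2 := h6 L hL6 hG (∏ p ∈ T, p) (by rw [rpow_natCast]; exact h2)
            calc _ ≤ (L^a)^M * 1 * (L^a * (C6 * (L^m)⁻¹)) := by
                  refine mul_le_mul (mul_le_mul e1 (om_le_one hT') (om_pos hT').le (by positivity)) (e2.trans ?_) (Bq_nonneg _ _) (by positivity)
                  gcongr
              _ = _ := by ring
        _ ≤ L^a * (C6 * (L^m)⁻¹ * (L^a)^(M+1)) := by
            rw [sum_const, nsmul_eq_mul]
            refine mul_le_mul_of_nonneg_right ?_ (by positivity)
            have : #{T ∈ pw P Q | ((∏ p ∈ T, p : ℕ):ℝ) ≤ L^a} ≤ #(Finset.Icc 1 ⌊L^a⌋₊) := by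
              refine card_le_card_of_injOn (fun T => ∏ p ∈ T, p) ?_ ?_
              · intro T hT
                obtain ⟨h1, h2⟩ := mem_filter.1 hT
                exact Finset.mem_coe.2 (Finset.mem_Icc.2 ⟨prod_pos' (hP.mono (mem_pw.1 h1).1), Nat.le_floor h2⟩)
              · intro T hT T' hT' e
                exact prod_inj (hP.mono (mem_pw.1 (mem_filter.1 hT).1).1) (hP.mono (mem_pw.1 (mem_filter.1 hT').1).1) e
            rw [Nat.card_Icc, Nat.add_sub_cancel] at this
            exact le_trans (by exact_mod_cast this) (Nat.floor_le (by positivity))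
        _ = C6 * (L^(M+1))⁻¹ := by
            have : L^m = L^a * (L^a)^(M+1) * L^(M+1) := by rw [← pow_mul, ← pow_add, ← pow_add]; congr 1; rw [hm]; ring
            rw [this]
            field_simp
    · calc _ ≤ ∑ T ∈ pw P Q with ¬ ((∏ p ∈ T, p : ℕ):ℝ) ≤ L^a, K * (L^(M+6))⁻¹ * Bq (∏ p ∈ T, p) L := by
            refine sum_le_sum fun T hT => ?_
            obtain ⟨h1, h2⟩ := mem_filter.1 hT
            have hT' := hP.mono (mem_pw.1 h1).1
            refine mul_le_mul_of_nonneg_right ((hM T hT').trans ?_) (Bq_nonneg _ _)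
            have e1 : L^(M+6) = (L^a)^(1/2:ℝ) := by
              rw [← rpow_natCast L a, ← rpow_mul hLp.le, ha, ← rpow_natCast L (M+6)]
              congr 1; push_cast; ring
            rw [e1]
            push Not at h2
            gcongr
        _ ≤ ∑ T ∈ pw P Q, K * (L^(M+6))⁻¹ * Bq (∏ p ∈ T, p) L :=
            sum_le_sum_of_subset_of_nonneg (filter_subset _ _) fun T _ _ => mul_nonneg (by positivity) (Bq_nonneg _ _)
        _ = K * (L^(M+6))⁻¹ * ∑ T ∈ pw P Q, Bq (∏ p ∈ T, p) L := by rw [mul_sum]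
        _ ≤ K * (L^(M+6))⁻¹ * (C5 * L^5) := by gcongr; exact h5 L hL5 P hP
        _ = _ := by
            rw [show M + 6 = (M + 1) + 5 by ring, pow_add L (M+1) 5]; field_simp
  refine s2.trans ((mul_le_mul s4 s3 (sum_nonneg fun S hS => mul_nonneg (by positivity) (hom S (mem_pw.1 hS).1)) (by positivity)).trans (le_of_eq ?_))
  rw [pow_succ]; field_simp
end BD
namespace BD
open Finset Topology
section comb
variable {ι α β : Type} [Fintype ι] [DecidableEq ι] [Fintype α] [DecidableEq α] [Fintype β] [DecidableEq β]
lemma fib (κ : β → α) (m : ι → β → ℝ) (y : (ι → α) → ℝ) :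
    ∑ b : ι → β, y (fun p => κ (b p)) * ∏ p, m p (b p) = ∑ a, y a * ∏ p, ∑ b with κ b = a p, m p b := by
  rw [← sum_fiberwise univ (fun (b : ι → β) p => κ (b p))]
  refine sum_congr rfl fun a _ => ?_
  rw [Finset.prod_univ_sum, mul_sum]
  have : (univ.filter fun b : ι → β => (fun p => κ (b p)) = a) = Fintype.piFinset fun p => univ.filter fun b => κ b = a p := by
    ext b; simp [funext_iff]
  rw [this]
  refine sum_congr rfl fun b hb => ?_
  rw [show (fun p => κ (b p)) = a from funext fun p => by simpa using Fintype.mem_piFinset.1 hb p]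
lemma coll (κ : β → α) {m : ι → β → ℝ} {y : (ι → α) → ℝ} {y' : (ι → β) → ℝ} {ε : ι → ℝ} {w : ι → α → ℝ}
    (hm : ∀ p b, 0 ≤ m p b) (hy : ∀ a, 0 ≤ y a) (hyy : ∀ b, y' b ≤ y (fun p => κ (b p)))
    (h : ∀ p a, ∑ b with κ b = a, m p b ≤ (1 + ε p) * w p a) :
    ∑ b : ι → β, y' b * ∏ p, m p (b p) ≤ (∏ p, (1 + ε p)) * ∑ a, y a * ∏ p, w p (a p) := by
  calc _ ≤ ∑ b : ι → β, y (fun p => κ (b p)) * ∏ p, m p (b p) :=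
        sum_le_sum fun b _ => mul_le_mul_of_nonneg_right (hyy b) (Finset.prod_nonneg fun p _ => hm p _)
    _ = ∑ a, y a * ∏ p, ∑ b with κ b = a p, m p b := fib κ m y
    _ ≤ ∑ a, y a * ∏ p, ((1 + ε p) * w p (a p)) := sum_le_sum fun a _ => mul_le_mul_of_nonneg_left
        (Finset.prod_le_prod (fun p _ => sum_nonneg fun b _ => hm p b) fun p _ => h p _) (hy a)
    _ = _ := by
        rw [mul_sum]; refine sum_congr rfl fun a _ => ?_
        rw [Finset.prod_mul_distrib]; ring
lemma pairs (f : (ι → α) → (ι → α) → ℝ) : ∑ c, ∑ c', f c c' = ∑ b : ι → α × α, f (fun p => (b p).1) (fun p => (b p).2) := by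
  rw [← Fintype.sum_prod_type']
  exact ((Equiv.arrowProdEquivProdArrow ι (fun _ => α) (fun _ => α)).sum_comp (fun x => f x.1 x.2)).symm
def Sub {γ : Type} (c' c : ι → Option γ) : Prop := ∀ p, c' p = c p ∨ c' p = none
lemma quad {γ : Type} [Fintype γ] [DecidableEq γ] {y : (ι → Option γ) → ℝ} {m : ι → Option γ → Option γ → ℝ} {ε : ι → ℝ} (hy : ∀ c, 0 ≤ y c)
    (hmono : ∀ c' c, Sub c' c → y c ≤ y c') (h1 : ∀ p, m p none none = 1) (h0 : ∀ p a, 0 ≤ m p a a)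
    (hε : ∀ p, ∑ x : Option γ × Option γ with x.1 ≠ x.2, |m p x.1 x.2| ≤ ε p) :
    |∑ c, ∑ c', y c * y c' * ∏ p, m p (c p) (c' p) - ∑ c, y c ^ 2 * ∏ p, m p (c p) (c p)| ≤
      (∏ p, (1 + ε p) - 1) * ∑ c, y c ^ 2 * ∏ p, m p (c p) (c p) := by
  set D := ∑ c, y c ^ 2 * ∏ p, m p (c p) (c p)
  have hε0 : ∀ p, 0 ≤ ε p := fun p => le_trans (sum_nonneg fun _ _ => abs_nonneg _) (hε p)
  have k1 : ∑ c, ∑ c', y c * y c' * ∏ p, |m p (c p) (c' p)| ≤ (∏ p, (1 + ε p)) * D := by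
    rw [pairs]
    refine coll (fun x : Option γ × Option γ => if x.1 = x.2 then x.1 else none) (m := fun p x => |m p x.1 x.2|)
      (y := fun c => y c ^ 2) (w := fun p a => m p a a) (fun p b => abs_nonneg _) (fun a => sq_nonneg _) (fun b => ?_) (fun p a => ?_)
    · rw [sq]
      refine mul_le_mul (hmono _ _ fun p => ?_) (hmono _ _ fun p => ?_) (hy _) (hy _) <;> split_ifs with h <;> simp [h]
    · have e2 : ∀ x : Option γ × Option γ, (if x.1 = x.2 then x.1 else none) = a → x ≠ (a,a) → a = none ∧ x.1 ≠ x.2 := by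
        rintro ⟨x, x'⟩ h hne
        split_ifs at h with h'
        · dsimp only at h'; subst h'; subst h; exact absurd rfl hne
        · exact ⟨h.symm, h'⟩
      have e1 : (univ.filter fun x : Option γ × Option γ => (if x.1 = x.2 then x.1 else none) = a) ⊆
         insert (a,a) (if a = none then univ.filter fun x : Option γ × Option γ => x.1 ≠ x.2 else ∅) := by
        intro x hx
        rw [Finset.mem_insert]
        by_cases hxa : x = (a,a)
        · exact Or.inl hxa
        · obtain ⟨h3, h4⟩ := e2 x (mem_filter.1 hx).2 hxa
          right; rw [if_pos h3]; simpa using h4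
      refine (sum_le_sum_of_subset_of_nonneg e1 fun _ _ _ => abs_nonneg _).trans ?_
      rw [sum_insert (by split_ifs <;> simp)]
      split_ifs with h
      · subst h; simp only [h1]; rw [abs_one]; linarith [hε p]
      · rw [sum_empty, add_zero, abs_of_nonneg (h0 p a)]
        nlinarith [h0 p a, hε0 p]
  have k2 : ∀ c c', |y c * y c' * ∏ p, m p (c p) (c' p)| = y c * y c' * ∏ p, |m p (c p) (c' p)| := fun c c' => by
    rw [abs_mul, Finset.abs_prod, abs_of_nonneg (mul_nonneg (hy _) (hy _))]
  have k3 : ∀ c, ∑ c', y c * y c' * ∏ p, m p (c p) (c' p) = y c ^ 2 * ∏ p, m p (c p) (c p) + ∑ c' ∈ univ.erase c, y c * y c' * ∏ p, m p (c p) (c' p) := fun c => by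
    rw [← add_sum_erase _ _ (Finset.mem_univ c), sq]
  have k4 : ∀ c, ∑ c', y c * y c' * ∏ p, |m p (c p) (c' p)| = y c ^ 2 * ∏ p, m p (c p) (c p) + ∑ c' ∈ univ.erase c, y c * y c' * ∏ p, |m p (c p) (c' p)| := fun c => by
    rw [← add_sum_erase _ _ (Finset.mem_univ c), sq, Finset.prod_congr rfl fun p _ => abs_of_nonneg (h0 p _)]
  rw [sum_congr rfl fun c _ => k3 c, sum_add_distrib, add_sub_cancel_left]
  rw [sum_congr rfl fun c _ => k4 c, sum_add_distrib] at k1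
  calc _ ≤ ∑ c, ∑ c' ∈ univ.erase c, |y c * y c' * ∏ p, m p (c p) (c' p)| :=
        (abs_sum_le_sum_abs _ _).trans (sum_le_sum fun c _ => abs_sum_le_sum_abs _ _)
    _ ≤ _ := by simp only [k2]; linarith
def oB (u : ι → ℝ) (r : ι → Bool) : ℝ := ∏ p, if r p then u p else 1
def oC {γ : Type} (u : ι → ℝ) (c : ι → Option γ) : ℝ := ∏ p, if (c p).isSome then u p else 1
def cls {γ : Type} [DecidableEq γ] (c : ι → Option γ) (j : γ) : ι → Bool := fun p => decide (c p = some j)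
lemma tuples {γ : Type} [Fintype γ] [DecidableEq γ] (g : γ → (ι → Bool) → ℝ) :
    ∏ j, ∑ r, g j r = ∑ b : ι → γ → Bool, ∏ j, g j (fun p => b p j) := by
  rw [Finset.prod_univ_sum, Fintype.piFinset_univ]
  exact ((Equiv.piComm (fun (_ : ι) (_ : γ) => Bool)).sum_comp (fun x => ∏ j, g j (x j))).symm
lemma oC_cls {γ : Type} [Fintype γ] [DecidableEq γ] (u : ι → ℝ) (c : ι → Option γ) : oC u c = ∏ j, oB u (cls c j) := by
  simp only [oC, oB, cls, decide_eq_true_eq]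
  rw [Finset.prod_comm]
  refine Finset.prod_congr rfl fun p _ => ?_
  cases h : c p with
  | none => simp
  | some i => simp
lemma up {γ : Type} [Fintype γ] [DecidableEq γ] {u : ι → ℝ} (hu : ∀ p, 0 ≤ u p) {g : γ → (ι → Bool) → ℝ} (hg : ∀ j r, 0 ≤ g j r) :
    ∑ c, (∏ j, g j (cls c j)) * oC u c ≤ ∏ j, ∑ r, g j r * oB u r := by
  rw [tuples]
  refine sum_le_inj (fun c p j => cls c j p) (fun _ _ => Finset.mem_univ _) ?_ ?_ ?_
  · intro c _ c' _ h
    funext p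
    have : ∀ j, c p = some j ↔ c' p = some j := fun j => by
      have := congrFun (congrFun h p) j
      simpa [cls] using this
    exact Option.ext this
  · intro c _
    rw [oC_cls, ← Finset.prod_mul_distrib]
  · intro b _
    exact Finset.prod_nonneg fun j _ => mul_nonneg (hg _ _) (Finset.prod_nonneg fun p _ => by split_ifs <;> [exact hu p; exact zero_le_one])
open Classical in
noncomputable def kc {γ : Type} (v : γ → Bool) : Option γ := if h : ∃ j, ∀ j', v j' = true ↔ j' = j then some h.choose else none
lemma kc_some {γ : Type} {v : γ → Bool} {j : γ} : kc v = some j ↔ ∀ j', v j' = true ↔ j' = j := by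
  unfold kc
  constructor
  · intro h
    split_ifs at h with h'
    rw [← Option.some.inj h]; exact h'.choose_spec
  · intro h
    have h' : ∃ j, ∀ j', v j' = true ↔ j' = j := ⟨j, h⟩
    rw [dif_pos h']
    congr 1
    exact ((h _).1 ((h'.choose_spec _).2 rfl))
lemma down {γ : Type} [Fintype γ] [DecidableEq γ] {u : ι → ℝ} (hu : ∀ p, 0 ≤ u p) (hk : ∀ p, Fintype.card γ * u p ≤ 1)
    {y : (ι → Option γ) → ℝ} {y' : (ι → γ → Bool) → ℝ} (hy : ∀ a, 0 ≤ y a) (hyy : ∀ b, y' b ≤ y (fun p => kc (b p))) :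
    ∑ b : ι → γ → Bool, y' b * ∏ j, oB u (fun p => b p j) ≤ (∏ p, (1 + (Fintype.card γ * u p)^2)) * ∑ c, y c * oC u c := by
  have e : ∀ b : ι → γ → Bool, ∏ j, oB u (fun p => b p j) = ∏ p, ∏ j, if b p j then u p else 1 := fun b => by
    unfold oB; rw [Finset.prod_comm]
  simp only [e]
  have hm : ∀ (p : ι) (v : γ → Bool), 0 ≤ ∏ j, if v j then u p else 1 := fun p v => Finset.prod_nonneg fun j _ => by
    split_ifs <;> [exact hu p; exact zero_le_one]
  refine coll (κ := kc) (m := fun p v => ∏ j, if v j then u p else 1) (w := fun p a => if a.isSome then u p else 1) hm hy hyy fun p a => ?_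
  have h1 : ∀ j, ∑ v with kc v = some j, ∏ j, (if v j then u p else 1) = u p := fun j => by
    have : (univ.filter fun v : γ → Bool => kc v = some j) = {fun j' => decide (j' = j)} := by
      ext v
      simp only [mem_filter, Finset.mem_univ, true_and, kc_some, Finset.mem_singleton, funext_iff]
      refine forall_congr' fun j' => ?_
      by_cases hj : j' = j <;> simp [hj]
    rw [this, sum_singleton]
    simp
  cases a with
  | some j =>
    rw [h1]; simp only [Option.isSome_some, if_true]
    nlinarith [hu p, mul_nonneg (sq_nonneg (Fintype.card γ * u p)) (hu p)]
  | none =>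
    have h2 : ∑ v : γ → Bool, ∏ j, (if v j then u p else 1) = (1 + u p)^(Fintype.card γ) := by
      have := Finset.prod_univ_sum (fun _ : γ => (univ : Finset Bool)) (fun _ x => if x then u p else 1)
      rw [Fintype.piFinset_univ] at this
      rw [← this]; simp [add_comm]
    rw [← sum_fiberwise univ (fun v : γ → Bool => kc v), Fintype.sum_option, sum_congr rfl fun j _ => h1 j, sum_const, nsmul_eq_mul, card_univ] at h2
    have h3 : (1 + u p)^(Fintype.card γ) ≤ exp (Fintype.card γ * u p) := by
      rw [exp_nat_mul]
      exact pow_le_pow_left₀ (by linarith [hu p]) (by linarith [add_one_le_exp (u p)]) _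
    have h4 := Real.abs_exp_sub_one_sub_id_le (x := Fintype.card γ * u p) (by rw [abs_of_nonneg (mul_nonneg (Nat.cast_nonneg _) (hu p))]; exact hk p)
    have := (abs_le.1 h4).2
    simp only [Option.isSome_none, Bool.false_eq_true, if_false]
    linarith
end comb
end BD
namespace BD
open Finset Topology
section may
variable {ι γ : Type} [Fintype ι] [DecidableEq ι] [Fintype γ] [DecidableEq γ]
def lam (lg : ι → ℝ) (r : ι → Bool) : ℝ := ∑ p, if r p then lg p else 0
open Classical in
noncomputable def FF (ρ : ℝ) (f : γ → ℝ → ℝ) (v : γ → ℝ) : ℝ := if ∑ j, v j ≤ ρ then ∏ j, f j (v j) else 0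
lemma FF_nonneg {ρ : ℝ} {f : γ → ℝ → ℝ} (hf : ∀ j x, 0 ≤ f j x) (v : γ → ℝ) : 0 ≤ FF ρ f v := by
  unfold FF; split_ifs
  · exact Finset.prod_nonneg fun j _ => hf _ _
  · exact le_rfl
lemma FF_mono {ρ : ℝ} {f : γ → ℝ → ℝ} (hf : ∀ j x, 0 ≤ f j x) (ha : ∀ j, Antitone (f j)) {v v' : γ → ℝ} (h : ∀ j, v' j ≤ v j) : FF ρ f v ≤ FF ρ f v' := by
  by_cases h1 : ∑ j, v j ≤ ρ
  · have h2 : ∑ j, v' j ≤ ρ := (sum_le_sum fun j _ => h j).trans h1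
    rw [FF, FF, if_pos h1, if_pos h2]
    exact Finset.prod_le_prod (fun j _ => hf _ _) fun j _ => ha j (h j)
  · rw [FF, if_neg h1]; exact FF_nonneg hf _
lemma lam_mono {lg : ι → ℝ} (hl : ∀ p, 0 ≤ lg p) {r r' : ι → Bool} (h : ∀ p, r p = true → r' p = true) : lam lg r ≤ lam lg r' := by
  refine sum_le_sum fun p _ => ?_
  split_ifs with h1 h2
  · exact le_rfl
  · exact absurd (h p h1) h2
  · exact hl p
  · exact le_rfl
lemma oB_nonneg {u : ι → ℝ} (hu : ∀ p, 0 ≤ u p) (r : ι → Bool) : 0 ≤ oB u r :=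
  Finset.prod_nonneg fun p _ => by split_ifs <;> [exact hu p; exact zero_le_one]
lemma oC_nonneg {u : ι → ℝ} (hu : ∀ p, 0 ≤ u p) (c : ι → Option γ) : 0 ≤ oC u c :=
  Finset.prod_nonneg fun p _ => by split_ifs <;> [exact hu p; exact zero_le_one]
lemma markov {lg : ι → ℝ} (hl : ∀ p, 0 ≤ lg p) {g : γ → (ι → Bool) → ℝ} (hg : ∀ j r, 0 ≤ g j r) {μ : γ → ℝ}
    (hμ : ∀ j, ∑ r, g j r * lam lg r ≤ μ j * ∑ r, g j r) {ρ : ℝ} (hρ : 0 < ρ) (h : ∑ j, μ j ≤ ρ/2) :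
    1/2 * ∏ j, ∑ r, g j r ≤ ∑ b : ι → γ → Bool, (if ∑ j, lam lg (fun p => b p j) ≤ ρ then ∏ j, g j (fun p => b p j) else 0) := by
  set PI := ∏ j, ∑ r, g j r
  have hI : ∀ j, 0 ≤ ∑ r, g j r := fun j => sum_nonneg fun r _ => hg j r
  have hP : 0 ≤ PI := Finset.prod_nonneg fun j _ => hI j
  have hlam : ∀ r, 0 ≤ lam lg r := fun r => sum_nonneg fun p _ => by split_ifs <;> [exact hl p; exact le_rfl]
  have h1 : ∀ i, ∑ b : ι → γ → Bool, lam lg (fun p => b p i) * ∏ j, g j (fun p => b p j) ≤ μ i * PI := fun i => by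
    calc _ = ∑ b : ι → γ → Bool, ∏ j, (g j (fun p => b p j) * if j = i then lam lg (fun p => b p j) else 1) := by
          refine sum_congr rfl fun b _ => ?_
          rw [Finset.prod_mul_distrib, Finset.prod_ite_eq' univ i, if_pos (Finset.mem_univ i), mul_comm]
      _ = ∏ j, ∑ r, (g j r * if j = i then lam lg r else 1) := (tuples fun j r => g j r * if j = i then lam lg r else 1).symm
      _ ≤ ∏ j, ((if j = i then μ j else 1) * ∑ r, g j r) := by
          refine Finset.prod_le_prod (fun j _ => sum_nonneg fun r _ => mul_nonneg (hg _ _) (by split_ifs <;> [exact hlam r; exact zero_le_one])) fun j _ => ?_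
          split_ifs with hj
          · exact hμ j
          · simp
      _ = _ := by rw [Finset.prod_mul_distrib, Finset.prod_ite_eq' univ i, if_pos (Finset.mem_univ i)]
  have h2 : ∑ b : ι → γ → Bool, (∑ j, lam lg (fun p => b p j)) * ∏ j, g j (fun p => b p j) ≤ (∑ j, μ j) * PI := by
    simp only [sum_mul]
    rw [sum_comm]
    exact sum_le_sum fun i _ => h1 i
  calc 1/2 * PI ≤ PI - (∑ b : ι → γ → Bool, (∑ j, lam lg (fun p => b p j)) * ∏ j, g j (fun p => b p j)) / ρ := by
        have : (∑ b : ι → γ → Bool, (∑ j, lam lg (fun p => b p j)) * ∏ j, g j (fun p => b p j)) / ρ ≤ 1/2 * PI := by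
          rw [div_le_iff₀ hρ]
          nlinarith [mul_le_mul_of_nonneg_right h hP]
        linarith
    _ = ∑ b : ι → γ → Bool, (1 - (∑ j, lam lg (fun p => b p j))/ρ) * ∏ j, g j (fun p => b p j) := by
        rw [show PI = _ from tuples g, sum_div, ← sum_sub_distrib]
        exact sum_congr rfl fun b _ => by ring
    _ ≤ _ := by
        refine sum_le_sum fun b _ => ?_
        have h3 : 0 ≤ ∏ j, g j (fun p => b p j) := Finset.prod_nonneg fun j _ => hg _ _
        have h4 : 0 ≤ ∑ j, lam lg (fun p => b p j) := sum_nonneg fun j _ => hlam _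
        split_ifs with h5
        · have : 0 ≤ (∑ j, lam lg (fun p => b p j))/ρ := by positivity
          nlinarith
        · push Not at h5
          have : 1 ≤ (∑ j, lam lg (fun p => b p j))/ρ := by rw [one_le_div hρ]; exact h5.le
          nlinarith
lemma Sub_lam {lg : ι → ℝ} (hl : ∀ p, 0 ≤ lg p) {c' c : ι → Option γ} (h : Sub c' c) (j : γ) : lam lg (cls c' j) ≤ lam lg (cls c j) := by
  refine lam_mono hl fun p hp => ?_
  simp only [cls, decide_eq_true_eq] at hp ⊢
  rcases h p with h | h
  · rw [← h, hp]
  · rw [h] at hp; cases hp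
noncomputable def yy (lg : ι → ℝ) (ρ : ℝ) (G : ℝ → ℝ) (c : ι → Option γ) : ℝ := FF ρ (fun _ => G) fun j => lam lg (cls c j)
lemma S1abs {lg u ε : ι → ℝ} {ρ : ℝ} {G : ℝ → ℝ} {m : ι → Option γ → Option γ → ℝ} (hl : ∀ p, 0 ≤ lg p) (hu : ∀ p, 0 ≤ u p) (hG : ∀ x, 0 ≤ G x) (ha : Antitone G)
    (h1 : ∀ p, m p none none = 1) (h0 : ∀ p j, m p (some j) (some j) = u p)
    (hε : ∀ p, ∑ x : Option γ × Option γ with x.1 ≠ x.2, |m p x.1 x.2| ≤ ε p) (he : ∏ p, (1 + ε p) ≤ 3/2) :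
    ∑ c, ∑ c', yy lg ρ G c * yy lg ρ G c' * ∏ p, m p (c p) (c' p) ≤ 3/2 * (∑ r, G (lam lg r)^2 * oB u r)^(Fintype.card γ) := by
  have hm : ∀ p a, m p a a = if a.isSome then u p else 1 := fun p a => by cases a <;> simp [h1, h0]
  have hq := quad (y := yy lg ρ G) (fun c => FF_nonneg (fun _ => hG) _) (fun c' c h => FF_mono (fun _ => hG) (fun _ => ha) fun j => Sub_lam hl h j) h1
    (fun p a => by rw [hm]; split_ifs <;> [exact hu p; exact zero_le_one]) hε
  have hD : ∑ c, yy lg ρ G c ^ 2 * ∏ p, m p (c p) (c p) ≤ (∑ r, G (lam lg r)^2 * oB u r)^(Fintype.card γ) := by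
    calc _ ≤ ∑ c : ι → Option γ, (∏ j, G (lam lg (cls c j))^2) * oC u c := by
          refine sum_le_sum fun c _ => ?_
          simp only [hm]
          refine mul_le_mul_of_nonneg_right ?_ (oC_nonneg hu c)
          rw [Finset.prod_pow]
          refine pow_le_pow_left₀ (FF_nonneg (fun _ => hG) _) ?_ _
          unfold FF; split_ifs
          · exact le_rfl
          · exact Finset.prod_nonneg fun j _ => hG _
      _ ≤ _ := (up hu (g := fun _ r => G (lam lg r)^2) fun _ _ => sq_nonneg _).trans (by rw [Finset.prod_const, card_univ])
  have h3 := (abs_le.1 hq).2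
  have hD0 : 0 ≤ ∑ c, yy lg ρ G c ^ 2 * ∏ p, m p (c p) (c p) := sum_nonneg fun c _ => mul_nonneg (sq_nonneg _) (Finset.prod_nonneg fun p _ => by
    rw [hm]; split_ifs <;> [exact hu p; exact zero_le_one])
  nlinarith
def ke (i : γ) (a : Option γ) : Option γ := if a = some i then none else a
def YY (y : (ι → Option γ) → ℝ) (u : ι → ℝ) (i : γ) (s : ι → Option γ) : ℝ :=
  ∑ c with (fun p => ke i (c p)) = s, y c * ∏ p, if c p = some i then u p else 1
lemma ke_some {i j : γ} {a : Option γ} : ke i a = some j ↔ a = some j ∧ j ≠ i := by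
  unfold ke; split_ifs with h
  · subst h; simp only [false_iff, reduceCtorEq, Option.some.injEq]; rintro ⟨h, h'⟩; exact h' h.symm
  · exact ⟨fun h' => ⟨h', fun e => h (e ▸ h')⟩, fun h' => h'.1⟩
lemma w_nonneg {u : ι → ℝ} (hu : ∀ p, 0 ≤ u p) (i : γ) (c : ι → Option γ) : 0 ≤ ∏ p, (if c p = some i then u p else 1) :=
  Finset.prod_nonneg fun p _ => by split_ifs <;> [exact hu p; exact zero_le_one]
lemma YY_mono {y : (ι → Option γ) → ℝ} {u : ι → ℝ} (hu : ∀ p, 0 ≤ u p) (hy : ∀ c, 0 ≤ y c) (hmono : ∀ c' c, Sub c' c → y c ≤ y c') (i : γ)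
    (s' s : ι → Option γ) (h : Sub s' s) : YY y u i s ≤ YY y u i s' := by
  refine sum_le_inj (fun c p => if s' p = s p then c p else none) ?_ ?_ ?_ ?_
  · intro c hc
    have hc := (mem_filter.1 hc).2
    refine mem_filter.2 ⟨Finset.mem_univ _, funext fun p => ?_⟩
    have hp := congrFun hc p
    beta_reduce
    split_ifs with h1
    · rw [hp, h1]
    · rw [(h p).resolve_left h1]; simp [ke]
  · intro c hc c' hc' e
    have hc := (mem_filter.1 hc).2
    have hc' := (mem_filter.1 hc').2
    funext p
    have hp := congrFun e p
    split_ifs at hp with h1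
    · exact hp
    · have h2 := (h p).resolve_left h1
      obtain ⟨j, hj⟩ := Option.ne_none_iff_exists'.1 (fun h3 : s p = none => h1 (h2.trans h3.symm))
      have a1 := congrFun hc p
      have a2 := congrFun hc' p
      rw [hj] at a1 a2
      rw [(ke_some.1 a1).1, (ke_some.1 a2).1]
  · intro c hc
    have hc := (mem_filter.1 hc).2
    have e : ∏ p, (if c p = some i then u p else 1) = ∏ p, (if (if s' p = s p then c p else none) = some i then u p else 1) := by
      refine Finset.prod_congr rfl fun p _ => ?_
      by_cases h1 : s' p = s p
      · simp only [h1, if_true]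
      · have h2 := (h p).resolve_left h1
        obtain ⟨j, hj⟩ := Option.ne_none_iff_exists'.1 (fun h3 : s p = none => h1 (h2.trans h3.symm))
        have a1 := congrFun hc p
        rw [hj] at a1
        simp only [h1, if_false, reduceCtorEq, (ke_some.1 a1).1, Option.some.injEq, (ke_some.1 a1).2]
    rw [← e]
    refine mul_le_mul_of_nonneg_right (hmono _ _ fun p => ?_) (w_nonneg hu i c)
    by_cases h1 : s' p = s p <;> simp [h1]
  · intro c _
    exact mul_nonneg (hy _) (w_nonneg hu i c)
lemma YY_sum (y : (ι → Option γ) → ℝ) (u : ι → ℝ) (i : γ) (Q : (ι → Option γ) → ℝ) :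
    ∑ s, YY y u i s * Q s = ∑ c, y c * (∏ p, if c p = some i then u p else 1) * Q (fun p => ke i (c p)) := by
  conv_rhs => rw [← sum_fiberwise univ (fun (c : ι → Option γ) p => ke i (c p))]
  refine sum_congr rfl fun s _ => ?_
  unfold YY; rw [sum_mul]
  exact sum_congr rfl fun c hc => by rw [(mem_filter.1 hc).2]
lemma YY_ne {y : (ι → Option γ) → ℝ} {u : ι → ℝ} {i : γ} {s : ι → Option γ} (h : YY y u i s ≠ 0) (p : ι) : s p ≠ some i := by
  obtain ⟨c, hc, _⟩ := Finset.exists_ne_zero_of_sum_ne_zero h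
  rw [← (mem_filter.1 hc).2]
  intro h; exact (ke_some.1 h).2 rfl
lemma S2abs {lg u ε : ι → ℝ} {ρ : ℝ} {G : ℝ → ℝ} {m m' : ι → Option γ → Option γ → ℝ} (i : γ) (hl : ∀ p, 0 ≤ lg p) (hu : ∀ p, 0 ≤ u p) (hG : ∀ x, 0 ≤ G x) (ha : Antitone G)
    (hmm : ∀ p a b, m p a b = (if a = some i then u p else 1) * (if b = some i then u p else 1) * m' p (ke i a) (ke i b))
    (h1 : ∀ p, m' p none none = 1) (h0 : ∀ p j, j ≠ i → u p ≤ m' p (some j) (some j)) (h00 : ∀ p, 0 ≤ m' p (some i) (some i))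
    (hε : ∀ p, ∑ x : Option γ × Option γ with x.1 ≠ x.2, |m' p x.1 x.2| ≤ ε p) (he : ∏ p, (1 + ε p) ≤ 3/2)
    (hk : ∀ p, Fintype.card γ * u p ≤ 1) (he2 : ∏ p, (1 + (Fintype.card γ * u p)^2) ≤ 3/2)
    {I1 I2 μ1 μ2 : ℝ} (hI1 : I1 = ∑ r, G (lam lg r) * oB u r) (hI2 : I2 = ∑ r, G (lam lg r)^2 * oB u r) (hI2p : 0 < I2)
    (hμ1 : ∑ r, G (lam lg r) * oB u r * lam lg r ≤ μ1 * I1) (hμ2 : ∑ r, G (lam lg r)^2 * oB u r * lam lg r ≤ μ2 * I2)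
    (hμ : μ1 + Fintype.card γ * μ2 ≤ ρ/2) (hμ0 : 0 ≤ μ2) (hρ : 0 < ρ) :
    1/18 * I1^2 * I2^(Fintype.card γ - 1) ≤ ∑ c, ∑ c', yy lg ρ G c * yy lg ρ G c' * ∏ p, m p (c p) (c' p) := by
  set y : (ι → Option γ) → ℝ := yy lg ρ G with hy
  set Y := YY y u i with hY
  have y0 : ∀ c, 0 ≤ y c := fun c => FF_nonneg (fun _ => hG) _
  have ym : ∀ c' c, Sub c' c → y c ≤ y c' := fun c' c h => FF_mono (fun _ => hG) (fun _ => ha) fun j => Sub_lam hl h j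
  have Y0 : ∀ s, 0 ≤ Y s := fun s => sum_nonneg fun c _ => mul_nonneg (y0 c) (w_nonneg hu i c)
  have hm0 : ∀ p a, 0 ≤ m' p a a := fun p a => by
    cases a with
    | none => rw [h1]; exact zero_le_one
    | some j =>
      by_cases hj : j = i
      · rw [hj]; exact h00 p
      · exact (hu p).trans (h0 p j hj)
  have hoB := oB_nonneg hu
  have hI1p : 0 ≤ I1 := hI1 ▸ sum_nonneg fun r _ => mul_nonneg (hG _) (hoB r)
  have e1 : ∑ c, ∑ c', y c * y c' * ∏ p, m p (c p) (c' p) = ∑ s, ∑ s', Y s * Y s' * ∏ p, m' p (s p) (s' p) := by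
    have f1 : ∀ s, ∑ s', Y s * Y s' * ∏ p, m' p (s p) (s' p) = Y s * ∑ s', Y s' * ∏ p, m' p (s p) (s' p) := fun s => by
      rw [mul_sum]; exact sum_congr rfl fun _ _ => by ring
    rw [sum_congr rfl fun s _ => f1 s, hY, YY_sum]
    refine sum_congr rfl fun c _ => ?_
    rw [YY_sum, mul_sum]
    refine sum_congr rfl fun c' _ => ?_
    simp only [hmm, Finset.prod_mul_distrib]
    ring
  have q := quad Y0 (YY_mono hu y0 ym i) h1 hm0 hε
  have hD : ∑ s, Y s ^ 2 * oC u s ≤ ∑ s, Y s ^ 2 * ∏ p, m' p (s p) (s p) := by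
    refine sum_le_sum fun s _ => ?_
    by_cases hs : Y s = 0
    · rw [hs]; simp
    refine mul_le_mul_of_nonneg_left (Finset.prod_le_prod (fun p _ => by split_ifs <;> [exact hu p; exact zero_le_one]) fun p _ => ?_) (sq_nonneg _)
    have := YY_ne hs p
    cases h : s p with
    | none => simp [h1]
    | some j =>
      simp only [Option.isSome_some, if_true]
      exact h0 p j fun e => this (by rw [h, e])
  have hD0 : 0 ≤ ∑ s, Y s ^ 2 * oC u s := sum_nonneg fun s _ => mul_nonneg (sq_nonneg _) (oC_nonneg hu s)
  set gz : γ → (ι → Bool) → ℝ := fun j r => if j = i then (if r = fun _ => false then 1 else 0) else G (lam lg r) with hgz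
  set Z : (ι → Option γ) → ℝ := fun s => ∏ j, gz j (cls s j) with hZ
  have hpi : ∀ x y : ℝ, ∏ j, (if j = i then x else y) = x * y^(Fintype.card γ - 1) := fun x y => by
    rw [← Finset.mul_prod_erase univ _ (Finset.mem_univ i), if_pos rfl,
      Finset.prod_congr rfl (fun j hj => if_neg (Finset.ne_of_mem_erase hj)), Finset.prod_const, card_erase_of_mem (Finset.mem_univ i), card_univ]
  have z1 : ∑ s, Z s ^ 2 * oC u s ≤ I2^(Fintype.card γ - 1) := by
    calc _ = ∑ s : ι → Option γ, (∏ j, gz j (cls s j)^2) * oC u s := by simp only [hZ, Finset.prod_pow]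
      _ ≤ ∏ j, ∑ r, gz j r ^2 * oB u r := up hu (g := fun j r => gz j r ^ 2) fun _ _ => sq_nonneg _
      _ = ∏ j, (if j = i then 1 else I2) := by
          refine Finset.prod_congr rfl fun j _ => ?_
          by_cases hj : j = i
          · simp only [hgz, hj, if_true]
            rw [sum_eq_single (fun _ => false)]
            · simp [oB]
            · intro b _ hb; simp [hb]
            · simp
          · simp only [hgz, hj, if_false]; exact hI2.symm
      _ = _ := by rw [hpi, one_mul]
  have cs : (∑ s, Y s * (Z s * oC u s))^2 ≤ (∑ s, Y s ^ 2 * oC u s) * ∑ s, Z s ^ 2 * oC u s := by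
    refine sum_sq_le_sum_mul_sum_of_sq_eq_mul _ (fun s _ => mul_nonneg (sq_nonneg _) (oC_nonneg hu s)) (fun s _ => mul_nonneg (sq_nonneg _) (oC_nonneg hu s)) fun s _ => ?_
    ring
  set f : γ → ℝ → ℝ := fun j x => G x * if j = i then 1 else G x with hf
  have f0 : ∀ j x, 0 ≤ f j x := fun j x => mul_nonneg (hG x) (by split_ifs <;> [exact zero_le_one; exact hG x])
  have fa : ∀ j, Antitone (f j) := fun j x x' hx => by
    simp only [hf]; split_ifs
    · simpa using ha hx
    · exact mul_le_mul (ha hx) (ha hx) (hG _) (hG _)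
  have c1 : ∑ s, Y s * (Z s * oC u s) = ∑ c, FF ρ f (fun j => lam lg (cls c j)) * oC u c := by
    rw [hY, YY_sum]
    refine sum_congr rfl fun c _ => ?_
    have a1 : (∏ p, if c p = some i then u p else 1) * oC u (fun p => ke i (c p)) = oC u c := by
      simp only [oC]
      rw [← Finset.prod_mul_distrib]
      refine Finset.prod_congr rfl fun p _ => ?_
      by_cases h : c p = some i <;> simp [ke, h]
    have a2 : y c * Z (fun p => ke i (c p)) = FF ρ f (fun j => lam lg (cls c j)) := by
      rw [hy]; unfold yy FF
      split_ifs
      · rw [hZ, ← Finset.prod_mul_distrib]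
        refine Finset.prod_congr rfl fun j _ => ?_
        simp only [hgz, hf]
        by_cases hj : j = i
        · have : cls (fun p => ke i (c p)) j = fun _ => false := by
            funext p; simp [cls, ke_some, hj]
          rw [if_pos hj, if_pos hj, if_pos this]
        · have : cls (fun p => ke i (c p)) j = cls c j := by
            funext p; simp [cls, ke_some, hj]
          rw [if_neg hj, if_neg hj, this]
      · rw [zero_mul]
    rw [← a1, ← a2]; ring
  have c2 : 1/2 * (I1 * I2^(Fintype.card γ - 1)) ≤ 3/2 * ∑ s, Y s * (Z s * oC u s) := by
    have mk := markov hl (g := fun j r => f j (lam lg r) * oB u r) (fun j r => mul_nonneg (f0 _ _) (hoB r)) (μ := fun j => if j = i then μ1 else μ2) (fun j => by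
      simp only [hf]
      split_ifs
      · simp only [mul_one]; rw [← hI1]; exact hμ1
      · simp only [← sq]; rw [← hI2]; exact hμ2) hρ (by
        refine le_trans ?_ hμ
        calc ∑ j, (if j = i then μ1 else μ2) ≤ ∑ j, ((if j = i then μ1 else 0) + μ2) := sum_le_sum fun j _ => by split_ifs <;> linarith
          _ = _ := by rw [sum_add_distrib, sum_ite_eq' univ i, if_pos (Finset.mem_univ i), sum_const, nsmul_eq_mul, card_univ])
    have d := down (γ := γ) hu hk (y := fun c => FF ρ f (fun j => lam lg (cls c j))) (y' := fun b => FF ρ f fun j => lam lg (fun p => b p j))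
      (fun c => FF_nonneg f0 _) (fun b => FF_mono f0 fa fun j => lam_mono hl fun p hp => by
        simp only [cls, decide_eq_true_eq, kc_some] at hp
        exact (hp j).2 rfl)
    have a1 : ∏ j, ∑ r, f j (lam lg r) * oB u r = I1 * I2^(Fintype.card γ - 1) := by
      rw [← hpi]
      refine Finset.prod_congr rfl fun j _ => ?_
      simp only [hf]
      split_ifs
      · simp only [mul_one]; rw [← hI1]
      · simp only [← sq]; rw [← hI2]
    rw [a1] at mk
    rw [c1]
    refine mk.trans ((le_of_eq ?_).trans (d.trans (mul_le_mul_of_nonneg_right he2 (sum_nonneg fun c _ => mul_nonneg (FF_nonneg f0 _) (oC_nonneg hu c)))))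
    refine sum_congr rfl fun b _ => ?_
    unfold FF
    split_ifs
    · rw [Finset.prod_mul_distrib]
    · rw [zero_mul]
  set V := ∑ s, Y s * (Z s * oC u s)
  set D := ∑ s, Y s ^ 2 * oC u s
  set T := I2^(Fintype.card γ - 1)
  have hT : 0 < T := by positivity
  have b1 : (I1 * T)^2 ≤ 9 * (D * T) := by
    have : I1 * T ≤ 3 * V := by linarith
    have h2 : D * ∑ s, Z s ^ 2 * oC u s ≤ D * T := mul_le_mul_of_nonneg_left z1 hD0
    have h3 : (I1 * T)^2 ≤ (3 * V)^2 := pow_le_pow_left₀ (by positivity) this 2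
    nlinarith
  have b2 : I1^2 * T ≤ 9 * D := by
    have : (I1^2 * T) * T ≤ (9 * D) * T := by nlinarith
    exact le_of_mul_le_mul_right this hT
  rw [e1]
  have := (abs_le.1 q).1
  nlinarith
end may
end BD
namespace BD
open Finset Topology
lemma modEq_prod {T : Finset ℕ} (hT : Prm T) {a b : ℕ} : a ≡ b [MOD ∏ p ∈ T, p] ↔ ∀ p ∈ T, a % p = b % p := by
  constructor
  · exact fun h p hp => h.of_dvd (Finset.dvd_prod_of_mem _ hp)
  · intro h
    rw [Nat.modEq_iff_dvd, Nat.cast_prod]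
    refine Finset.prod_dvd_of_coprime (fun p hp q hq hpq => ?_) fun p hp => Nat.modEq_iff_dvd.1 (h p hp)
    exact Nat.isCoprime_iff_coprime.2 ((Nat.coprime_primes (hT p hp) (hT q hq)).2 hpq)
lemma crt {T N : Finset ℕ} (hT : Prm T) {a : ℕ → ℝ} {B : ℕ → Finset ℕ} (hB : ∀ p ∈ T, B p ⊆ Finset.range p) {f : ℕ → ℕ → ℝ}
    (hper : ∀ p ∈ T, ∀ n, f p n = f p (n % p)) {X E : ℝ} (hsupp : ∀ n ∈ N, a n ≠ 0 → ∀ p ∈ T, n % p ∈ B p)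
    (heq : ∀ b, (∀ p ∈ T, b % p ∈ B p) → |∑ n ∈ N with n ≡ b [MOD ∏ p ∈ T, p], a n - X / ∏ p ∈ T, (#(B p) : ℝ)| ≤ E) :
    |∑ n ∈ N, a n * ∏ p ∈ T, f p n - X * ∏ p ∈ T, ((∑ b ∈ B p, f p b) / #(B p))| ≤ E * ∏ p ∈ T, ∑ b ∈ B p, |f p b| := by
  have h1 : ∀ β ∈ T.pi B, ∃ b : ℕ, ∀ p (hp : p ∈ T), b % p = β p hp := by
    intro β hβ
    have pp : Set.Pairwise (T : Set ℕ) (Function.onFun Nat.Coprime (fun p : ℕ => p)) := fun p hp q hq hpq => (Nat.coprime_primes (hT p hp) (hT q hq)).2 hpq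
    obtain ⟨b, hb⟩ := Nat.chineseRemainderOfFinset (fun p => if h : p ∈ T then β p h else 0) (fun p => p) T (fun p hp => (hT p hp).ne_zero) pp
    refine ⟨b, fun p hp => ?_⟩
    have := hb p hp
    rw [dif_pos hp] at this
    rw [this, Nat.mod_eq_of_lt]
    exact Finset.mem_range.1 (hB p hp (Finset.mem_pi.1 hβ p hp))
  choose! bb hbb using h1
  have h2 : ∀ n ∈ N, a n * ∏ p ∈ T, f p n = ∑ β ∈ T.pi B, (∏ x ∈ T.attach, f x.1 (β x.1 x.2)) * if n ≡ bb β [MOD ∏ p ∈ T, p] then a n else 0 := by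
    intro n hn
    by_cases ha : a n = 0
    · simp [ha]
    have e1 : ∏ p ∈ T, f p n = ∏ p ∈ T, ∑ b ∈ B p, if n % p = b then f p b else 0 := by
      refine Finset.prod_congr rfl fun p hp => ?_
      rw [Finset.sum_ite_eq, if_pos (hsupp n hn ha p hp), hper p hp]
    rw [e1, Finset.prod_sum, mul_sum]
    refine sum_congr rfl fun β hβ => ?_
    rw [Finset.prod_ite_zero]
    have : (n ≡ bb β [MOD ∏ p ∈ T, p]) ↔ ∀ x ∈ T.attach, n % x.1 = β x.1 x.2 := by
      rw [modEq_prod hT]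
      exact ⟨fun h x _ => (h x.1 x.2).trans (hbb β hβ _ _), fun h p hp => (h ⟨p, hp⟩ (Finset.mem_attach _ _)).trans (hbb β hβ _ _).symm⟩
    by_cases hc : n ≡ bb β [MOD ∏ p ∈ T, p]
    · rw [if_pos hc, if_pos (this.1 hc), mul_comm]
    · rw [if_neg hc, if_neg (fun h => hc (this.2 h))]; ring
  rw [sum_congr rfl h2, sum_comm, Finset.prod_div_distrib, Finset.prod_sum, Finset.prod_sum, ← mul_div_assoc, mul_div_right_comm X, mul_sum, mul_sum, ← sum_sub_distrib]
  refine (abs_sum_le_sum_abs _ _).trans (sum_le_sum fun β hβ => ?_)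
  rw [← mul_sum, ← sum_filter, mul_comm (X / _), ← mul_sub, abs_mul, Finset.abs_prod, mul_comm]
  refine mul_le_mul_of_nonneg_right (heq _ fun p hp => ?_) (Finset.prod_nonneg fun _ _ => abs_nonneg _)
  rw [hbb β hβ p hp]; exact Finset.mem_pi.1 hβ p hp
open Classical in
noncomputable def xi {k : ℕ} (h : Fin k → ℤ) (p : ℕ) (a : Option (Fin k)) (n : ℤ) : ℝ := match a with
  | none => 1
  | some j => if (p:ℤ) ∣ n + h j then -1 else 1/((p:ℝ)-1)
noncomputable def mm {k : ℕ} (h : Fin k → ℤ) (B : ℕ → Finset ℕ) (p : ℕ) (a b : Option (Fin k)) : ℝ := (∑ n ∈ B p, xi h p a n * xi h p b n) / #(B p)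
def ex {k : ℕ} {P : Finset ℕ} (c : P → Option (Fin k)) (p : ℕ) : Option (Fin k) := if h : p ∈ P then c ⟨p, h⟩ else none
def sp {k : ℕ} {P : Finset ℕ} (c : P → Option (Fin k)) : Finset ℕ := P.filter fun p => ex c p ≠ none
noncomputable def AA {k : ℕ} {P : Finset ℕ} (h : Fin k → ℤ) (y : (P → Option (Fin k)) → ℝ) (n : ℤ) : ℝ := ∑ c, y c * ∏ p : P, xi h p (c p) n
lemma ex_coe {k : ℕ} {P : Finset ℕ} (c : P → Option (Fin k)) (p : P) : ex c p = c p := by simp [ex]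
lemma xi_mod {k : ℕ} (h : Fin k → ℤ) (p : ℕ) (a : Option (Fin k)) (n : ℕ) : xi h p a n = xi h p a ((n % p : ℕ) : ℤ) := by
  cases a with
  | none => rfl
  | some j =>
    have : ((p:ℤ) ∣ (n:ℤ) + h j) ↔ ((p:ℤ) ∣ ((n % p : ℕ):ℤ) + h j) := by
      rw [Int.natCast_mod, show (n:ℤ) + h j = ((n:ℤ) % p + h j) + p * ((n:ℤ) / p) by linarith [Int.emod_add_mul_ediv (n:ℤ) p]]
      exact Int.dvd_add_left (Dvd.intro _ rfl)
    simp only [xi, this]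
lemma xi_le {k : ℕ} (h : Fin k → ℤ) {p : ℕ} (hp : p.Prime) (a : Option (Fin k)) (n : ℤ) : |xi h p a n| ≤ 1 := by
  have := p_sub hp
  unfold xi; split
  · simp
  · split_ifs
    · simp
    · rw [abs_of_nonneg (by positivity), div_le_one (by linarith)]; exact this
lemma expand {k D : ℕ} {P N : Finset ℕ} (hP : Prm P) (hD : Disjoint (PP 0 D) P) {R : ℝ} (h : Fin k → ℤ) {y : (P → Option (Fin k)) → ℝ} (y0 : ∀ c, 0 ≤ y c) (y1 : ∀ c, y c ≤ 1)
    (yR : ∀ c, y c ≠ 0 → ((∏ p ∈ sp c, p : ℕ):ℝ) ≤ R) {a : ℕ → ℝ} {B : ℕ → Finset ℕ} (hB : ∀ p, B p ⊆ Finset.range p) (hB0 : ∀ p, p.Prime → 1 ∈ B p)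
    {X : ℝ} {E : Finset ℕ → ℝ} (E0 : ∀ S, 0 ≤ E S) (hsupp : ∀ n ∈ N, a n ≠ 0 → ∀ p ∈ PP 0 D ∪ P, n % p ∈ B p)
    (hloc : ∀ p ∈ P, ∀ j, ∑ n ∈ B p, |xi h p (some j) n| ≤ 2)
    (heq : ∀ S ∈ pw P (R*R), ∀ b, (∀ p ∈ PP 0 D ∪ S, b % p ∈ B p) → |∑ n ∈ N with n ≡ b [MOD ∏ p ∈ PP 0 D ∪ S, p], a n - X / ∏ p ∈ PP 0 D ∪ S, (#(B p) : ℝ)| ≤ E S) :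
    |∑ n ∈ N with n ≡ 1 [MOD ∏ p ∈ PP 0 D, p], a n * AA h y n ^ 2 - X / (∏ p ∈ PP 0 D, (#(B p):ℝ)) * ∑ c, ∑ c', y c * y c' * ∏ p : P, mm h B p (c p) (c' p)| ≤
      ∑ S ∈ pw P (R*R), (2 * (k+1)^2 : ℕ)^(#S) * E S := by
  classical
  set f : (P → Option (Fin k)) → (P → Option (Fin k)) → ℕ → ℕ → ℝ := fun c c' p n => if p ∈ P then xi h p (ex c p) n * xi h p (ex c' p) n else if n % p = 1 % p then 1 else 0 with hf
  set S : (P → Option (Fin k)) → (P → Option (Fin k)) → Finset ℕ := fun c c' => sp c ∪ sp c' with hS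
  have hSP : ∀ c c', S c c' ⊆ P := fun c c' => union_subset (filter_subset _ _) (filter_subset _ _)
  have hdis : ∀ c c', Disjoint (PP 0 D) (S c c') := fun c c' => hD.mono_right (hSP c c')
  have hDP : ∀ p ∈ PP 0 D, p ∉ P := fun p hp hp' => Finset.disjoint_left.1 hD hp hp'
  have hSn : ∀ c c', ∀ p ∈ P, p ∉ S c c' → ex c p = none ∧ ex c' p = none := fun c c' p hp hp' => by
    simp only [hS, Finset.mem_union, sp, mem_filter, hp, true_and, not_or, not_not] at hp'; exact hp'
  -- product over a product set
  have hprod : ∀ c c' (F : ℕ → Option (Fin k) → Option (Fin k) → ℝ), (∀ p ∈ P, F p none none = 1) → ∏ p : P, F p (c p) (c' p) = ∏ p ∈ S c c', F p (ex c p) (ex c' p) := by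
    intro c c' F hF
    rw [Finset.prod_subset (hSP c c') (fun p hp hp' => by rw [(hSn c c' p hp hp').1, (hSn c c' p hp hp').2, hF p hp]), ← Finset.prod_coe_sort P]
    exact Finset.prod_congr rfl fun p _ => by rw [ex_coe, ex_coe]
  have e1 : ∑ n ∈ N with n ≡ 1 [MOD ∏ p ∈ PP 0 D, p], a n * AA h y n ^ 2 = ∑ c, ∑ c', y c * y c' * ∑ n ∈ N, a n * ∏ p ∈ PP 0 D ∪ S c c', f c c' p n := by
    have : ∀ n ∈ N, (if n ≡ 1 [MOD ∏ p ∈ PP 0 D, p] then a n * AA h y n ^ 2 else 0) = ∑ c, ∑ c', y c * y c' * (a n * ∏ p ∈ PP 0 D ∪ S c c', f c c' p n) := by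
      intro n _
      have g1 : ∀ c c', ∏ p ∈ PP 0 D ∪ S c c', f c c' p n = (if n ≡ 1 [MOD ∏ p ∈ PP 0 D, p] then 1 else 0) * ((∏ p : P, xi h p (c p) n) * ∏ p : P, xi h p (c' p) n) := by
        intro c c'
        rw [Finset.prod_union (hdis c c'), ← Finset.prod_mul_distrib, hprod c c' (fun p a b => xi h p a n * xi h p b n) (fun p _ => by simp [xi])]
        congr 1
        · rw [Finset.prod_congr rfl (g := fun p => if n % p = 1 % p then (1:ℝ) else 0) (fun p hp => by simp only [hf, hDP p hp, if_false]), Finset.prod_ite_zero, Finset.prod_const_one]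
          simp only [modEq_prod (PP_prm 0 D)]
        · exact Finset.prod_congr rfl fun p hp => by simp only [hf, hSP c c' hp, if_true]
      simp only [g1]
      split_ifs
      · rw [AA, sq, sum_mul_sum, mul_sum]
        refine sum_congr rfl fun c _ => ?_
        rw [mul_sum]
        exact sum_congr rfl fun c' _ => by ring
      · simp
    rw [sum_filter, sum_congr rfl this, sum_comm]
    refine sum_congr rfl fun c _ => ?_
    rw [sum_comm]
    exact sum_congr rfl fun c' _ => by rw [mul_sum]
  have key : ∀ c c', y c * y c' ≠ 0 → S c c' ∈ pw P (R*R) ∧ |∑ n ∈ N, a n * ∏ p ∈ PP 0 D ∪ S c c', f c c' p n - X / (∏ p ∈ PP 0 D, (#(B p):ℝ)) * ∏ p : P, mm h B p (c p) (c' p)| ≤ E (S c c') * 2^(#(S c c')) := by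
    intro c c' hy
    obtain ⟨hc, hc'⟩ := mul_ne_zero_iff.1 hy
    have hpw : S c c' ∈ pw P (R*R) := by
      refine mem_pw.2 ⟨hSP c c', ?_⟩
      have b1 : (∏ p ∈ S c c', p) ≤ (∏ p ∈ sp c, p) * ∏ p ∈ sp c', p := by
        rw [← Finset.prod_union_inter]
        exact Nat.le_mul_of_pos_right _ (prod_pos' (hP.mono (inter_subset_left.trans (filter_subset _ _))))
      calc ((∏ p ∈ S c c', p : ℕ):ℝ) ≤ ((∏ p ∈ sp c, p : ℕ):ℝ) * ((∏ p ∈ sp c', p : ℕ):ℝ) := by exact_mod_cast b1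
        _ ≤ R * R := mul_le_mul (yR c hc) (yR c' hc') (by positivity) (le_trans (by positivity) (yR c hc))
    refine ⟨hpw, ?_⟩
    have hT : Prm (PP 0 D ∪ S c c') := fun p hp => (Finset.mem_union.1 hp).elim (PP_prm 0 D p) fun h => hP p (hSP c c' h)
    have cr := crt hT (fun p _ => hB p) (f := f c c') (fun p _ n => by
      simp only [hf]; rw [xi_mod, xi_mod h p (ex c' p), Nat.mod_mod]) (fun n hn ha p hp => hsupp n hn ha p (union_subset_union_right (hSP c c') hp)) (heq _ hpw)
    have hone : ∀ p ∈ PP 0 D, ∀ (b : ℕ), b ∈ B p → f c c' p b = if b = 1 then 1 else 0 := fun p hp b hb => by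
      simp only [hf, hDP p hp, if_false]
      rw [Nat.mod_eq_of_lt (Finset.mem_range.1 (hB p hb)), Nat.mod_eq_of_lt (PP_prm 0 D p hp).one_lt]
    have m1 : X * ∏ p ∈ PP 0 D ∪ S c c', ((∑ b ∈ B p, f c c' p b) / #(B p)) = X / (∏ p ∈ PP 0 D, (#(B p):ℝ)) * ∏ p : P, mm h B p (c p) (c' p) := by
      rw [Finset.prod_union (hdis c c'), hprod c c' (mm h B), ← mul_assoc, div_eq_mul_inv, ← Finset.prod_inv_distrib]
      · congr 1
        · congr 1
          refine Finset.prod_congr rfl fun p hp => ?_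
          rw [sum_congr rfl (hone p hp), Finset.sum_ite_eq', if_pos (hB0 p (PP_prm 0 D p hp)), one_div]
        · exact Finset.prod_congr rfl fun p hp => by simp only [hf, hSP c c' hp, if_true, mm]
      · intro p hp
        have : (#(B p):ℝ) ≠ 0 := by exact_mod_cast (card_pos.2 ⟨1, hB0 p (hP p hp)⟩).ne'
        simp [mm, xi, this]
    rw [m1] at cr
    refine cr.trans (mul_le_mul_of_nonneg_left ?_ (E0 _))
    rw [Finset.prod_union (hdis c c'), Finset.prod_eq_one (s := PP 0 D), one_mul, ← Finset.prod_const]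
    · refine Finset.prod_le_prod (fun p _ => sum_nonneg fun _ _ => abs_nonneg _) fun p hp => ?_
      have hpP := hSP c c' hp
      simp only [hf, hpP, if_true, abs_mul]
      have hx : ∀ a n, |xi h p a n| ≤ 1 := xi_le h (hP p hpP)
      by_cases h1 : ex c p = none
      · have h2 : ex c' p ≠ none := fun h2 => by
          simp only [hS, Finset.mem_union, sp, mem_filter, h1, h2, ne_eq, not_true_eq_false, and_false, or_self] at hp
        obtain ⟨j, hj⟩ := Option.ne_none_iff_exists'.1 h2
        rw [hj]
        exact (sum_le_sum fun n _ => mul_le_of_le_one_left (abs_nonneg _) (hx _ _)).trans (hloc p hpP j)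
      · obtain ⟨j, hj⟩ := Option.ne_none_iff_exists'.1 h1
        rw [hj]
        exact (sum_le_sum fun n _ => mul_le_of_le_one_right (abs_nonneg _) (hx _ _)).trans (hloc p hpP j)
    · intro p hp
      rw [sum_congr rfl fun b hb => by rw [hone p hp b hb]]
      simp only [apply_ite abs, abs_one, abs_zero]
      rw [Finset.sum_ite_eq', if_pos (hB0 p (PP_prm 0 D p hp))]
  have t1 : ∀ c c', |y c * y c' * ∑ n ∈ N, a n * ∏ p ∈ PP 0 D ∪ S c c', f c c' p n - X / (∏ p ∈ PP 0 D, (#(B p):ℝ)) * (y c * y c' * ∏ p : P, mm h B p (c p) (c' p))| ≤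
      if S c c' ∈ pw P (R*R) then E (S c c') * 2^(#(S c c')) else 0 := by
    intro c c'
    by_cases hy : y c * y c' = 0
    · rw [hy]; simp only [zero_mul, mul_zero, sub_zero, abs_zero]
      split_ifs
      · exact mul_nonneg (E0 _) (by positivity)
      · exact le_rfl
    · obtain ⟨k1, k2⟩ := key c c' hy
      rw [if_pos k1]
      refine le_trans ?_ k2
      rw [mul_left_comm, ← mul_sub, abs_mul, abs_of_nonneg (mul_nonneg (y0 c) (y0 c'))]
      exact mul_le_of_le_one_left (abs_nonneg _) (mul_le_one₀ (y1 c) (y0 c') (y1 c'))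
  have t2 : ∑ c, ∑ c', (if S c c' ∈ pw P (R*R) then E (S c c') * 2^(#(S c c')) else 0) ≤ ∑ T ∈ pw P (R*R), (2 * (k+1)^2 : ℕ)^(#T) * E T := by
    rw [pairs (fun c c' => if S c c' ∈ pw P (R*R) then E (S c c') * 2^(#(S c c')) else 0), ← sum_filter]
    rw [← sum_fiberwise_of_maps_to (t := pw P (R*R)) (g := fun b : P → Option (Fin k) × Option (Fin k) => S (fun p => (b p).1) (fun p => (b p).2)) (fun b hb => (mem_filter.1 hb).2)]
    refine sum_le_sum fun T hT => ?_
    rw [sum_congr rfl (g := fun _ => E T * 2^(#T)) (fun b hb => by rw [(mem_filter.1 hb).2]), sum_const, nsmul_eq_mul]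
    have : #(((univ.filter fun b : P → Option (Fin k) × Option (Fin k) => S (fun p => (b p).1) (fun p => (b p).2) ∈ pw P (R*R))).filter fun b => S (fun p => (b p).1) (fun p => (b p).2) = T) ≤ ((k+1)^2)^(#T) := by
      calc _ ≤ #(Fintype.piFinset fun p : P => if (p:ℕ) ∈ T then (univ : Finset (Option (Fin k) × Option (Fin k))) else {(none, none)}) := by
            refine card_le_card fun b hb => Fintype.mem_piFinset.2 fun p => ?_
            split_ifs with hp
            · exact Finset.mem_univ _
            · rw [← (mem_filter.1 hb).2] at hp
              have := hSn _ _ p p.2 hp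
              rw [ex_coe, ex_coe] at this
              exact Finset.mem_singleton.2 (Prod.ext this.1 this.2)
        _ = ∏ p : P, if (p:ℕ) ∈ T then (k+1)^2 else 1 := by
            rw [Fintype.card_piFinset]
            refine Finset.prod_congr rfl fun p _ => ?_
            split_ifs <;> simp [sq]
        _ = _ := by
            rw [Finset.prod_coe_sort P (fun p => if p ∈ T then (k+1)^2 else 1), Finset.prod_ite_mem, inter_eq_right.2 (mem_pw.1 hT).1, Finset.prod_const]
    calc _ ≤ ((((k+1)^2)^(#T) : ℕ):ℝ) * (E T * 2^(#T)) := by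
          refine mul_le_mul_of_nonneg_right (by exact_mod_cast this) (mul_nonneg (E0 _) (by positivity))
      _ = _ := by push_cast; rw [mul_pow]; ring
  refine le_trans ?_ t2
  rw [e1, mul_sum, ← sum_sub_distrib]
  refine (abs_sum_le_sum_abs _ _).trans (sum_le_sum fun c _ => ?_)
  rw [mul_sum, ← sum_sub_distrib]
  exact (abs_sum_le_sum_abs _ _).trans (sum_le_sum fun c' _ => t1 c c')
end BD
namespace BD
open Finset Topology
section loc
variable {k p : ℕ} {h : Fin k → ℤ}
lemma cnt (hp : 0 < p) (z : ℤ) : (Finset.range p).filter (fun n : ℕ => (p:ℤ) ∣ (n:ℤ) + z) = {((-z) % p).toNat} := by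
  have hp' : (0:ℤ) < p := by exact_mod_cast hp
  have h1 := Int.emod_nonneg (-z) hp'.ne'
  have h2 := Int.emod_lt_of_pos (-z) hp'
  ext n
  rw [mem_filter, Finset.mem_range, Finset.mem_singleton]
  constructor
  · rintro ⟨h3, h4⟩
    have : (-z) % p = n := by
      have h5 : (-z) ≡ n [ZMOD p] := (Int.modEq_iff_dvd).2 (by simpa using h4)
      rw [h5, Int.emod_eq_of_lt (by positivity) (by exact_mod_cast h3)]
    rw [this]; rfl
  · rintro rfl
    refine ⟨by omega, ?_⟩
    rw [Int.toNat_of_nonneg h1]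
    have : (-z) % p + z = - (p * (-z / p)) := by linarith [Int.emod_add_mul_ediv (-z) p]
    rw [this, dvd_neg]; exact Dvd.intro _ rfl
open Classical in
noncomputable def dd (h : Fin k → ℤ) (p : ℕ) (j : Fin k) (n : ℤ) : ℝ := if (p:ℤ) ∣ n + h j then 1 else 0
lemma xi_dd (hp : p.Prime) (j : Fin k) (n : ℤ) : xi h p (some j) n = 1/((p:ℝ)-1) - (1 + 1/((p:ℝ)-1)) * dd h p j n := by
  simp only [xi, dd]; split_ifs <;> ring
lemma dd_range (hp : p.Prime) (j : Fin k) : ∑ n ∈ Finset.range p, dd h p j n = 1 := by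
  classical
  simp only [dd]
  rw [← sum_filter, sum_const, nsmul_eq_mul, mul_one]
  exact_mod_cast (by rw [cnt hp.pos]; exact card_singleton _ : #((Finset.range p).filter (fun n : ℕ => (p:ℤ) ∣ (n:ℤ) + h j)) = 1)
lemma hloc {B : Finset ℕ} (hp : p.Prime) (hB : B ⊆ Finset.range p) (j : Fin k) : ∑ n ∈ B, |xi h p (some j) n| ≤ 2 := by
  have h1 := p_sub hp
  have h2 : (0:ℝ) ≤ 1/((p:ℝ)-1) := by positivity
  calc _ ≤ ∑ n ∈ Finset.range p, |xi h p (some j) n| := sum_le_sum_of_subset_of_nonneg hB fun _ _ _ => abs_nonneg _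
    _ = ∑ n ∈ Finset.range p, (1/((p:ℝ)-1) + (1 - 1/((p:ℝ)-1)) * dd h p j n) := sum_congr rfl fun n _ => by
        simp only [xi, dd]; split_ifs
        · simp
        · rw [abs_of_nonneg h2]; ring
    _ = p * (1/((p:ℝ)-1)) + (1 - 1/((p:ℝ)-1)) := by rw [sum_add_distrib, ← mul_sum, dd_range hp, sum_const, card_range, nsmul_eq_mul, mul_one]
    _ = 2 := by field_simp; ring
    _ ≤ 2 := le_rfl
lemma sums {B : Finset ℕ} (hp : p.Prime) {j j' : Fin k} (hd : j ≠ j' → ¬ (p:ℤ) ∣ h j - h j') (hj : ∑ n ∈ B, dd h p j n = 1) (hj' : ∑ n ∈ B, dd h p j' n = 1) :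
    ∑ n ∈ B, xi h p (some j) n * xi h p (some j') n = #B * (1/((p:ℝ)-1))^2 - 2 * (1/((p:ℝ)-1)) * (1 + 1/((p:ℝ)-1)) + if j = j' then (1 + 1/((p:ℝ)-1))^2 else 0 := by
  have e : ∑ n ∈ B, dd h p j n * dd h p j' n = if j = j' then 1 else 0 := by
    split_ifs with hjj
    · rw [← hj, ← hjj]; exact sum_congr rfl fun n _ => by simp only [dd]; split_ifs <;> simp
    · refine sum_eq_zero fun n _ => ?_
      simp only [dd]
      split_ifs with a b
      · exact absurd (by have := dvd_sub a b; simpa using this) (hd hjj)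
      all_goals simp
  calc _ = ∑ n ∈ B, ((1/((p:ℝ)-1))^2 - (1/((p:ℝ)-1)) * (1 + 1/((p:ℝ)-1)) * dd h p j n - (1/((p:ℝ)-1)) * (1 + 1/((p:ℝ)-1)) * dd h p j' n + (1 + 1/((p:ℝ)-1))^2 * (dd h p j n * dd h p j' n)) :=
        sum_congr rfl fun n _ => by rw [xi_dd hp, xi_dd hp]; ring
    _ = _ := by
        rw [sum_add_distrib, sum_sub_distrib, sum_sub_distrib, ← mul_sum, ← mul_sum, ← mul_sum, hj, hj', e, sum_const, nsmul_eq_mul]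
        split_ifs <;> ring
lemma sum1 {B : Finset ℕ} (hp : p.Prime) {j : Fin k} (hj : ∑ n ∈ B, dd h p j n = 1) :
    ∑ n ∈ B, xi h p (some j) n = #B * (1/((p:ℝ)-1)) - (1 + 1/((p:ℝ)-1)) := by
  rw [sum_congr rfl fun (n:ℕ) _ => xi_dd (h := h) hp j (n:ℤ), sum_sub_distrib, ← mul_sum, hj, sum_const, nsmul_eq_mul, mul_one]
lemma mm_symm (B : ℕ → Finset ℕ) (a b : Option (Fin k)) : mm h B p a b = mm h B p b a := by
  unfold mm; congr 1; exact sum_congr rfl fun _ _ => mul_comm _ _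
lemma mm_none {B : ℕ → Finset ℕ} (hB : 0 < #(B p)) : mm h B p none none = 1 := by
  have : (#(B p):ℝ) ≠ 0 := by exact_mod_cast hB.ne'
  simp [mm, xi, this]
lemma mm1 (hp : p.Prime) (hd : ∀ j j', j ≠ j' → ¬ (p:ℤ) ∣ h j - h j') : (∀ j, mm h Finset.range p (some j) (some j) = 1/((p:ℝ)-1)) ∧
    ∀ a b, a ≠ b → |mm h Finset.range p a b| ≤ 3 * (1/((p:ℝ)-1))^2 := by
  have h1 := p_sub hp
  have h2 : (0:ℝ) < 1/((p:ℝ)-1) := by positivity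
  have hpp : (0:ℝ) < p := by linarith
  have hn : ∀ j, mm h Finset.range p none (some j) = 0 := fun j => by
    simp only [mm, xi.eq_1, one_mul]
    rw [sum1 hp (dd_range hp j), card_range]
    field_simp; ring
  refine ⟨fun j => ?_, fun a b hab => ?_⟩
  · rw [mm, sums hp (hd j j) (dd_range hp j) (dd_range hp j), if_pos rfl, card_range]
    have : (p:ℝ)-1 ≠ 0 := by linarith
    field_simp; ring
  · match a, b with
    | none, none => exact absurd rfl hab
    | none, some j => rw [hn, abs_zero]; positivity
    | some j, none => rw [mm_symm, hn, abs_zero]; positivity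
    | some j, some j' =>
      have hjj : j ≠ j' := fun e => hab (by rw [e])
      rw [mm, sums hp (hd j j') (dd_range hp j) (dd_range hp j'), if_neg hjj, card_range]
      have : (p * (1/((p:ℝ)-1))^2 - 2 * (1/((p:ℝ)-1)) * (1 + 1/((p:ℝ)-1)) + 0)/p = - (1/((p:ℝ)-1))^2 := by
        have : (p:ℝ)-1 ≠ 0 := by linarith
        field_simp; ring
      rw [this, abs_neg, abs_of_nonneg (by positivity)]
      nlinarith [sq_nonneg (1/((p:ℝ)-1))]
def Bu (p : ℕ) : Finset ℕ := (Finset.range p).erase 0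
lemma Bu_card (hp : p.Prime) : (#(Bu p):ℝ) = (p:ℝ) - 1 := by
  rw [Bu, card_erase_of_mem (Finset.mem_range.2 hp.pos), card_range, Nat.cast_sub hp.one_le, Nat.cast_one]
noncomputable def mu (h : Fin k → ℤ) (i : Fin k) (p : ℕ) (a b : Option (Fin k)) : ℝ := if a = some i ∨ b = some i then 0 else mm h Bu p a b
lemma mm2 (hp : p.Prime) (hd : ∀ j j', j ≠ j' → ¬ (p:ℤ) ∣ h j - h j') {i : Fin k} (hi : h i = 0) :
    (∀ a b, mm h Bu p a b = (if a = some i then 1/((p:ℝ)-1) else 1) * (if b = some i then 1/((p:ℝ)-1) else 1) * mu h i p (ke i a) (ke i b)) ∧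
    mu h i p none none = 1 ∧ (∀ j, j ≠ i → 1/((p:ℝ)-1) ≤ mu h i p (some j) (some j)) ∧ 0 ≤ mu h i p (some i) (some i) ∧
    ∀ a b, a ≠ b → |mu h i p a b| ≤ 3 * (1/((p:ℝ)-1))^2 := by
  have h1 := p_sub hp
  set u := 1/((p:ℝ)-1) with hu
  have h2 : (0:ℝ) < u := by positivity
  have hu1 : u ≤ 1 := by rw [hu, div_le_one (by linarith)]; exact h1
  have hc : (#(Bu p):ℝ) = u⁻¹ := by rw [Bu_card hp, hu, one_div, inv_inv]
  have hcp : 0 < #(Bu p) := by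
    have : (0:ℝ) < #(Bu p) := by rw [hc]; positivity
    exact_mod_cast this
  have hds : ∀ j, j ≠ i → ∑ n ∈ Bu p, dd h p j n = 1 := fun j hj => by
    have h3 := dd_range (h := h) hp j
    rw [← add_sum_erase _ _ (Finset.mem_range.2 hp.pos)] at h3
    have : dd h p j ((0:ℕ):ℤ) = 0 := by
      have h4 := hd j i hj
      rw [hi, sub_zero] at h4
      simp only [dd, Nat.cast_zero, zero_add, h4, if_false]
    rw [this, zero_add] at h3; exact h3
  have hxi : ∀ n ∈ Bu p, xi h p (some i) n = u := fun n hn => by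
    have hn' := Finset.mem_erase.1 hn
    have : ¬ (p:ℤ) ∣ (n:ℤ) + h i := by
      rw [hi, add_zero, Int.natCast_dvd_natCast]
      exact fun hdv => absurd (Nat.le_of_dvd (Nat.pos_of_ne_zero hn'.1) hdv) (not_le.2 (Finset.mem_range.1 hn'.2))
    simp only [xi, this, if_false, hu]
  have hw : ∀ a, ∀ n ∈ Bu p, xi h p a n = (if a = some i then u else 1) * xi h p (ke i a) n := fun a n hn => by
    unfold ke
    split_ifs with ha
    · rw [ha, hxi n hn]; simp [xi]
    · rw [one_mul]
  have hke : ∀ a, ke i a ≠ some i := fun a ha => (ke_some.1 ha).2 rfl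
  have hn : ∀ j, j ≠ i → mm h Bu p none (some j) = - u^2 := fun j hj => by
    simp only [mm, xi.eq_1, one_mul]
    rw [sum1 hp (hds j hj), hc, ← hu]
    field_simp; ring
  refine ⟨fun a b => ?_, ?_, fun j hj => ?_, ?_, fun a b hab => ?_⟩
  · rw [mu, if_neg (not_or.2 ⟨hke a, hke b⟩), mm, mm, ← mul_div_assoc, mul_sum]
    congr 1
    exact sum_congr rfl fun n hn => by rw [hw a n hn, hw b n hn]; ring
  · rw [mu, if_neg (by simp)]; exact mm_none hcp
  · rw [mu, if_neg (by simpa using hj), mm, sums hp (hd j j) (hds j hj) (hds j hj), if_pos rfl, ← hu, hc, div_inv_eq_mul]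
    have : (u⁻¹ * u^2 - 2 * u * (1+u) + (1+u)^2) * u = u + u^2 * (1 - u) := by field_simp; ring
    rw [this]
    nlinarith [mul_nonneg (sq_nonneg u) (sub_nonneg.2 hu1)]
  · simp [mu]
  · unfold mu
    split_ifs with hor
    · rw [abs_zero]; positivity
    obtain ⟨ha, hb⟩ := not_or.1 hor
    match a, b with
    | none, none => exact absurd rfl hab
    | none, some j => rw [hn j (fun e => hb (by rw [e])), abs_neg, abs_of_nonneg (by positivity)]; nlinarith
    | some j, none => rw [mm_symm, hn j (fun e => ha (by rw [e])), abs_neg, abs_of_nonneg (by positivity)]; nlinarith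
    | some j, some j' =>
      have hjj : j ≠ j' := fun e => hab (by rw [e])
      rw [mm, sums hp (hd j j') (hds j fun e => ha (by rw [e])) (hds j' fun e => hb (by rw [e])), if_neg hjj, ← hu, hc, div_inv_eq_mul]
      have : (u⁻¹ * u^2 - 2 * u * (1+u) + 0) * u = - (u^2 + 2 * u^3) := by field_simp; ring
      rw [this, abs_neg, abs_of_nonneg (by positivity)]
      nlinarith [mul_nonneg (sq_nonneg u) (sub_nonneg.2 hu1)]
end loc
end BD
namespace BD
open Finset Topology
lemma tail {D R : ℕ} (hD : 2 ≤ D) : ∑ p ∈ PP D R, (1/((p:ℝ)-1))^2 ≤ 1/((D:ℝ)-1) := by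
  have hD' : (2:ℝ) ≤ D := by exact_mod_cast hD
  have h : ∀ R, D ≤ R → ∑ p ∈ Finset.Ioc D R, (1/((p:ℝ)-1))^2 ≤ 1/((D:ℝ)-1) - 1/((R:ℝ)-1) := by
    intro R hR
    induction R, hR using Nat.le_induction with
    | base => simp
    | succ n hn ih =>
      rw [← Finset.insert_Ioc_right_eq_Ioc_add_one (by omega), sum_insert (by simp)]
      have hn' : (2:ℝ) ≤ n := hD'.trans (by exact_mod_cast hn)
      push_cast
      rw [add_sub_cancel_right]
      have : (1/(n:ℝ))^2 ≤ 1/((n:ℝ)-1) - 1/n := by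
        rw [div_sub_div _ _ (by linarith) (by linarith), div_pow, div_le_div_iff₀ (by positivity) (by nlinarith)]
        nlinarith
      linarith
  by_cases hR : D ≤ R
  · refine (sum_le_sum_of_subset_of_nonneg (filter_subset _ _) fun _ _ _ => sq_nonneg _).trans ((h R hR).trans ?_)
    have hR' : (2:ℝ) ≤ R := hD'.trans (by exact_mod_cast hR)
    have : 0 ≤ 1/((R:ℝ)-1) := div_nonneg zero_le_one (by linarith)
    linarith
  · rw [PP, Finset.Ioc_eq_empty (by omega), filter_empty, sum_empty]
    exact div_nonneg zero_le_one (by linarith)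
lemma eps {D R : ℕ} {C : ℝ} (hD : 2 ≤ D) (hC : 0 ≤ C) (h : 3 * C ≤ (D:ℝ) - 1) : ∏ p : PP D R, (1 + C * (1/((p:ℝ)-1))^2) ≤ 3/2 := by
  rw [Finset.prod_coe_sort (PP D R) (fun p : ℕ => 1 + C * (1/((p:ℝ)-1))^2)]
  refine (prod_one_add_le _ _ fun p _ => by positivity).trans ?_
  rw [← mul_sum]
  have hD' : (2:ℝ) ≤ D := by exact_mod_cast hD
  have h1 : C * ∑ p ∈ PP D R, (1/((p:ℝ)-1))^2 ≤ 1/3 := by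
    refine (mul_le_mul_of_nonneg_left (tail hD) hC).trans ?_
    rw [mul_one_div, div_le_iff₀ (by linarith)]; linarith
  refine (exp_le_exp.2 h1).trans ?_
  have h2 : exp (1/3) ^ 3 = exp 1 := by rw [← exp_nat_mul]; norm_num
  by_contra h3
  have h4 : (3/2:ℝ)^3 < exp (1/3)^3 := pow_lt_pow_left₀ (not_le.1 h3) (by norm_num) (by norm_num)
  rw [h2] at h4
  have := exp_one_lt_d9
  norm_num at h4 this; linarith
noncomputable def Wd (D : ℕ) : ℕ := ∏ p ∈ PP 0 D, p
lemma Wd_pos (D : ℕ) : 0 < Wd D := prod_pos' (PP_prm 0 D)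
lemma hdiv {k D R p : ℕ} (hp : p ∈ PP D R) (hk : k ≤ D) {h : Fin k → ℤ} (hh : ∀ j j', h j - h j' = ((j:ℕ) - (j':ℕ) : ℤ) * Wd D) :
    ∀ j j', j ≠ j' → ¬ (p:ℤ) ∣ h j - h j' := by
  intro j j' hj hd
  have hpp := PP_prm D R p hp
  have hDp : D < p := (Finset.mem_Ioc.1 (mem_filter.1 hp).1).1
  rw [hh] at hd
  rcases (Nat.prime_iff_prime_int.1 hpp).dvd_or_dvd hd with h1 | h1
  · have := Int.eq_zero_of_abs_lt_dvd h1 (by rw [abs_lt]; constructor <;> omega)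
    exact hj (Fin.ext (by omega))
  · rw [Int.natCast_dvd_natCast, Wd, Prime.dvd_finset_prod_iff hpp.prime] at h1
    obtain ⟨q, hq, hpq⟩ := h1
    rw [(Nat.prime_dvd_prime_iff_eq hpp (PP_prm 0 D q hq)).1 hpq] at hDp
    exact absurd (Finset.mem_Ioc.1 (mem_filter.1 hq).1).2 (not_le.2 hDp)
section fixed
variable {k D R : ℕ} {ρ : ℝ} {G : ℝ → ℝ}
noncomputable def lgp (P : Finset ℕ) (p : P) : ℝ := log (p:ℕ)
noncomputable def up' (P : Finset ℕ) (p : P) : ℝ := 1/(((p:ℕ):ℝ)-1)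
lemma lgp_nonneg (P : Finset ℕ) (p : P) : 0 ≤ lgp P p := log_natCast_nonneg _
lemma yR {P : Finset ℕ} (hP : Prm P) (c : P → Option (Fin k)) (h : yy (lgp P) ρ G c ≠ 0) : ((∏ p ∈ sp c, p : ℕ):ℝ) ≤ exp ρ := by
  have h1 : ∑ j, lam (lgp P) (cls c j) ≤ ρ := by
    by_contra h2
    exact h (by rw [yy, FF, if_neg h2])
  have hpos : (0:ℝ) < (∏ p ∈ sp c, p : ℕ) := by exact_mod_cast prod_pos' (fun p hp => hP p (mem_filter.1 hp).1)
  rw [← log_le_iff_le_exp hpos]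
  refine le_trans (le_of_eq ?_) h1
  simp only [lam, cls, decide_eq_true_eq]
  rw [sum_comm, Nat.cast_prod, log_prod (fun p hp => by exact_mod_cast (hP p (mem_filter.1 hp).1).ne_zero), sp, sum_filter,
    ← Finset.sum_coe_sort P]
  refine sum_congr rfl fun p _ => ?_
  rw [ex_coe]
  cases hc : c p with
  | none => simp
  | some j => simp [lgp]
lemma y01 (P : Finset ℕ) (hG : ∀ x, 0 ≤ G x) (hG1 : ∀ x, G x ≤ 1) (c : P → Option (Fin k)) : 0 ≤ yy (lgp P) ρ G c ∧ yy (lgp P) ρ G c ≤ 1 := by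
  refine ⟨FF_nonneg (fun _ => hG) _, ?_⟩
  unfold yy FF
  split_ifs
  · exact Finset.prod_le_one (fun _ _ => hG _) fun _ _ => hG1 _
  · exact zero_le_one
lemma offd {m : Option (Fin k) → Option (Fin k) → ℝ} {u : ℝ} (h : ∀ a b, a ≠ b → |m a b| ≤ 3 * u^2) :
    ∑ x : Option (Fin k) × Option (Fin k) with x.1 ≠ x.2, |m x.1 x.2| ≤ 3 * ((k:ℝ)+1)^2 * u^2 := by
  refine (sum_le_sum fun x hx => h x.1 x.2 (mem_filter.1 hx).2).trans ?_
  rw [sum_const, nsmul_eq_mul]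
  have h1 : #{x : Option (Fin k) × Option (Fin k) | x.1 ≠ x.2} ≤ (k+1)^2 := by
    refine (card_le_univ _).trans (le_of_eq ?_)
    rw [Fintype.card_prod, Fintype.card_option, Fintype.card_fin, sq]
  have h2 : (#{x : Option (Fin k) × Option (Fin k) | x.1 ≠ x.2} : ℝ) ≤ ((k:ℝ)+1)^2 := by exact_mod_cast h1
  nlinarith [sq_nonneg u]
lemma count_mod {q : ℕ} (hq : 0 < q) (M b : ℕ) : |(#{n ∈ Finset.range M | n ≡ b [MOD q]} : ℝ) - M/q| ≤ 1 := by
  have h0 : #{n ∈ Finset.range M | n ≡ b [MOD q]} = Nat.count (· ≡ b [MOD q]) M := (Nat.count_eq_card_filter_range _ _).symm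
  rw [h0, Nat.count_modEq_card _ hq]
  have h1 := Nat.div_add_mod M q
  have h2 := Nat.mod_lt M hq
  have hq' : (0:ℝ) < q := by exact_mod_cast hq
  have h3 : (M:ℝ)/q = (M/q : ℕ) + (M % q : ℕ)/q := by
    rw [div_eq_iff hq'.ne', add_mul, div_mul_cancel₀ _ hq'.ne']
    have : (M:ℝ) = q * (M/q : ℕ) + (M % q : ℕ) := by exact_mod_cast h1.symm
    linarith
  have h4 : ((M % q : ℕ):ℝ)/q ≤ 1 := by rw [div_le_one hq']; exact_mod_cast h2.le
  have h5 : 0 ≤ ((M % q : ℕ):ℝ)/q := by positivity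
  rw [h3]; push_cast
  split_ifs <;> rw [abs_le] <;> constructor <;> push_cast <;> linarith
lemma S1 (hD : D = 10*(k+1)^2) (hG : ∀ x, 0 ≤ G x) (hG1 : ∀ x, G x ≤ 1) (ha : Antitone G) {h : Fin k → ℤ}
    (hh : ∀ j j', h j - h j' = ((j:ℕ) - (j':ℕ) : ℤ) * Wd D) (M : ℕ) :
    ∑ n ∈ Finset.range M with n ≡ 1 [MOD Wd D], AA h (yy (lgp (PP D R)) ρ G) n ^ 2 ≤
      M/Wd D * (3/2 * (∑ r, G (lam (lgp (PP D R)) r)^2 * oB (up' (PP D R)) r)^k) + exp ρ ^ 4 := by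
  set P := PP D R with hP
  have hPp : Prm P := PP_prm D R
  have hk : k ≤ D := by nlinarith
  have hprod : ∀ T : Finset ℕ, ∏ p ∈ T, (#(Finset.range p):ℝ) = ((∏ p ∈ T, p : ℕ):ℝ) := fun T => by simp
  have key := expand (N := Finset.range M) hPp (PP_disj D R) (R := exp ρ) h (fun c => (y01 P hG hG1 c).1) (fun c => (y01 (ρ := ρ) P hG hG1 c).2) (yR hPp) (a := fun _ => 1) (B := Finset.range)
    (fun p => Finset.Subset.refl _) (fun p hp => Finset.mem_range.2 hp.one_lt) (X := M) (E := fun _ => 1) (fun _ => zero_le_one)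
    (fun n _ _ p hp => Finset.mem_range.2 (Nat.mod_lt _ ?_)) (fun p hp j => hloc (hPp p hp) (Finset.Subset.refl _) j)
    (fun S hS b _ => by
      rw [sum_const, nsmul_eq_mul, mul_one, hprod]
      refine count_mod (prod_pos' ?_) M b
      intro p hp
      rcases Finset.mem_union.1 hp with h1 | h1
      · exact PP_prm 0 D p h1
      · exact hPp p ((mem_pw.1 hS).1 h1))
  swap
  · rcases Finset.mem_union.1 hp with h1 | h1
    · exact (PP_prm 0 D p h1).pos
    · exact (hPp p h1).pos
  rw [hprod] at key
  simp only [one_mul, mul_one] at key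
  have hW : (0:ℝ) < Wd D := by exact_mod_cast Wd_pos D
  have hS := S1abs (ρ := ρ) (m := fun p : P => mm h Finset.range p) (lgp_nonneg P) (u := up' P) (fun p => ?_) hG ha (fun p => mm_none (by rw [card_range]; exact (hPp p p.2).pos))
    (fun p j => (mm1 (hPp p p.2) (hdiv p.2 hk hh)).1 j) (fun p => offd (mm1 (hPp p p.2) (hdiv p.2 hk hh)).2) (eps (by nlinarith) (by positivity) ?_)
  rotate_left
  · exact div_nonneg zero_le_one (by have := p_sub (hPp p p.2); linarith)
  · rw [hD]; push_cast; nlinarith [(Nat.cast_nonneg k : (0:ℝ) ≤ k)]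
  rw [Fintype.card_fin] at hS
  have hE : ∑ S ∈ pw P (exp ρ * exp ρ), ((2 * (k+1)^2 : ℕ):ℝ)^(#S) ≤ exp ρ ^ 4 := by
    calc _ ≤ ∑ S ∈ pw P (exp ρ * exp ρ), exp ρ * exp ρ := by
          refine sum_le_sum fun S hS => ?_
          refine le_trans ?_ (mem_pw.1 hS).2
          rw [Nat.cast_prod, ← Finset.prod_const]
          refine Finset.prod_le_prod (fun _ _ => by positivity) fun p hp => ?_
          have := (Finset.mem_Ioc.1 (mem_filter.1 ((mem_pw.1 hS).1 hp)).1).1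
          exact_mod_cast (show 2*(k+1)^2 ≤ p by nlinarith)
      _ = #(pw P (exp ρ * exp ρ)) * (exp ρ * exp ρ) := by rw [sum_const, nsmul_eq_mul]
      _ ≤ (exp ρ * exp ρ) * (exp ρ * exp ρ) := by
          refine mul_le_mul_of_nonneg_right ?_ (by positivity)
          refine le_trans ?_ (Nat.floor_le (by positivity : 0 ≤ exp ρ * exp ρ))
          have : #(pw P (exp ρ * exp ρ)) ≤ #(Finset.Ioc 0 ⌊exp ρ * exp ρ⌋₊) := by
            refine Finset.card_le_card_of_injOn (fun S => ∏ p ∈ S, p) (fun S hS => ?_) (fun S hS T hT e => ?_)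
            · have hS' := mem_pw.1 hS
              exact Finset.mem_coe.2 (Finset.mem_Ioc.2 ⟨prod_pos' (hPp.mono hS'.1), Nat.le_floor hS'.2⟩)
            · exact prod_inj (hPp.mono (mem_pw.1 hS).1) (hPp.mono (mem_pw.1 hT).1) e
          rw [Nat.card_Ioc, Nat.sub_zero] at this
          exact_mod_cast this
      _ = _ := by ring
  have h1 := (abs_le.1 (key.trans hE)).2
  have h2 := mul_le_mul_of_nonneg_left hS (by positivity : (0:ℝ) ≤ M/Wd D)
  change ∑ n ∈ Finset.range M with n ≡ 1 [MOD Wd D], _ - M/(Wd D:ℝ) * _ ≤ _ at h1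
  linarith
end fixed
end BD
namespace BD
open Finset Topology
lemma tot {T : Finset ℕ} (hT : Prm T) : ((∏ p ∈ T, p).totient : ℝ) = ∏ p ∈ T, (#(Bu p):ℝ) := by
  induction T using Finset.induction_on with
  | empty => simp
  | insert p T hp ih =>
    have h1 := hT p (mem_insert_self _ _)
    have h2 : Prm T := hT.mono (subset_insert _ _)
    rw [Finset.prod_insert hp, Finset.prod_insert hp, Nat.totient_mul, Nat.cast_mul, ih h2, Bu_card h1, Nat.totient_prime h1, Nat.cast_sub h1.one_le, Nat.cast_one]
    exact Nat.Coprime.prod_right fun q hq => (Nat.coprime_primes h1 (h2 q hq)).2 fun e => hp (e ▸ hq)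
lemma Bu_mem {n p : ℕ} (hp : p.Prime) (h : n.Coprime p) : n % p ∈ Bu p := by
  refine Finset.mem_erase.2 ⟨fun h0 => ?_, Finset.mem_range.2 (Nat.mod_lt _ hp.pos)⟩
  exact hp.one_lt.ne' (Nat.Coprime.eq_one_of_dvd h.symm (Nat.dvd_of_mod_eq_zero h0))
lemma S2 {k D R : ℕ} {ρ L : ℝ} {G : ℝ → ℝ} (hD : D = 10*(k+1)^2) (hG : ∀ x, 0 ≤ G x) (hG1 : ∀ x, G x ≤ 1) (ha : Antitone G) {h : Fin k → ℤ}
    (hh : ∀ j j', h j - h j' = ((j:ℕ) - (j':ℕ) : ℤ) * Wd D) {i : Fin k} (hi : h i = 0) (hL : 5 ≤ L) (hDL : (D:ℝ) ≤ exp (L/100)) (hRL : (R:ℝ) ≤ exp (L/100))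
    (hWL : Wd D * (exp ρ * exp ρ) ≤ exp (L/100)) {K : ℝ} (hBV : ∀ P : Finset ℕ, Prm P →
      ∑ S ∈ pw P (exp (L/100)), ((2*(k+1)^2 : ℕ):ℝ)^(#S) * Er (∏ p ∈ S, p) L ≤ K / L) {I1 I2 μ1 μ2 : ℝ}
    (hI1 : I1 = ∑ r, G (lam (lgp (PP D R)) r) * oB (up' (PP D R)) r) (hI2 : I2 = ∑ r, G (lam (lgp (PP D R)) r)^2 * oB (up' (PP D R)) r) (hI2p : 0 < I2)
    (hμ1 : ∑ r, G (lam (lgp (PP D R)) r) * oB (up' (PP D R)) r * lam (lgp (PP D R)) r ≤ μ1 * I1)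
    (hμ2 : ∑ r, G (lam (lgp (PP D R)) r)^2 * oB (up' (PP D R)) r * lam (lgp (PP D R)) r ≤ μ2 * I2)
    (hμ : μ1 + k * μ2 ≤ ρ/2) (hμ0 : 0 ≤ μ2) (hρ : 0 < ρ) (hX : 0 ≤ X1 L) :
    X1 L / (∏ p ∈ PP 0 D, ((p:ℝ)-1)) * (1/18 * I1^2 * I2^(k-1)) - K/L ≤
      ∑ n ∈ Finset.Ioc 0 (NL L) with n ≡ 1 [MOD Wd D], aw L n * AA h (yy (lgp (PP D R)) ρ G) n ^ 2 := by
  set P := PP D R with hP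
  have hPp : Prm P := PP_prm D R
  have hk : k ≤ D := by nlinarith
  have hk0 : (0:ℝ) ≤ k := Nat.cast_nonneg k
  have hU : Prm (PP 0 D ∪ P) := fun p hp => (Finset.mem_union.1 hp).elim (PP_prm 0 D p) (hPp p)
  have hdis : ∀ S ⊆ P, Disjoint (PP 0 D) S := fun S hS => (PP_disj D R).mono_right hS
  have hq : ∀ S ∈ pw P (exp ρ * exp ρ), ((∏ p ∈ PP 0 D ∪ S, p : ℕ):ℝ) ≤ exp (L/100) := fun S hS => by
    rw [Finset.prod_union (hdis S (mem_pw.1 hS).1), Nat.cast_mul]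
    exact (mul_le_mul_of_nonneg_left (mem_pw.1 hS).2 (Nat.cast_nonneg _)).trans hWL
  have hUS : ∀ S ∈ pw P (exp ρ * exp ρ), Prm (PP 0 D ∪ S) := fun S hS => hU.mono (union_subset_union_right (mem_pw.1 hS).1)
  have key := expand (N := Finset.Ioc 0 (NL L)) hPp (PP_disj D R) (R := exp ρ) h (fun c => (y01 P hG hG1 c).1) (fun c => (y01 (ρ := ρ) P hG hG1 c).2) (yR hPp) (a := aw L) (B := Bu)
    (fun p => Finset.erase_subset _ _) (fun p hp => Finset.mem_erase.2 ⟨one_ne_zero, Finset.mem_range.2 hp.one_lt⟩) (X := X1 L) (E := fun S => Er (∏ p ∈ PP 0 D ∪ S, p) L) (fun _ => Er_nonneg _ _)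
    (fun n _ han p hp => ?_) (fun p hp j => hloc (hPp p hp) (Finset.erase_subset _ _) j)
    (fun S hS b hb => by
      rw [← tot (hUS S hS)]
      refine progression hL (prod_pos' (hUS S hS)).ne' (hq S hS) ?_
      refine Nat.Coprime.prod_right fun p hp => ?_
      rw [Nat.coprime_comm, (hUS S hS p hp).coprime_iff_not_dvd]
      intro hd
      exact (Finset.mem_erase.1 (hb p hp)).1 (Nat.mod_eq_zero_of_dvd hd))
  swap
  · refine Bu_mem (hU p hp) (aw_coprime hL (hU p hp).ne_zero ?_ han)
    rcases Finset.mem_union.1 hp with h1 | h1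
    · exact le_trans (by exact_mod_cast (Finset.mem_Ioc.1 (mem_filter.1 h1).1).2) hDL
    · exact le_trans (by exact_mod_cast (Finset.mem_Ioc.1 (mem_filter.1 h1).1).2) hRL
  have hE : ∑ S ∈ pw P (exp ρ * exp ρ), ((2 * (k+1)^2 : ℕ):ℝ)^(#S) * Er (∏ p ∈ PP 0 D ∪ S, p) L ≤ K/L := by
    refine le_trans (sum_le_inj (fun S => PP 0 D ∪ S) (fun S hS => mem_pw.2 ⟨union_subset_union_right (mem_pw.1 hS).1, hq S hS⟩) ?_ ?_ ?_) (hBV _ hU)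
    · intro S hS T hT e
      have e' : (PP 0 D ∪ S) \ PP 0 D = (PP 0 D ∪ T) \ PP 0 D := by rw [show PP 0 D ∪ S = PP 0 D ∪ T from e]
      rwa [union_sdiff_cancel_left (hdis S (mem_pw.1 hS).1), union_sdiff_cancel_left (hdis T (mem_pw.1 hT).1)] at e'
    · intro S hS
      refine mul_le_mul_of_nonneg_right (pow_le_pow_right₀ ?_ (card_le_card subset_union_right)) (Er_nonneg _ _)
      exact_mod_cast (show 1 ≤ 2*(k+1)^2 by nlinarith)
    · exact fun T _ => mul_nonneg (by positivity) (Er_nonneg _ _)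
  have hloc2 := fun p : P => mm2 (hPp p p.2) (hdiv p.2 hk hh) hi
  have hup : ∀ p : P, 0 ≤ up' P p := fun p => div_nonneg zero_le_one (by have := p_sub (hPp p p.2); linarith)
  have hkD' : (k:ℝ) ≤ (D:ℝ) - 1 := by rw [hD]; push_cast; nlinarith
  have hkD : 3 * (k:ℝ)^2 ≤ (D:ℝ) - 1 := by rw [hD]; push_cast; nlinarith
  have hS := S2abs (ρ := ρ) (m := fun p : P => mm h Bu p) (m' := fun p : P => mu h i p) i (lgp_nonneg P) hup hG ha (fun p a b => (hloc2 p).1 a b)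
    (fun p => (hloc2 p).2.1) (fun p j => (hloc2 p).2.2.1 j) (fun p => (hloc2 p).2.2.2.1) (fun p => offd (hloc2 p).2.2.2.2) (eps (by nlinarith) (by positivity) ?_)
    (fun p => ?_) (by
      rw [Fintype.card_fin]
      have := eps (D := D) (R := R) (C := (k:ℝ)^2) (by nlinarith) (by positivity) hkD
      refine le_trans (le_of_eq ?_) this
      exact Finset.prod_congr rfl fun p _ => by rw [mul_pow]; rfl) hI1 hI2 hI2p hμ1 hμ2 (by rw [Fintype.card_fin]; exact hμ) hμ0 hρ
  rotate_left
  · rw [hD]; push_cast; nlinarith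
  · have h1 : (D:ℝ) < (p:ℕ) := by exact_mod_cast (Finset.mem_Ioc.1 (mem_filter.1 p.2).1).1
    rw [Fintype.card_fin, up', mul_one_div, div_le_one (by linarith)]
    linarith
  rw [Fintype.card_fin] at hS
  have h1 := (abs_le.1 (key.trans hE)).1
  rw [Finset.prod_congr rfl fun p hp => Bu_card (PP_prm 0 D p hp)] at h1
  have h2 := mul_le_mul_of_nonneg_left hS (div_nonneg hX (Finset.prod_nonneg fun p hp => ?_) : 0 ≤ X1 L / (∏ p ∈ PP 0 D, ((p:ℝ)-1)))
  swap
  · have := p_sub (PP_prm 0 D p hp); linarith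
  change _ ≤ ∑ n ∈ Finset.Ioc 0 (NL L) with n ≡ 1 [MOD Wd D], _ - _ at h1
  linarith
end BD
namespace BD
open Finset Topology
noncomputable def ind (x t : ℝ) : ℝ := if x ≤ t then 1 else 0
lemma ind01 (x t : ℝ) : ind x t = 0 ∨ ind x t = 1 := by unfold ind; split_ifs <;> simp
lemma ind_nonneg (x t : ℝ) : 0 ≤ ind x t := by rcases ind01 x t with h | h <;> rw [h]; exact zero_le_one
lemma ind_mul (x t : ℝ) : ind x t * x ≤ t * ind x t := by unfold ind; split_ifs <;> simp; assumption
lemma bridge {P : Finset ℕ} (hP : Prm P) (t : ℝ) : ∑ r, ind (lam (lgp P) r) t * oB (up' P) r = VV P (exp t) := by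
  classical
  rw [VV, pw, sum_filter]
  symm
  refine Finset.sum_bij' (i := fun S _ => fun p : P => decide ((p:ℕ) ∈ S)) (j := fun r _ => P.filter fun p => ∃ h : p ∈ P, r ⟨p, h⟩ = true) (fun _ _ => Finset.mem_univ _)
    (fun r _ => mem_powerset.2 (filter_subset _ _)) ?_ ?_ ?_
  · intro S hS
    ext p
    simp only [mem_filter, decide_eq_true_eq]
    exact ⟨fun h => h.2.2, fun h => ⟨mem_powerset.1 hS h, mem_powerset.1 hS h, h⟩⟩
  · intro r _
    funext p
    simp
  · intro S hS
    have hSP := mem_powerset.1 hS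
    have hpos : (0:ℝ) < (∏ p ∈ S, p : ℕ) := by exact_mod_cast prod_pos' (hP.mono hSP)
    have h1 : lam (lgp P) (fun p : P => decide ((p:ℕ) ∈ S)) = log (∏ p ∈ S, p : ℕ) := by
      simp only [lam, decide_eq_true_eq, lgp]
      rw [Finset.sum_coe_sort P (fun p => if p ∈ S then log p else 0), ← sum_filter, filter_mem_eq_inter, inter_eq_right.2 hSP, Nat.cast_prod,
        log_prod (fun p hp => by exact_mod_cast (hP p (hSP hp)).ne_zero)]
    have h2 : oB (up' P) (fun p : P => decide ((p:ℕ) ∈ S)) = om S := by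
      simp only [oB, decide_eq_true_eq, up', om]
      rw [Finset.prod_coe_sort P (fun p => if p ∈ S then 1/((p:ℝ)-1) else 1), ← Finset.prod_filter, filter_mem_eq_inter, inter_eq_right.2 hSP]
    rw [h1, h2, ind]
    simp only [log_le_iff_le_exp hpos]
    split_ifs <;> simp
lemma gsq (n : ℕ) : ∀ (a : ℕ → ℝ), (∀ j, a j = 0 ∨ a j = 1) → 0 ≤ ∑ j ∈ Finset.range n, (1/2:ℝ)^(j+1) * a j ∧ ∑ j ∈ Finset.range n, (1/2:ℝ)^(j+1) * a j ≤ 1 ∧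
    (∑ j ∈ Finset.range n, (1/2:ℝ)^(j+1) * a j)^2 ≤ ∑ j ∈ Finset.range n, (1/4:ℝ)^j * a j := by
  induction n with
  | zero => intro a _; simp
  | succ n ih =>
    intro a ha
    obtain ⟨h1, h2, h3⟩ := ih (fun j => a (j+1)) fun j => ha _
    set s := ∑ j ∈ Finset.range n, (1/2:ℝ)^(j+1) * a (j+1) with hs
    have e1 : ∑ j ∈ Finset.range (n+1), (1/2:ℝ)^(j+1) * a j = 1/2 * s + 1/2 * a 0 := by
      rw [sum_range_succ', hs, mul_sum]
      congr 1
      · exact sum_congr rfl fun j _ => by ring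
      · ring
    have e2 : ∑ j ∈ Finset.range (n+1), (1/4:ℝ)^j * a j = 1/4 * (∑ j ∈ Finset.range n, (1/4:ℝ)^j * a (j+1)) + a 0 := by
      rw [sum_range_succ', mul_sum]
      congr 1
      · exact sum_congr rfl fun j _ => by ring
      · ring
    rw [e1, e2]
    rcases ha 0 with h | h <;> rw [h] <;> refine ⟨by linarith, by linarith, by nlinarith⟩
noncomputable def Gf (J : ℕ) (ℓ x : ℝ) : ℝ := ∑ j ∈ Finset.range (J+1), (1/2:ℝ)^(j+1) * ind x (2^j * ℓ)
lemma Gf_prop (J : ℕ) (ℓ x : ℝ) : 0 ≤ Gf J ℓ x ∧ Gf J ℓ x ≤ 1 ∧ Gf J ℓ x ^ 2 ≤ ∑ j ∈ Finset.range (J+1), (1/4:ℝ)^j * ind x (2^j * ℓ) :=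
  gsq (J+1) (fun j => ind x (2^j * ℓ)) fun _ => ind01 _ _
lemma Gf_anti (J : ℕ) (ℓ : ℝ) : Antitone (Gf J ℓ) := fun x y hxy => by
  refine sum_le_sum fun j _ => mul_le_mul_of_nonneg_left ?_ (by positivity)
  unfold ind
  split_ifs with h1 h2
  · exact le_rfl
  · exact absurd (hxy.trans h1) h2
  · exact zero_le_one
  · exact le_rfl
lemma moments {J D R : ℕ} {ℓ : ℝ} (hl : 1 + log (Wd D) ≤ ℓ) (hR : exp (2^J * ℓ) ≤ R) :
    ∃ I1 I2, I1 = ∑ r, Gf J ℓ (lam (lgp (PP D R)) r) * oB (up' (PP D R)) r ∧ I2 = ∑ r, Gf J ℓ (lam (lgp (PP D R)) r)^2 * oB (up' (PP D R)) r ∧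
      ((J:ℝ)+1) * (kap D * ℓ) / 4 ≤ I1 ∧ kap D * ℓ / 8 ≤ I2 ∧ I2 ≤ 12 * (kap D * ℓ) ∧
      ∑ r, Gf J ℓ (lam (lgp (PP D R)) r) * oB (up' (PP D R)) r * lam (lgp (PP D R)) r ≤ (2^J * ℓ) * I1 ∧
      ∑ r, Gf J ℓ (lam (lgp (PP D R)) r)^2 * oB (up' (PP D R)) r * lam (lgp (PP D R)) r ≤ (48 * ((J:ℝ)+1) * ℓ) * I2 := by
  set P := PP D R with hP
  have hPp : Prm P := PP_prm D R
  have hκ := kap_pos D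
  have hW : 0 ≤ log (Wd D) := log_natCast_nonneg _
  have hl0 : 0 < ℓ := by linarith
  have ho : ∀ r, 0 ≤ oB (up' P) r := oB_nonneg fun p => div_nonneg zero_le_one (by have := p_sub (hPp p p.2); linarith)
  set Vt : ℕ → ℝ := fun j => ∑ r, ind (lam (lgp P) r) (2^j * ℓ) * oB (up' P) r with hVt
  have hV : ∀ j ∈ Finset.range (J+1), kap D * (1/2 * (2^j * ℓ)) ≤ Vt j ∧ Vt j ≤ 6 * kap D * (2^j * ℓ) := by
    intro j hj
    have h1 : (1:ℝ) ≤ 2^j := one_le_pow₀ (by norm_num)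
    have h1' : (2:ℝ)^j ≤ 2^J := pow_le_pow_right₀ (by norm_num) (by have := Finset.mem_range.1 hj; omega)
    have h2 : ℓ ≤ 2^j * ℓ := by nlinarith
    have hz : 1 ≤ exp (2^j * ℓ) := one_le_exp (by linarith)
    rw [hVt]
    simp only
    rw [bridge hPp]
    constructor
    · have := VV_lo (D := D) hz (le_trans (exp_le_exp.2 (mul_le_mul_of_nonneg_right h1' hl0.le)) hR)
      rwa [log_exp] at this
    · have h3 := VV_up (D := D) (R := R) hz
      rw [log_mul (exp_pos _).ne' (by exact_mod_cast (Wd_pos D).ne'), log_exp] at h3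
      refine h3.trans ?_
      change kap D * (exp 1 * (1 + (2^j * ℓ + log (Wd D)))) ≤ _
      rw [mul_comm 6, mul_assoc]
      refine mul_le_mul_of_nonneg_left ?_ hκ.le
      have := exp_one_lt_d9
      nlinarith [exp_pos 1]
  have sw : ∀ (f : ℕ → ℝ) (g : (P → Bool) → ℝ), ∑ r, (∑ j ∈ Finset.range (J+1), f j * ind (lam (lgp P) r) (2^j * ℓ)) * g r =
      ∑ j ∈ Finset.range (J+1), f j * ∑ r, ind (lam (lgp P) r) (2^j * ℓ) * g r := fun f g => by
    simp only [mul_sum, sum_mul]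
    rw [sum_comm]
    simp only [mul_assoc]
  have hc : ∀ j : ℕ, (1/4:ℝ)^j * 2^j = (1/2)^j := fun j => by rw [← mul_pow]; norm_num
  have hI2 : kap D * ℓ / 8 ≤ ∑ r, Gf J ℓ (lam (lgp P) r)^2 * oB (up' P) r := by
    have h1 := (hV 0 (by simp)).1
    calc kap D * ℓ / 8 ≤ 1/4 * Vt 0 := by simp only [pow_zero, one_mul] at h1; linarith
      _ = ∑ r, 1/4 * (ind (lam (lgp P) r) ℓ * oB (up' P) r) := by simp only [hVt, pow_zero, one_mul, mul_sum]
      _ ≤ _ := by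
        refine sum_le_sum fun r _ => ?_
        rw [← mul_assoc]
        refine mul_le_mul_of_nonneg_right ?_ (ho r)
        have h2 : 1/2 * ind (lam (lgp P) r) ℓ ≤ Gf J ℓ (lam (lgp P) r) := by
          rw [Gf, sum_range_succ']
          have : 0 ≤ ∑ j ∈ Finset.range J, (1/2:ℝ)^(j+1+1) * ind (lam (lgp P) r) (2^(j+1) * ℓ) := sum_nonneg fun j _ => mul_nonneg (by positivity) (ind_nonneg _ _)
          simp only [pow_zero, one_mul, zero_add, pow_one]
          linarith
        rcases ind01 (lam (lgp P) r) ℓ with h3 | h3 <;> rw [h3] at h2 ⊢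
        · rw [mul_zero]; positivity
        · nlinarith
  refine ⟨_, _, rfl, rfl, ?_, hI2, ?_, ?_, ?_⟩
  · rw [show ∑ r, Gf J ℓ (lam (lgp P) r) * oB (up' P) r = ∑ j ∈ Finset.range (J+1), (1/2:ℝ)^(j+1) * Vt j from sw _ _]
    calc _ = ∑ j ∈ Finset.range (J+1), kap D * ℓ / 4 := by rw [sum_const, card_range, nsmul_eq_mul]; push_cast; ring
      _ ≤ _ := sum_le_sum fun j hj => by
        refine le_trans (le_of_eq ?_) (mul_le_mul_of_nonneg_left (hV j hj).1 (by positivity))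
        have : (1/2:ℝ)^j * 2^j = 1 := by rw [← mul_pow]; norm_num
        linear_combination (-(kap D * ℓ / 4)) * this
  · calc _ ≤ ∑ r, (∑ j ∈ Finset.range (J+1), (1/4:ℝ)^j * ind (lam (lgp P) r) (2^j * ℓ)) * oB (up' P) r :=
          sum_le_sum fun r _ => mul_le_mul_of_nonneg_right (Gf_prop _ _ _).2.2 (ho r)
      _ = ∑ j ∈ Finset.range (J+1), (1/4:ℝ)^j * Vt j := sw _ _
      _ ≤ ∑ j ∈ Finset.range (J+1), 6 * (kap D * ℓ) * (1/2:ℝ)^j := sum_le_sum fun j hj => by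
          refine le_trans (mul_le_mul_of_nonneg_left (hV j hj).2 (by positivity)) (le_of_eq ?_)
          rw [← hc]; ring
      _ ≤ _ := by
          rw [← mul_sum]
          have : ∑ j ∈ Finset.range (J+1), (1/2:ℝ)^j ≤ 2 := sum_geometric_two_le _
          nlinarith [mul_pos hκ hl0]
  · rw [mul_sum]
    refine sum_le_sum fun r _ => ?_
    have : Gf J ℓ (lam (lgp P) r) * lam (lgp P) r ≤ 2^J * ℓ * Gf J ℓ (lam (lgp P) r) := by
      rw [Gf, sum_mul, mul_sum]
      refine sum_le_sum fun j hj => ?_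
      have h1' : (2:ℝ)^j ≤ 2^J := pow_le_pow_right₀ (by norm_num) (by have := Finset.mem_range.1 hj; omega)
      have h3 := (ind_mul (lam (lgp P) r) (2^j * ℓ)).trans (mul_le_mul_of_nonneg_right (mul_le_mul_of_nonneg_right h1' hl0.le) (ind_nonneg _ _))
      have := mul_le_mul_of_nonneg_left h3 (by positivity : (0:ℝ) ≤ (1/2)^(j+1))
      linarith
    have := mul_le_mul_of_nonneg_right this (ho r)
    linarith
  · have hlam : ∀ r, 0 ≤ lam (lgp P) r := fun r => sum_nonneg fun p _ => by split_ifs <;> [exact lgp_nonneg P p; exact le_rfl]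
    calc _ ≤ ∑ r, (∑ j ∈ Finset.range (J+1), (1/4:ℝ)^j * ind (lam (lgp P) r) (2^j * ℓ)) * (oB (up' P) r * lam (lgp P) r) :=
          sum_le_sum fun r _ => by
            rw [mul_assoc]
            exact mul_le_mul_of_nonneg_right (Gf_prop _ _ _).2.2 (mul_nonneg (ho r) (hlam r))
      _ = ∑ j ∈ Finset.range (J+1), (1/4:ℝ)^j * ∑ r, ind (lam (lgp P) r) (2^j * ℓ) * (oB (up' P) r * lam (lgp P) r) := sw _ _
      _ ≤ ∑ j ∈ Finset.range (J+1), 6 * (kap D * ℓ) * ℓ := sum_le_sum fun j hj => by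
          have h1 : ∑ r, ind (lam (lgp P) r) (2^j * ℓ) * (oB (up' P) r * lam (lgp P) r) ≤ (2^j * ℓ) * Vt j := by
            rw [hVt, mul_sum]
            refine sum_le_sum fun r _ => ?_
            have := mul_le_mul_of_nonneg_right (ind_mul (lam (lgp P) r) (2^j * ℓ)) (ho r)
            linarith
          have h2 := h1.trans (mul_le_mul_of_nonneg_left (hV j hj).2 (by positivity))
          refine le_trans (mul_le_mul_of_nonneg_left h2 (by positivity)) (le_of_eq ?_)
          have : (1/4:ℝ)^j * (2^j * 2^j) = 1 := by rw [← mul_pow, ← mul_pow]; norm_num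
          linear_combination (6 * (kap D * ℓ) * ℓ) * this
      _ = ((J:ℝ)+1) * ℓ * (6 * (kap D * ℓ)) := by rw [sum_const, card_range, nsmul_eq_mul]; push_cast; ring
      _ ≤ _ := by
          have : 0 ≤ ((J:ℝ)+1) * ℓ := by positivity
          nlinarith [mul_le_mul_of_nonneg_left hI2 this]
end BD
namespace BD
open Finset Topology
lemma AA_shift {k : ℕ} {P : Finset ℕ} {h h0 : Fin k → ℤ} {a : ℤ} (hh : ∀ j, h j = h0 j - a) (y : (P → Option (Fin k)) → ℝ) (n : ℤ) : AA h y n = AA h0 y (n - a) := by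
  unfold AA
  refine sum_congr rfl fun c _ => ?_
  congr 1
  refine Finset.prod_congr rfl fun p _ => ?_
  cases c p with
  | none => rfl
  | some j => simp only [xi]; rw [hh, show n + (h0 j - a) = n - a + h0 j by ring]
lemma pair {k W : ℕ} {L : ℝ} {P : Finset ℕ} (y : (P → Option (Fin k)) → ℝ) (hL : 0 < L) (hkW : ((k * W : ℕ):ℝ) ≤ exp (L-4)) (hW : 0 < W)
    (hno : ¬ ∃ p q : ℕ, p.Prime ∧ q.Prime ∧ exp (L-4) < p ∧ p < q ∧ q ≤ p + k * W) :
    ∑ i : Fin k, ∑ n ∈ Finset.Ioc 0 (NL L) with n ≡ 1 [MOD W], aw L n * AA (fun j => ((j:ℕ) - (i:ℕ) : ℤ) * W) y n ^ 2 ≤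
      ((L+4) * exp (4-L)) * ∑ m ∈ Finset.range (NL L + 1) with m ≡ 1 [MOD W], AA (fun j => ((j:ℕ):ℤ) * W) y m ^ 2 := by
  have hC : 0 ≤ (L+4) * exp (4-L) := by positivity
  have h1 : ∀ i : Fin k, ∑ n ∈ Finset.Ioc 0 (NL L) with n ≡ 1 [MOD W], aw L n * AA (fun j => ((j:ℕ) - (i:ℕ) : ℤ) * W) y n ^ 2 ≤
      ∑ m ∈ Finset.range (NL L + 1) with m ≡ 1 [MOD W], aw L (m + i * W) * AA (fun j => ((j:ℕ):ℤ) * W) y m ^ 2 := by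
    intro i
    rw [← sum_filter_of_ne (p := fun n => aw L n ≠ 0) (fun n _ hn h0 => hn (by rw [h0, zero_mul]))]
    have hiW : ∀ n, aw L n ≠ 0 → i * W ≤ n := fun n hn => by
      have h2 := (aw_win hn).2.1
      have h3 : ((k * W : ℕ):ℝ) < n := lt_of_le_of_lt hkW h2
      have h4 : k * W < n := by exact_mod_cast h3
      exact (Nat.mul_le_mul_right W i.2.le).trans h4.le
    refine sum_le_inj (fun n => n - i * W) ?_ ?_ ?_ (fun m _ => mul_nonneg (aw_nonneg _ _) (sq_nonneg _))
    · intro n hn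
      obtain ⟨hn1, hn2⟩ := mem_filter.1 hn
      obtain ⟨hn3, hn4⟩ := mem_filter.1 hn1
      refine mem_filter.2 ⟨Finset.mem_range.2 ?_, ?_⟩
      · have := (Finset.mem_Ioc.1 hn3).2; omega
      · have h5 := Nat.sub_add_cancel (hiW n hn2)
        have h6 : n - i * W ≡ n - i * W + i * W [MOD W] := by
          simp [Nat.ModEq]
        rw [h5] at h6
        exact h6.trans hn4
    · intro n hn n' hn' e
      have e1 := hiW n (mem_filter.1 hn).2
      have e2 := hiW n' (mem_filter.1 hn').2
      omega
    · intro n hn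
      have h5 := Nat.sub_add_cancel (hiW n (mem_filter.1 hn).2)
      rw [h5, AA_shift (h0 := fun j => ((j:ℕ):ℤ) * W) (a := ((i:ℕ):ℤ) * W) (fun j => by ring), Nat.cast_sub (hiW n (mem_filter.1 hn).2)]
      push_cast
      exact le_rfl
  refine (sum_le_sum fun i _ => h1 i).trans ?_
  rw [sum_comm, mul_sum]
  refine sum_le_sum fun m _ => ?_
  rw [← sum_mul]
  refine mul_le_mul_of_nonneg_right ?_ (sq_nonneg _)
  by_cases hz : ∃ i : Fin k, aw L (m + i * W) ≠ 0
  · obtain ⟨i, hi⟩ := hz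
    rw [Finset.sum_eq_single i]
    · exact aw_le hL _
    · intro j _ hj
      by_contra hj0
      obtain ⟨a1, a2, _⟩ := aw_win hi
      obtain ⟨b1, b2, _⟩ := aw_win hj0
      have hb : ∀ i' : Fin k, (i':ℕ) * W ≤ k * W := fun i' => Nat.mul_le_mul_right W i'.2.le
      have hne : (i:ℕ) ≠ j := fun e => hj (Fin.ext e.symm)
      have c1 := hb i
      have c2 := hb j
      rcases lt_or_gt_of_ne hne with h | h
      · have c3 := Nat.mul_lt_mul_of_pos_right h hW
        exact hno ⟨_, _, a1, b1, a2, by omega, by omega⟩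
      · have c3 := Nat.mul_lt_mul_of_pos_right h hW
        exact hno ⟨_, _, b1, a1, b2, by omega, by omega⟩
    · exact fun h => absurd (Finset.mem_univ i) h
  · push Not at hz
    rw [sum_eq_zero fun i _ => hz i]; exact hC
lemma kapW (D : ℕ) : ∏ p ∈ PP 0 D, ((p:ℝ)-1) = kap D * Wd D := by
  rw [kap, Wd, Nat.cast_prod, ← Finset.prod_mul_distrib]
  refine Finset.prod_congr rfl fun p hp => ?_
  have : (p:ℝ) ≠ 0 := by exact_mod_cast (PP_prm 0 D p hp).ne_zero
  field_simp
lemma arith {k J1 κ W ℓ L I1 I2 Q X K S E : ℝ} (hk : 1 ≤ k) (hJ : 1 ≤ J1) (hκ : 0 < κ) (hW : 0 < W) (hℓ : 0 < ℓ) (hL : 4 ≤ L) (hkJ : k * J1 * ℓ = L/39200)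
    (hI1 : J1 * (κ * ℓ)/4 ≤ I1) (hI20 : 0 ≤ I2) (hI2 : I2 ≤ 12 * (κ * ℓ)) (hQ : 1 ≤ Q) (hX : exp (-7) ≤ X) (hE : (L+4) * exp (4-L) * E ≤ 2*L) (hK : k * (K/L) ≤ L)
    (hκℓ : 3 * W ≤ κ * ℓ) (hJJ : exp 7 * (288 * 39200) * (36 * exp 9 + 1) < J1)
    (hS : k * (X/(κ * W) * (1/18 * I1^2 * Q) - K/L) ≤ (L+4) * exp (4-L) * S) (hS1 : S ≤ exp (L+5)/W * (3/2 * (I2 * Q)) + E) : False := by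
  have hL0 : 0 < L := by linarith
  have hX0 : 0 < X := (exp_pos _).trans_le hX
  set T := Q * (κ * ℓ) * L / W with hT
  have hTp : 0 < T := by positivity
  have a1 : exp (-7) * J1 / (288 * 39200) * T ≤ k * (X/(κ * W) * (1/18 * I1^2 * Q)) := by
    have b1 : (J1 * (κ * ℓ)/4)^2 ≤ I1^2 := pow_le_pow_left₀ (by positivity) hI1 2
    calc _ = k * (exp (-7)/(κ * W) * (1/18 * (J1 * (κ * ℓ)/4)^2 * Q)) := by
          rw [hT, show L = k * J1 * ℓ * 39200 by rw [hkJ]; ring]; field_simp; ring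
      _ ≤ _ := by gcongr
  have a2 : (L+4) * exp (4-L) * S ≤ 36 * exp 9 * T + 2*L := by
    calc _ ≤ (L+4) * exp (4-L) * (exp (L+5)/W * (3/2 * (I2 * Q)) + E) := by gcongr
      _ = (L+4) * (exp (4-L) * exp (L+5)) * (3/2 * (I2*Q))/W + (L+4) * exp (4-L) * E := by ring
      _ ≤ (2*L) * (exp (4-L) * exp (L+5)) * (3/2 * (12 * (κ * ℓ)*Q))/W + 2*L := by gcongr; linarith
      _ = _ := by rw [← exp_add, show 4 - L + (L+5) = 9 by ring, hT]; ring
  have a3 : 3 * L ≤ T := by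
    rw [hT, le_div_iff₀ hW]
    nlinarith [mul_le_mul_of_nonneg_right hQ (mul_pos (mul_pos hκ hℓ) hL0).le]
  have a4 : exp (-7) * J1 / (288 * 39200) * T ≤ (36 * exp 9 + 1) * T := by nlinarith
  have a5 := le_of_mul_le_mul_right a4 hTp
  rw [div_le_iff₀ (by norm_num), exp_neg, inv_mul_le_iff₀ (exp_pos 7)] at a5
  linarith
end BD
namespace BD
open Finset Topology
set_option maxHeartbeats 1000000 in
theorem bounded_gaps : ∃ H : ℕ, ∃ᶠ L : ℝ in atTop, ∃ p q : ℕ, p.Prime ∧ q.Prime ∧ exp (L-4) < p ∧ p < q ∧ q ≤ p + H := by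
  obtain ⟨J, hJ⟩ := exists_nat_gt (exp 7 * (288 * 39200) * (36 * exp 9 + 1))
  obtain ⟨k, hk⟩ : ∃ k, k = 2^J := ⟨_, rfl⟩
  have hk1 : 1 ≤ k := hk ▸ Nat.one_le_two_pow
  have hk1' : (1:ℝ) ≤ k := by exact_mod_cast hk1
  obtain ⟨D, hD⟩ : ∃ D, D = 10*(k+1)^2 := ⟨_, rfl⟩
  obtain ⟨A, K, L0, hA, hBV⟩ := BV (2*(k+1)^2)
  obtain ⟨LX, hX1⟩ := X1_ge
  refine ⟨k * Wd D, ?_⟩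
  have hκ := kap_pos D
  have hW : (0:ℝ) < Wd D := by exact_mod_cast Wd_pos D
  obtain ⟨β, hβ⟩ : ∃ β : ℝ, β = 1/(39200 * (k * ((J:ℝ)+1))) := ⟨_, rfl⟩
  have hβ0 : 0 < β := by rw [hβ]; positivity
  have hev : ∀ᶠ L : ℝ in atTop, L0 ≤ L ∧ LX ≤ L ∧ 100 ≤ L ∧ 100 * (D:ℝ) ≤ L ∧ 200 * (Wd D:ℝ) ≤ L ∧ ((k * Wd D : ℕ):ℝ) + 4 ≤ L ∧ k * |K| ≤ L ∧ (1 + log (Wd D))/β ≤ L ∧ (8 + 3 * Wd D)/(kap D * β) ≤ L := by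
    simp only [eventually_and]
    exact ⟨eventually_ge_atTop _, eventually_ge_atTop _, eventually_ge_atTop _, eventually_ge_atTop _, eventually_ge_atTop _, eventually_ge_atTop _, eventually_ge_atTop _, eventually_ge_atTop _, eventually_ge_atTop _⟩
  refine ((exists_good hA).and_eventually hev).mono ?_
  rintro L ⟨hgood, c1, c2, c3, c4, c5, c6, c7, c8, c9⟩
  by_contra hno
  obtain ⟨ρ, hρ⟩ : ∃ ρ, ρ = L/400 := ⟨_, rfl⟩
  obtain ⟨ℓ, hℓ⟩ : ∃ ℓ, ℓ = β * L := ⟨_, rfl⟩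
  have hL0 : 0 < L := by linarith
  have hρ0 : 0 < ρ := by rw [hρ]; positivity
  have hℓ0 : 0 < ℓ := by rw [hℓ]; positivity
  have hkJ : k * ((J:ℝ)+1) * ℓ = L/39200 := by rw [hℓ, hβ]; field_simp
  have hJ1 : (1:ℝ) ≤ (J:ℝ)+1 := by linarith [(Nat.cast_nonneg J : (0:ℝ) ≤ J)]
  have hkℓ : k * ℓ ≤ L/39200 := by
    rw [← hkJ]; exact mul_le_mul_of_nonneg_right (le_mul_of_one_le_right (by positivity) hJ1) hℓ0.le
  obtain ⟨R, hR⟩ : ∃ R, R = ⌈exp ρ⌉₊ := ⟨_, rfl⟩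
  have hlW : 1 + log (Wd D) ≤ ℓ := by rw [div_le_iff₀ hβ0] at c8; rw [hℓ]; linarith
  have hκℓ : 8 + 3 * (Wd D:ℝ) ≤ kap D * ℓ := by rw [div_le_iff₀ (by positivity)] at c9; rw [hℓ]; linarith
  have hkc : ((k:ℕ):ℝ) = 2^J := by rw [hk]; push_cast; rfl
  obtain ⟨I1, I2, hI1, hI2, d1, d2, d3, d4, d5⟩ := moments (J := J) (D := D) (R := R) (ℓ := ℓ) hlW (by
    refine le_trans (exp_le_exp.2 ?_) (hR ▸ Nat.le_ceil _)
    rw [← hkc]; linarith)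
  have hmu : 2^J * ℓ + k * (48 * ((J:ℝ)+1) * ℓ) ≤ ρ/2 := by
    rw [← hkc, show k * (48 * ((J:ℝ)+1) * ℓ) = 48 * (k * ((J:ℝ)+1) * ℓ) by ring, hkJ, hρ]; linarith
  have hI2p : 1 ≤ I2 := by linarith
  have hG := fun x => (Gf_prop J ℓ x).1
  have hG1 := fun x => (Gf_prop J ℓ x).2.1
  have hexp : ∀ x : ℝ, x ≤ exp x := fun x => by linarith [add_one_le_exp x]
  have hRL : (R:ℝ) ≤ exp (L/100) := by
    have e1 : (R:ℝ) < exp ρ + 1 := hR ▸ Nat.ceil_lt_add_one (exp_pos _).le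
    have e2 : 1 ≤ exp ρ := one_le_exp hρ0.le
    have e3 : exp (L/100) = exp ρ * exp (3 * L/400) := by rw [← exp_add, hρ]; congr 1; ring
    have e4 : 7/4 ≤ exp (3*L/400) := by linarith [add_one_le_exp (3*L/400)]
    have e5 : 2 ≤ exp (3*L/400) := by
      have : exp (3/4) ≤ exp (3*L/400) := exp_le_exp.2 (by linarith)
      have e6 : 1 + 3/4 + (3/4:ℝ)^2/2 ≤ exp (3/4) := quadratic_le_exp_of_nonneg (by norm_num)
      norm_num at e6; linarith
    rw [e3]
    refine le_trans ?_ (mul_le_mul_of_nonneg_left e5 (exp_pos ρ).le)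
    linarith only [e1, e2]
  have hWL : Wd D * (exp ρ * exp ρ) ≤ exp (L/100) := by
    have e3 : exp (L/100) = exp (L/200) * (exp ρ * exp ρ) := by rw [← exp_add, ← exp_add, hρ]; congr 1; ring
    rw [e3]
    refine mul_le_mul_of_nonneg_right (le_trans ?_ (hexp _)) (by positivity)
    linarith
  have hDL : (D:ℝ) ≤ exp (L/100) := le_trans (by linarith) (hexp _)
  have hX := hX1 L c2
  have s1 := S1 (k := k) (D := D) (R := R) (ρ := ρ) hD hG hG1 (Gf_anti J ℓ) (h := fun j => ((j:ℕ):ℤ) * Wd D) (fun j j' => by ring) (NL L + 1)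
  have s2 := fun i : Fin k => S2 (k := k) (D := D) (R := R) (ρ := ρ) (L := L) hD hG hG1 (Gf_anti J ℓ) (h := fun j => ((j:ℕ) - (i:ℕ) : ℤ) * Wd D) (fun j j' => by ring) (i := i) (by ring)
    (by linarith) hDL hRL hWL (hBV L c1 hgood) hI1 hI2 (by linarith) d4 d5 hmu (by positivity) hρ0 ((exp_pos _).le.trans hX)
  have s3 := pair (yy (γ := Fin k) (lgp (PP D R)) ρ (Gf J ℓ)) hL0 (le_trans (by linarith) (hexp (L-4))) (Wd_pos D) hno
  rw [← hI2, show I2^k = I2 * I2^(k-1) by rw [← pow_succ', Nat.sub_add_cancel hk1]] at s1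
  have s4 := (sum_le_sum fun i (_ : i ∈ (Finset.univ : Finset (Fin k))) => s2 i).trans s3
  rw [sum_const, Finset.card_univ, Fintype.card_fin, nsmul_eq_mul, kapW] at s4
  refine arith (E := exp ρ ^ 4) hk1' hJ1 hκ hW hℓ0 (by linarith) hkJ d1 (by linarith) d3 (one_le_pow₀ hI2p) hX ?_ ?_ (by linarith) (by linarith) s4 (s1.trans ?_)
  · rw [← exp_nat_mul, mul_assoc, ← exp_add]
    have : exp (4 - L + (4:ℕ) * ρ) ≤ 1 := exp_le_one_iff.2 (by rw [hρ]; push_cast; linarith)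
    refine (mul_le_mul_of_nonneg_left this (by positivity)).trans ?_
    linarith only [c3]
  · refine le_trans ?_ c7
    refine mul_le_mul_of_nonneg_left ?_ (by positivity)
    rw [div_le_iff₀ hL0]
    exact (le_abs_self K).trans (le_mul_of_one_le_right (abs_nonneg K) (by linarith only [c3]))
  · have e1 : ((NL L + 1 : ℕ):ℝ) ≤ exp (L+5) := by
      push_cast
      have f1 : (NL L:ℝ) ≤ exp (L+4) := Nat.floor_le (exp_pos _).le
      have f2 : exp (L+5) = exp (L+4) * exp 1 := by rw [← exp_add]; congr 1; ring
      have f3 := add_one_le_exp (1:ℝ)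
      have f4 : 1 ≤ exp (L+4) := one_le_exp (by linarith)
      rw [f2]
      refine le_trans ?_ (mul_le_mul_of_nonneg_left f3 (exp_pos _).le)
      linarith only [f1, f4]
    gcongr
lemma gap_freq : ∃ H : ℕ, ∀ N : ℕ, ∃ n ≥ N, Nat.nth Nat.Prime (n+1) ≤ Nat.nth Nat.Prime n + H := by
  obtain ⟨H, hH⟩ := bounded_gaps
  refine ⟨H, fun N => ?_⟩
  obtain ⟨L', ⟨p, q, hp, hq, h1, h2, h3⟩, hL⟩ := (hH.and_eventually (eventually_ge_atTop ((Nat.nth Nat.Prime N:ℝ) + 4))).exists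
  have hNp : Nat.nth Nat.Prime N < p := by
    have : (Nat.nth Nat.Prime N:ℝ) < p := by linarith [add_one_le_exp (L'-4)]
    exact_mod_cast this
  refine ⟨Nat.count Nat.Prime p, ?_, ?_⟩
  · rw [← Nat.nth_count hp] at hNp
    exact ((Nat.nth_lt_nth Nat.infinite_setOfPred_prime).1 hNp).le
  · rw [Nat.nth_count hp]
    refine le_trans ?_ h3
    have h4 : Nat.count Nat.Prime p + 1 ≤ Nat.count Nat.Prime q := Nat.count_strict_mono hp h2
    calc _ ≤ Nat.nth Nat.Prime (Nat.count Nat.Prime q) := (Nat.nth_le_nth Nat.infinite_setOfPred_prime).2 h4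
      _ = q := Nat.nth_count hq
end BD
/-- (Bombieri–Davenport) `liminf (p_{n+1} - p_n)/log p_n ≤ 0.46650`. -/
theorem bombieri_davenport_liminf :
    Filter.liminf
      (fun n : ℕ => ((nthPrime (n + 1) : ℝ) - nthPrime n) / Real.log (nthPrime n))
      Filter.atTop ≤ 0.46650 := by
  obtain ⟨H, hH⟩ := BD.gap_freq
  refine Filter.liminf_le_of_frequently_le ?_ ⟨0, ?_⟩
  · rw [Filter.frequently_atTop]
    intro N
    obtain ⟨n, hn, h⟩ := hH (N + ⌈Real.exp (3 * H)⌉₊)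
    refine ⟨n+1, by omega, ?_⟩
    have h1 : nthPrime (n+1) = Nat.nth Nat.Prime n := rfl
    have h2 : nthPrime (n+1+1) = Nat.nth Nat.Prime (n+1) := rfl
    rw [h1, h2]
    have h3 : n + 2 ≤ Nat.nth Nat.Prime n := Nat.add_two_le_nth_prime n
    have h4 : Real.exp (3 * H) ≤ (Nat.nth Nat.Prime n : ℝ) := by
      refine (Nat.le_ceil _).trans ?_
      exact_mod_cast (by omega : ⌈Real.exp (3 * H)⌉₊ ≤ Nat.nth Nat.Prime n)
    have h5 : (0:ℝ) < Nat.nth Nat.Prime n := by exact_mod_cast (by omega : 0 < Nat.nth Nat.Prime n)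
    have h6 := (Real.le_log_iff_exp_le h5).2 h4
    have h7 : 0 < Real.log (Nat.nth Nat.Prime n) := Real.log_pos (by exact_mod_cast (by omega : 1 < Nat.nth Nat.Prime n))
    rw [div_le_iff₀ h7]
    have h8 : (Nat.nth Nat.Prime (n+1) : ℝ) ≤ Nat.nth Nat.Prime n + H := by exact_mod_cast h
    have h9 : (0:ℝ) ≤ H := Nat.cast_nonneg H
    linarith
  · refine Filter.eventually_map.2 (Filter.Eventually.of_forall fun n => ?_)
    refine div_nonneg (sub_nonneg.2 ?_) (Real.log_natCast_nonneg _)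
    exact_mod_cast (Nat.nth_le_nth Nat.infinite_setOfPred_prime).2 (by omega)
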